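/- arXiv:1512.02079 — 2 statements merged into one kernel-verified Lean document; each statement's English description precedes it below -/
import Mathlib

section
/- Let F be a field of characteristic p > 0 and E = F(b_1^{1/p^{m_1}},…,b_r^{1/p^{m_r}}) a purely inseparable extension with b_1,…,b_r ∈ F∖F^p and integers m_1,…,m_r ≥ 1. Then for n ≥ 1, H_p^{n+1}(E/F) = H_p^2(E/F) ∧ ν̄_{n-1}(F), i.e. the kernel in degree n equals the subgroup of H_p^{n+1}(F) generated by the classes of ω ∧ η where the 1-form ω ∈ Ω_F^1 represents a class in H_p^2(E/F) (as given by the generating system of the kernel) and η ∈ ν_{n-1}(F). -/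
noncomputable section

/-- The full algebra of absolute differential forms of a field `F`:
the exterior algebra of the `F`-module of absolute Kähler differentials `Ω[F⁄ℤ]`. -/
abbrev DF (F : Type*) [Field F] : Type _ :=
  ExteriorAlgebra F (KaehlerDifferential ℤ F)

/-- `Ω_F^n`, the space of differential `n`-forms, as a submodule of `DF F`. -/
def omegaPow (F : Type*) [Field F] (n : ℕ) : Submodule F (DF F) :=
  LinearMap.range (ExteriorAlgebra.ι F :
    KaehlerDifferential ℤ F →ₗ[F] DF F) ^ n

/-- `Ω_F^{n-1}`, with the convention `Ω_F^{-1} = 0`. -/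
def omegaPred (F : Type*) [Field F] : ℕ → Submodule F (DF F)
  | 0 => ⊥
  | n + 1 => omegaPow F n

/-- The exact 1-form `d a` of an element `a ∈ F`. -/
def dForm (F : Type*) [Field F] (a : F) : DF F :=
  ExteriorAlgebra.ι F (KaehlerDifferential.D ℤ F a)

/-- The logarithmic 1-form `da/a` of an element `a ∈ F`. -/
def dLog (F : Type*) [Field F] (a : F) : DF F :=
  ExteriorAlgebra.ι F (a⁻¹ • KaehlerDifferential.D ℤ F a)

/-- The logarithmic `n`-form `(dx₁/x₁) ∧ … ∧ (dxₙ/xₙ)`. -/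
def logForm (F : Type*) [Field F] {n : ℕ} (x : Fin n → F) : DF F :=
  (List.ofFn fun i => dLog F (x i)).prod

/-- The exterior derivative `d` together with the (`p`-basis dependent) additive map `s_p`
on the differential forms of a field `F` of characteristic `p`. -/
structure DiffStr (p : ℕ) (F : Type*) [Field F] where
  d : DF F →+ DF F
  sp : DF F →+ DF F
  d_grade : ∀ n : ℕ, ∀ ω ∈ omegaPow F n, d ω ∈ omegaPow F (n + 1)
  d_d : ∀ ω : DF F, d (d ω) = 0
  d_one : d 1 = 0
  d_smul : ∀ (a : F) (ω : DF F), d (a • ω) = dForm F a * ω + a • d ω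
  sp_grade : ∀ n : ℕ, ∀ ω ∈ omegaPow F n, sp ω ∈ omegaPow F n
  sp_log : ∀ (n : ℕ) (a : F) (x : Fin n → F),
      ∃ η ∈ omegaPred F n, sp (a • logForm F x) = a ^ p • logForm F x + d η

/-- The Artin–Schreier map `℘ = s_p − id` on differential forms. -/
def asMap {p : ℕ} {F : Type*} [Field F] (S : DiffStr p F) : DF F →+ DF F :=
  S.sp - AddMonoidHom.id (DF F)

/-- The subgroup `℘Ω_F^n + dΩ_F^{n-1}` of `Ω_F^n`; the group `H_p^{n+1}(F)` is the quotient
of `Ω_F^n` by this subgroup. -/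
def hRel {p : ℕ} {F : Type*} [Field F] (S : DiffStr p F) (n : ℕ) : AddSubgroup (DF F) :=
  ((omegaPow F n).toAddSubgroup.map (asMap S)) ⊔ ((omegaPred F n).toAddSubgroup.map S.d)

/-- The `t`-th iterate `v ↦ v^{[p^t]}` of the map `s_p`. -/
def spIter {p : ℕ} {F : Type*} [Field F] (S : DiffStr p F) (t : ℕ) : DF F → DF F :=
  (fun x => S.sp x)^[t]

/-- `ν_n(F) = ker(℘ : Ω_F^n → Ω_F^n/dΩ_F^{n-1})`. -/
def nuSet {p : ℕ} {F : Type*} [Field F] (S : DiffStr p F) (n : ℕ) : Set (DF F) :=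
  { η | η ∈ omegaPow F n ∧ ∃ z ∈ omegaPred F n, S.sp η - η = S.d z }

/-- Restriction of differential forms along a field extension `E/F`. -/
structure DiffRes (p : ℕ) (F E : Type*) [Field F] [Field E] [Algebra F E]
    (SF : DiffStr p F) (SE : DiffStr p E) where
  res : DF F →+ DF E
  res_one : res 1 = 1
  res_mul : ∀ x y : DF F, res (x * y) = res x * res y
  res_smul : ∀ (a : F) (ω : DF F), res (a • ω) = algebraMap F E a • res ω
  res_dForm : ∀ a : F, res (dForm F a) = dForm E (algebraMap F E a)
  res_grade : ∀ n : ℕ, ∀ ω ∈ omegaPow F n, res ω ∈ omegaPow E n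
  res_d : ∀ ω : DF F, res (SF.d ω) = SE.d (res ω)


noncomputable section
namespace KW

open Polynomial in
lemma nodal_univ {p : ℕ} [Fact p.Prime] :
    Lagrange.nodal Finset.univ (id : ZMod p → ZMod p) = X ^ p - X := by
  have h1 := FiniteField.roots_X_pow_card_sub_X (ZMod p)
  rw [ZMod.card] at h1
  have hp : 1 < p := (Fact.out : p.Prime).one_lt
  have hm : (X ^ p - X : (ZMod p)[X]).Monic := by
    apply monic_X_pow_sub
    rw [degree_X]
    exact_mod_cast hp
  have := prod_multiset_X_sub_C_of_monic_of_roots_card_eq hm (by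
    rw [h1, FiniteField.X_pow_card_sub_X_natDegree_eq _ hp]
    simp [ZMod.card])
  rw [← this, h1]
  rfl

open Polynomial in
lemma exists_idem {p : ℕ} [Fact p.Prime] {A : Type*} [Ring A] [CharP A p] (T : A) (hT : T ^ p = T) :
    ∃ q : ZMod p → A, ∑ c, q c = 1 ∧ (∀ c, T * q c = (ZMod.castHom (dvd_refl p) A c) * q c) ∧
      ∀ S : A, Commute S T → ∀ c, Commute S (q c) := by
  let _ : Algebra (ZMod p) A := ZMod.algebra A p
  refine ⟨fun c => aeval T (Lagrange.basis Finset.univ (id : ZMod p → ZMod p) c), ?_, ?_, ?_⟩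
  · rw [← map_sum, Lagrange.sum_basis (Set.injOn_id _) Finset.univ_nonempty, map_one]
  · intro c
    have h1 : (X - C c) * Lagrange.basis Finset.univ (id : ZMod p → ZMod p) c =
        C (Lagrange.nodalWeight Finset.univ id c) * (X ^ p - X) := by
      rw [Lagrange.basis_eq_prod_sub_inv_mul_nodal_div (Finset.mem_univ c),
        ← Lagrange.nodal_erase_eq_nodal_div (Finset.mem_univ c), mul_left_comm]
      have := Lagrange.nodal_eq_mul_nodal_erase (v := (id : ZMod p → ZMod p)) (Finset.mem_univ c)
      rw [← nodal_univ, this]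
      rfl
    have h3 := congrArg (aeval T) h1
    simp only [map_mul, map_sub, aeval_X, aeval_C, map_pow, hT, sub_self, mul_zero, sub_mul] at h3
    exact sub_eq_zero.1 h3
  · intro S hS c
    change Commute S (aeval T (Lagrange.basis Finset.univ (id : ZMod p → ZMod p) c))
    generalize (Lagrange.basis Finset.univ (id : ZMod p → ZMod p) c) = f
    induction f using Polynomial.induction_on' with
    | add f g hf hg => rw [map_add]; exact hf.add_right hg
    | monomial n a =>
      rw [aeval_monomial]
      exact Commute.mul_right (Algebra.commutes a S).symm (hS.pow_right n)

lemma choose_pred_char {p : ℕ} [Fact p.Prime] {A : Type*} [Ring A] [CharP A p] (m : ℕ)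
    (hm : m < p) : ((Nat.choose (p - 1) m : ℕ) : A) = (-1) ^ m := by
  induction m with
  | zero => simp
  | succ m ih =>
    have hp : p.Prime := Fact.out
    have h1 : (p - 1).choose m + (p - 1).choose (m + 1) = p.choose (m + 1) := by
      conv_rhs => rw [← Nat.sub_add_cancel hp.one_le]
      rw [Nat.choose_succ_succ]
    have h2 : ((p.choose (m + 1) : ℕ) : A) = 0 :=
      (CharP.cast_eq_zero_iff A p _).2 (hp.dvd_choose_self (by omega) hm)
    have h3 := congrArg (Nat.cast : ℕ → A) h1
    rw [h2, Nat.cast_add, ih (by omega)] at h3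
    rw [pow_succ, mul_neg, mul_one]
    exact eq_neg_of_add_eq_zero_right h3

lemma neg_one_pow_pred {p : ℕ} [Fact p.Prime] {A : Type*} [Ring A] [CharP A p] :
    (-1 : A) ^ (p - 1) = 1 := by
  have hp : p.Prime := Fact.out
  simpa using (choose_pred_char (A := A) (p - 1) (by have := hp.pos; omega)).symm

lemma sub_pow_pred {p : ℕ} [Fact p.Prime] {A : Type*} [Ring A] [CharP A p] {x y : A}
    (h : Commute x y) : (x - y) ^ (p - 1) = ∑ i ∈ Finset.range p, x ^ i * y ^ (p - 1 - i) := by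
  have hp : p.Prime := Fact.out
  rw [sub_eq_add_neg, (h.neg_right).add_pow, Nat.sub_add_cancel hp.one_le]
  refine Finset.sum_congr rfl fun i hi => ?_
  have hi := Finset.mem_range.1 hi
  rw [choose_pred_char i hi, mul_assoc, neg_pow y, mul_assoc, ← (Commute.neg_one_left _).pow_left i |>.eq, ← mul_assoc ((-1) ^ _),
    ← pow_add, Nat.sub_add_cancel (by omega), neg_one_pow_pred, one_mul]

instance charP_end {p : ℕ} {K : Type*} [CommRing K] [CharP K p] : CharP (Module.End ℤ K) p :=
  charP_of_injective_ringHom (f := (Algebra.lmul ℤ K).toRingHom)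
    (fun a b h => by simpa using congrArg (fun f => f 1) h) p

/-- ad T commutes: iterate. -/
lemma ad_pow_pred {p : ℕ} [Fact p.Prime] {A : Type*} [Ring A] [CharP A p] (Q L : A) :
    ∑ i ∈ Finset.range p, Q ^ i * L * Q ^ (p - 1 - i) = (fun z => Q * z - z * Q)^[p - 1] L := by
  have hc : CharP (Module.End ℤ A) p := charP_of_injective_ringHom (f := (Algebra.lmul ℤ A).toRingHom)
    (fun a b h => by simpa using congrArg (fun f => f 1) h) p
  have h1 := sub_pow_pred (p := p) (LinearMap.commute_mulLeft_right (R := ℤ) Q Q)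
  have h2 := congrArg (fun f => f L) h1
  simp only [Module.End.pow_apply, LinearMap.sum_apply, Module.End.mul_apply] at h2
  have h3 : ⇑(LinearMap.mulLeft ℤ Q - LinearMap.mulRight ℤ Q) = fun z => Q * z - z * Q := by
    ext z; simp
  rw [h3] at h2
  rw [h2]
  refine Finset.sum_congr rfl fun i hi => ?_
  rw [← Module.End.pow_apply, ← Module.End.pow_apply, LinearMap.pow_mulLeft, LinearMap.pow_mulRight]
  simp [mul_assoc]

lemma ad_pow_char {p : ℕ} [Fact p.Prime] {A : Type*} [Ring A] [CharP A p] (Q L : A) :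
    Q ^ p * L - L * Q ^ p = (fun z => Q * z - z * Q)^[p] L := by
  have hc : CharP (Module.End ℤ A) p := charP_of_injective_ringHom (f := (Algebra.lmul ℤ A).toRingHom)
    (fun a b h => by simpa using congrArg (fun f => f 1) h) p
  have h1 := sub_pow_char_of_commute p (LinearMap.commute_mulLeft_right (R := ℤ) Q Q)
  have h2 := congrArg (fun f => f L) h1
  have h3 : ⇑(LinearMap.mulLeft ℤ Q - LinearMap.mulRight ℤ Q) = fun z => Q * z - z * Q := by
    ext z; simp
  simp only [Module.End.pow_apply, h3, LinearMap.pow_mulLeft, LinearMap.pow_mulRight, LinearMap.sub_apply,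
    LinearMap.mulLeft_apply, LinearMap.mulRight_apply] at h2
  rw [h2]


open Polynomial in
lemma jacobson_aux {p : ℕ} [Fact p.Prime] {A : Type*} [Ring A] [CharP A p] (T : A) (g : ℕ → A)
    (hg : ∀ n, T * g n - g n * T = g (n + 1)) (hc : ∀ n, g 0 * g n = g n * g 0) :
    (T + g 0) ^ p = T ^ p + g 0 ^ p + g (p - 1) := by
  have hp : p.Prime := Fact.out
  obtain ⟨Q, hQ⟩ : ∃ Q : A[X], Q = C T + C (g 0) * X := ⟨_, rfl⟩
  have had : ∀ n, Q * C (g n) - C (g n) * Q = C (g (n + 1)) := by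
    intro n
    rw [← hg, hQ, C_sub, C_mul, C_mul, add_mul, mul_add, mul_assoc, X_mul_C, ← mul_assoc,
      ← mul_assoc, ← C_mul (a := g 0), hc n, C_mul]
    abel
  have hdQ : derivative Q = C (g 0) := by
    simp [hQ]
  have hder : derivative (Q ^ p) = C (g (p - 1)) := by
    have h1 : ∀ n : ℕ, derivative (Q ^ n) =
        ∑ i ∈ Finset.range n, Q ^ i * C (g 0) * Q ^ (n - 1 - i) := by
      intro n
      induction n with
      | zero => simp
      | succ n ih =>
        rw [pow_succ, derivative_mul, ih, Finset.sum_range_succ, Finset.sum_mul, hdQ]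
        congr 1
        · refine Finset.sum_congr rfl fun i hi => ?_
          have := Finset.mem_range.1 hi
          rw [mul_assoc _ _ Q, ← pow_succ]
          congr 2; omega
        · simp
    have h2 : ∀ n : ℕ, (fun z => Q * z - z * Q)^[n] (C (g 0)) = C (g n) := by
      intro n
      induction n with
      | zero => rfl
      | succ n ih => rw [Function.iterate_succ_apply', ih, had]
    rw [h1, ad_pow_pred, h2]
  have hd1 : Q.natDegree ≤ 1 := by rw [hQ]; compute_degree
  have hdeg : (Q ^ p).natDegree ≤ p := by
    refine natDegree_pow_le.trans ?_
    nlinarith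
  have hc0 : (Q ^ p).coeff 0 = T ^ p := by
    have h : ∀ n : ℕ, (Q ^ n).coeff 0 = T ^ n := by
      intro n
      induction n with
      | zero => simp
      | succ n ih => rw [pow_succ, mul_coeff_zero, ih, pow_succ]; simp [hQ]
    exact h p
  have hcp : (Q ^ p).coeff p = g 0 ^ p := by
    have h : ∀ n : ℕ, (Q ^ n).coeff n = g 0 ^ n := by
      intro n
      have := coeff_pow_of_natDegree_le (m := n) hd1
      rw [mul_one] at this
      rw [this, hQ]
      simp
    exact h p
  have hck : ∀ k : ℕ, k + 1 < p → (Q ^ p).coeff (k + 1) = if k = 0 then g (p - 1) else 0 := by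
    intro k hk
    have h1 := congrArg (fun f => f.coeff k) hder
    simp only [coeff_derivative, coeff_C] at h1
    split_ifs with h0
    · subst h0; simpa using h1
    · rw [if_neg h0] at h1
      let _ : Algebra (ZMod p) A := ZMod.algebra _ p
      have h2 : ((k : ZMod p) + 1) ≠ 0 := by
        have : ((k + 1 : ℕ) : ZMod p) ≠ 0 := by
          rw [Ne, ZMod.natCast_eq_zero_iff]
          exact Nat.not_dvd_of_pos_of_lt (by omega) hk
        exact_mod_cast this
      have h3 : ((k : A) + 1) = algebraMap (ZMod p) _ ((k : ZMod p) + 1) := by simp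
      rw [h3, ← Algebra.commutes, ← Algebra.smul_def] at h1
      exact (smul_eq_zero_iff_right h2).1 h1
  have hev : (Q ^ p).eval 1 = (T + g 0) ^ p := by
    have h : ∀ n : ℕ, (Q ^ n).eval 1 = (T + g 0) ^ n := by
      intro n
      induction n with
      | zero => simp
      | succ n ih =>
        have h5 := eval₂_mul_noncomm (p := Q ^ n) (q := Q) (f := RingHom.id A) (x := 1)
          (fun k => Commute.one_right _)
        change eval 1 (Q ^ n * Q) = eval 1 (Q ^ n) * eval 1 Q at h5
        rw [pow_succ, h5, ih, pow_succ]
        simp [hQ]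
    exact h p
  rw [← hev, eval_eq_sum_range' (Nat.lt_succ_of_le hdeg), Finset.sum_range_succ, hcp]
  obtain ⟨q, rfl⟩ : ∃ q, p = q + 2 := ⟨p - 2, by have := hp.two_le; omega⟩
  rw [Finset.sum_range_succ', hc0,
    Finset.sum_congr rfl (g := fun k => if k = 0 then g (q + 2 - 1) else 0)]
  · simp; abel
  · intro k hk
    rw [hck k (by have := Finset.mem_range.1 hk; omega)]
    simp

section der
variable {p : ℕ} [Fact p.Prime] {K : Type*} [CommRing K] [CharP K p]

/-- operator of left mult -/
abbrev Lm (a : K) : Module.End ℤ K := LinearMap.mulLeft ℤ a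
abbrev Dm (θ : Derivation ℤ K K) : Module.End ℤ K := θ.toLinearMap

lemma Dm_Lm (θ : Derivation ℤ K K) (a : K) : Dm θ * Lm a - Lm a * Dm θ = Lm (θ a) := by
  ext x; simp [mul_comm]

lemma leib_pow (θ : Derivation ℤ K K) (x y : K) :
    (Dm θ ^ p) (x * y) = x * (Dm θ ^ p) y + y * (Dm θ ^ p) x := by
  have h := ad_pow_char (p := p) (Dm θ) (Lm x)
  have h2 : ∀ n : ℕ, (fun z => Dm θ * z - z * Dm θ)^[n] (Lm x) = Lm ((Dm θ ^ n) x) := by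
    intro n
    induction n with
    | zero => rfl
    | succ n ih => rw [Function.iterate_succ_apply', ih, Dm_Lm, pow_succ']; rfl
  rw [h2] at h
  have := congrArg (fun f => f y) h
  simp only [LinearMap.sub_apply, Module.End.mul_apply, LinearMap.mulLeft_apply] at this
  rw [sub_eq_iff_eq_add] at this
  rw [this]; ring

/-- p-th power of a derivation. -/
def powDer (p : ℕ) [Fact p.Prime] [CharP K p] (θ : Derivation ℤ K K) : Derivation ℤ K K :=
  Derivation.mk' (Dm θ ^ p) (fun a b => by simpa using leib_pow (p := p) θ a b)


lemma jacobson (θ : Derivation ℤ K K) (g : K) :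
    (Dm θ + Lm g) ^ p = Dm θ ^ p + Lm (g ^ p) + Lm ((Dm θ ^ (p - 1)) g) := by
  have h := jacobson_aux (p := p) (Dm θ) (fun n => Lm ((Dm θ ^ n) g))
    (fun n => by rw [Dm_Lm, pow_succ']; rfl) (fun n => by ext x; simp; ring)
  simp only [pow_zero, Module.End.one_apply, LinearMap.pow_mulLeft] at h
  exact h
end der
end KW
end

noncomputable section
namespace KW
set_option linter.all false

/-- A field with commuting derivations `θ i` that are diagonal on a family `t i`. -/
structure PB (p : ℕ) (K : Type*) [Field K] (I : Type*) where
  θ : I → Derivation ℤ K K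
  t : I → K
  t_ne : ∀ i, t i ≠ 0
  comm : ∀ i j x, θ i (θ j x) = θ j (θ i x)
  θ_t : ∀ i, θ i (t i) = t i
  θ_t_ne : ∀ i j, i ≠ j → θ i (t j) = 0
  pow : ∀ i, Dm (θ i) ^ p = Dm (θ i)
  fin : ∀ x, {i | θ i x ≠ 0}.Finite

section gen
variable {p : ℕ} [Fact p.Prime] {K : Type*} [Field K] [CharP K p]

lemma der_pow_char (θ : Derivation ℤ K K) (x : K) : θ (x ^ p) = 0 := by
  rw [Derivation.leibniz_pow]
  simp [← Nat.cast_smul_eq_nsmul K]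

lemma der_natCast (θ : Derivation ℤ K K) (n : ℕ) : θ (n : K) = 0 := by
  simpa using θ.map_natCast n

lemma der_div_pow (θ : Derivation ℤ K K) (x y : K) : θ (x / y ^ p) = θ x / y ^ p := by
  rw [Derivation.leibniz_div_const _ _ _ (der_pow_char θ y), smul_eq_mul]
  field_simp

lemma natCast_pow_char (n : ℕ) : (n : K) ^ p = n := by
  have := map_natCast (frobenius K p) n
  rwa [frobenius_def] at this

lemma logfix_add (y z : K) : ∃ P : K, ∀ θ : Derivation ℤ K K,
    (y + z) ^ (p - 1) * θ (y + z) - (y ^ (p - 1) * θ y + z ^ (p - 1) * θ z) = θ P := by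
  have hp : p.Prime := Fact.out
  obtain ⟨q, hq⟩ : ∃ q, p = q + 1 := ⟨p - 1, by have := hp.pos; omega⟩
  have hq1 : p - 1 = q := by omega
  refine ⟨∑ k ∈ Finset.range q, ((k + 1 : ℕ) : K)⁻¹ * (-1) ^ k * (y ^ (k + 1) * z ^ (q - k)), ?_⟩
  intro θ
  have hs : (y + z) ^ q = ∑ i ∈ Finset.range (q + 1), (-y) ^ i * z ^ (q - i) := by
    have := sub_pow_pred (p := p) (Commute.all (-y) z)
    rw [hq1, ← neg_add', neg_pow, ← hq1, neg_one_pow_pred, one_mul, hq1] at this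
    rw [this, hq]
  have h1 : (y + z) ^ q = ∑ i ∈ Finset.range q, (-y) ^ i * z ^ (q - i) + y ^ q := by
    rw [hs, Finset.sum_range_succ, Nat.sub_self, pow_zero, mul_one, neg_pow]
    rw [← hq1, neg_one_pow_pred, one_mul]
  have h2 : (y + z) ^ q = ∑ i ∈ Finset.range q, (-y) ^ (i + 1) * z ^ (q - (i + 1)) + z ^ q := by
    rw [hs, Finset.sum_range_succ']; simp
  rw [hq1, map_add, mul_add]
  have e1 : (y + z) ^ q * θ y + (y + z) ^ q * θ z - (y ^ q * θ y + z ^ q * θ z)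
    = (∑ i ∈ Finset.range q, (-y) ^ i * z ^ (q - i)) * θ y +
      (∑ i ∈ Finset.range q, (-y) ^ (i + 1) * z ^ (q - (i + 1))) * θ z := by
    have h1' := eq_sub_of_add_eq h1.symm
    have h2' := eq_sub_of_add_eq h2.symm
    rw [h1', h2']; ring
  rw [e1, map_sum, Finset.sum_mul, Finset.sum_mul, ← Finset.sum_add_distrib]
  refine Finset.sum_congr rfl fun k hk => ?_
  have hk := Finset.mem_range.1 hk
  have hk0 : ((k + 1 : ℕ) : K) ≠ 0 := by
    rw [Ne, CharP.cast_eq_zero_iff K p]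
    exact Nat.not_dvd_of_pos_of_lt (by omega) (by omega)
  have hc : θ (((k + 1 : ℕ) : K)⁻¹ * (-1) ^ k) = 0 := by
    have h3 : θ ((-1 : K) ^ k) = 0 := by
      rw [Derivation.leibniz_pow]; simp
    rw [Derivation.leibniz, h3, Derivation.leibniz_inv, der_natCast]; simp
  have hqk : ((q - k : ℕ) : K) = - ((k + 1 : ℕ) : K) := by
    have : ((q - k : ℕ) : K) + ((k + 1 : ℕ) : K) = ((p : ℕ) : K) := by
      rw [← Nat.cast_add]; congr 1; omega
    rw [CharP.cast_eq_zero K p] at this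
    exact eq_neg_of_add_eq_zero_left this
  rw [Derivation.leibniz, hc, Derivation.leibniz, Derivation.leibniz_pow, Derivation.leibniz_pow,
    ← Nat.cast_smul_eq_nsmul K (q - k), ← Nat.cast_smul_eq_nsmul K (k + 1), hqk]
  simp only [smul_eq_mul, mul_zero, add_zero, Nat.add_sub_cancel, Nat.sub_sub]
  field_simp
  rw [neg_pow y, neg_pow y (k + 1)]
  ring

end gen

section pb
variable {p : ℕ} [Fact p.Prime] {K : Type*} [Field K] [CharP K p] {I : Type*} (B : PB p K I)

lemma weight_ind (J : Finset I) : ∀ (M : AddSubgroup K)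
    (_ : ∀ κ : K, (∀ i, B.θ i κ = 0) → ∀ α : I → ℕ, κ * ∏ i ∈ J, B.t i ^ α i ∈ M)
    (x : K) (_ : ∀ i ∉ J, B.θ i x = 0), x ∈ M := by
  classical
  induction J using Finset.induction_on with
  | empty =>
    intro M H x hx
    simpa using H x (fun i => hx i (by simp)) 0
  | insert i J hiJ ih =>
    intro M H x hx
    obtain ⟨q, hq1, hq2, hq3⟩ := exists_idem (Dm (B.θ i)) (B.pow i)
    have hxs : x = ∑ c, q c x := by
      rw [← LinearMap.sum_apply, hq1]; rfl
    rw [hxs]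
    refine sum_mem fun c _ => ?_
    set y := q c x with hy
    have hyi : B.θ i y = (c.val : K) * y := by
      have h1 := congrArg (fun f => f x) (hq2 c)
      have h2 : (ZMod.castHom (dvd_refl p) (Module.End ℤ K)) c = (c.val : Module.End ℤ K) := by
        conv_lhs => rw [← ZMod.natCast_zmod_val c]
        rw [map_natCast]
      rw [h2] at h1
      have h3 : ((c.val : Module.End ℤ K) * q c) x = (c.val : K) * y := by
        rw [← nsmul_eq_mul, ← nsmul_eq_mul, LinearMap.smul_apply]
      rw [h3] at h1
      exact h1
    have hyj : ∀ j ∉ insert i J, B.θ j y = 0 := by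
      intro j hj
      have hc : Commute (Dm (B.θ j)) (Dm (B.θ i)) := by
        ext z; exact B.comm j i z
      have h1 := congrArg (fun f => f x) (hq3 _ hc c).eq
      have h2 : Dm (B.θ j) x = 0 := hx j hj
      simp only [Module.End.mul_apply, h2, map_zero] at h1
      exact h1
    have ht := B.t_ne i
    have hyb : y = (y / B.t i ^ c.val) * B.t i ^ c.val := by
      field_simp
    have htp : B.θ i (B.t i ^ c.val) = (c.val : K) * B.t i ^ c.val := by
      rw [Derivation.leibniz_pow, B.θ_t, smul_eq_mul, nsmul_eq_mul]
      rcases Nat.eq_zero_or_pos c.val with h | h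
      · simp [h]
      · rw [← pow_succ, Nat.sub_add_cancel h]
    have hb : ∀ j ∉ J, B.θ j (y / B.t i ^ c.val) = 0 := by
      intro j hj
      rw [Derivation.leibniz_div]
      by_cases hji : j = i
      · subst hji
        rw [hyi, htp]; simp; right; ring
      · rw [hyj j (by simp [hji, hj]), Derivation.leibniz_pow, B.θ_t_ne j i hji]; simp
    rw [hyb]
    have := ih (M.comap (AddMonoidHom.mulRight (B.t i ^ c.val))) ?_ _ hb
    · simpa using this
    · intro κ hκ α
      have h := H κ hκ (Function.update α i c.val)
      rw [Finset.prod_insert hiJ] at h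
      simp only [AddSubgroup.mem_comap, AddMonoidHom.mulRight_apply]
      convert h using 1
      rw [Function.update_self, mul_assoc, mul_comm (B.t i ^ _)]
      congr 2
      refine Finset.prod_congr rfl fun j hj => ?_
      rw [Function.update_of_ne]
      rintro rfl
      exact hiJ hj

lemma weight_vec (J : Finset I) (κ : K) (hκ : ∀ i, B.θ i κ = 0) (α : I → ℕ) (j : I) :
    ∃ n : ℕ, B.θ j (κ * ∏ i ∈ J, B.t i ^ α i) = n * (κ * ∏ i ∈ J, B.t i ^ α i) := by
  classical
  induction J using Finset.induction_on with
  | empty => exact ⟨0, by simpa using hκ j⟩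
  | insert i J hiJ ih =>
    obtain ⟨n, hn⟩ := ih
    have : ∃ m : ℕ, B.θ j (B.t i ^ α i) = m * B.t i ^ α i := by
      by_cases hji : j = i
      · subst hji
        refine ⟨α j, ?_⟩
        rw [Derivation.leibniz_pow, B.θ_t, smul_eq_mul, nsmul_eq_mul]
        rcases Nat.eq_zero_or_pos (α j) with h | h
        · simp [h]
        · rw [← pow_succ, Nat.sub_add_cancel h]
      · exact ⟨0, by rw [Derivation.leibniz_pow, B.θ_t_ne j i hji]; simp⟩
    obtain ⟨m, hm⟩ := this
    refine ⟨m + n, ?_⟩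
    rw [Finset.prod_insert hiJ, mul_left_comm, Derivation.leibniz, hn, hm]
    push_cast
    simp only [smul_eq_mul]; ring

lemma logfix (y : K) : ∃ G : K, ∀ j, y ^ (p - 1) * B.θ j y - (B.θ j y) ^ p = B.θ j G := by
  have hp : p.Prime := Fact.out
  let M : AddSubgroup K :=
    { carrier := {y | ∃ G : K, ∀ j, y ^ (p - 1) * B.θ j y - (B.θ j y) ^ p = B.θ j G}
      zero_mem' := ⟨0, fun j => by simp [hp.ne_zero]⟩
      add_mem' := by
        rintro a b ⟨G, hG⟩ ⟨H, hH⟩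
        obtain ⟨P, hP⟩ := logfix_add (p := p) a b
        refine ⟨P + G + H, fun j => ?_⟩
        rw [map_add (B.θ j) (P + G), map_add (B.θ j) P, ← hP, ← hG, ← hH, map_add, add_pow_char (B.θ j a) (B.θ j b) p]; ring
      neg_mem' := by
        rintro a ⟨G, hG⟩
        refine ⟨-G, fun j => ?_⟩
        rw [map_neg, map_neg, ← hG, neg_pow a, neg_one_pow_pred, neg_pow (B.θ j a), neg_one_pow_char]
        ring }
  refine weight_ind B (B.fin y).toFinset M ?_ y ?_
  · intro κ hκ α
    refine ⟨0, fun j => ?_⟩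
    obtain ⟨n, hn⟩ := weight_vec B (B.fin y).toFinset κ hκ α j
    rw [hn, mul_pow (n : K), natCast_pow_char, map_zero, mul_left_comm, ← pow_succ,
      Nat.sub_add_cancel hp.one_le, sub_self]
  · intro i hi; simpa using hi
end pb
end KW
end

noncomputable section
namespace KW
set_option linter.all false
open Polynomial

universe u
section ext
variable {p : ℕ} [Fact p.Prime] {K : Type*} [Field K] [CharP K p]

/-- coefficientwise derivation -/
def pd (θ : Derivation ℤ K K) : Derivation ℤ K[X] K[X] :=
  (PolynomialModule.equivPolynomialSelf (R := K)).toLinearMap.compDer θ.mapCoeffs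

lemma pd_coeff (θ : Derivation ℤ K K) (f : K[X]) (n : ℕ) : (pd θ f).coeff n = θ (f.coeff n) := by
  rfl

lemma pd_C (θ : Derivation ℤ K K) (a : K) : pd θ (C a) = C (θ a) := by
  ext n; rw [pd_coeff, coeff_C, coeff_C]; split_ifs <;> simp

lemma pd_X (θ : Derivation ℤ K K) : pd θ X = 0 := by
  ext n; rw [pd_coeff, coeff_X]; split_ifs <;> simp

lemma pd_natDegree (θ : Derivation ℤ K K) (f : K[X]) {d : ℕ} (h : f.degree < d) :
    (pd θ f).degree < d := by
  rw [degree_lt_iff_coeff_zero] at h ⊢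
  intro m hm
  rw [pd_coeff, h m hm, map_zero]

lemma pd_factor (c : K) (hc : c ≠ 0) (g q : K[X]) (hg : g.Monic) 
    (hq : g * q = X ^ (p - 1) - C c) (θ : Derivation ℤ K K) (hθ : θ c = 0) : pd θ g = 0 := by
  have hp : p.Prime := Fact.out
  have hsep : (X ^ (p - 1) - C c).Separable := by
    apply separable_X_pow_sub_C _ _ hc
    rw [Nat.cast_sub hp.one_lt.le, CharP.cast_eq_zero K p]; simp
  have h0 : pd θ (g * q) = 0 := by
    rw [hq, map_sub, pd_C, hθ, Derivation.leibniz_pow, pd_X]; simp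
  rw [← hq] at hsep
  have hcop := hsep.isCoprime
  rw [Derivation.leibniz, smul_eq_mul, smul_eq_mul] at h0
  have hd : g ∣ q * pd θ g := by
    rw [add_eq_zero_iff_eq_neg'] at h0; rw [h0]; exact Dvd.intro _ (by ring : g * (- pd θ q) = _)
  have hd := hcop.dvd_of_dvd_mul_left hd
  by_contra hne
  refine absurd (degree_le_of_dvd hd hne) (not_le.2 ?_)
  rw [degree_eq_natDegree hg.ne_zero]
  rw [degree_lt_iff_coeff_zero]
  intro m hm
  rw [pd_coeff]
  rcases hm.eq_or_lt with h | h
  · rw [← h, hg.coeff_natDegree]; simp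
  · rw [coeff_eq_zero_of_natDegree_lt h, map_zero]

/-- descent -/
lemma pd_mk (θ : Derivation ℤ K K) (g : K[X]) (hg : pd θ g = 0) {K' : Type*} [Field K']
    (mk : K[X] →+* K') (hmk : Function.Surjective mk) (hker : ∀ f, mk f = 0 ↔ g ∣ f) :
    ∃ θ' : Derivation ℤ K' K', ∀ f, θ' (mk f) = mk (pd θ f) := by
  have hs : Function.Surjective mk.toIntAlgHom := hmk
  have hd : ∀ x, mk.toIntAlgHom x = 0 → mk.toIntAlgHom (pd θ x) = 0 := by
    intro x hx
    have hx : mk x = 0 := hx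
    change mk (pd θ x) = 0
    rw [hker] at hx ⊢
    obtain ⟨y, rfl⟩ := hx
    rw [Derivation.leibniz, hg]; simp
  exact ⟨Derivation.liftOfSurjective hs hd, fun f => Derivation.liftOfSurjective_apply hs hd f⟩

end ext

lemma exists_ext_aux {p : ℕ} [Fact p.Prime] {K : Type*} [Field K] [CharP K p] {I : Type*} (B : PB p K I)
    (c : K) (hc : c ≠ 0) (hθ : ∀ i, B.θ i c = 0) (g q : K[X]) (hgm : g.Monic) (hgi : Irreducible g)
    (hq : X ^ (p - 1) - C c = g * q) {K' : Type*} [Field K'] [CharP K' p]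
    (mk : K[X] →+* K') (hmk : Function.Surjective mk) (hker : ∀ f, mk f = 0 ↔ g ∣ f)
    (ρ : K' →+ K) (hρ : ∀ f : K[X], f.degree < g.natDegree → ρ (mk f) = f.coeff 0) :
    ∃ (B' : PB p K' I) (alg : K →+* K') (κ : K'),
      κ ^ (p - 1) = alg c ∧ (∀ i x, B'.θ i (alg x) = alg (B.θ i x)) ∧
      (∀ i, B'.θ i κ = 0) ∧ (∀ i, B'.t i = alg (B.t i)) ∧
      (∀ a x, ρ (alg a * x) = a * ρ x) ∧ ρ 1 = 1 ∧
      (∀ j x, ρ (B'.θ j x) = B.θ j (ρ x)) ∧ ∀ x, ρ (x ^ p) = ρ x ^ p := by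
  have hp : p.Prime := Fact.out
  have hg0 : ∀ i, pd (B.θ i) g = 0 := fun i => pd_factor (p := p) c hc g q hgm hq.symm _ (hθ i)
  choose θ' hθ' using fun i => pd_mk (B.θ i) g (hg0 i) mk hmk hker
  let alg : K →+* K' := mk.comp C
  have alg_ : ∀ x, alg x = mk (C x) := fun x => rfl
  let κ : K' := mk X
  have hmkg : mk g = 0 := (hker g).2 dvd_rfl
  have hθalg : ∀ i x, θ' i (alg x) = alg (B.θ i x) := fun i x => by
    rw [alg_, hθ', pd_C]; rfl
  have hθpow : ∀ i n f, (Dm (θ' i) ^ n) (mk f) = mk ((Dm (pd (B.θ i)) ^ n) f) := by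
    intro i n f
    induction n with
    | zero => rfl
    | succ n ih =>
      rw [pow_succ', pow_succ', Module.End.mul_apply, ih]; exact hθ' i _
  have hpdpow : ∀ i n f m, ((Dm (pd (B.θ i)) ^ n) f).coeff m = (Dm (B.θ i) ^ n) (f.coeff m) := by
    intro i n f m
    induction n with
    | zero => rfl
    | succ n ih =>
      rw [pow_succ', pow_succ', Module.End.mul_apply, Module.End.mul_apply, ← ih]; exact pd_coeff _ _ _
  have hrep : ∀ x : K', ∃ f : K[X], f.degree < g.natDegree ∧ mk f = x := by
    intro x
    obtain ⟨f, rfl⟩ := hmk x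
    refine ⟨f %ₘ g, ?_, ?_⟩
    · rw [← degree_eq_natDegree hgm.ne_zero]; exact degree_modByMonic_lt _ hgm
    · rw [modByMonic_eq_sub_mul_div, map_sub, map_mul, hmkg]; simp
  let B' : PB p K' I :=
    { θ := θ'
      t := fun i => alg (B.t i)
      t_ne := fun i => by simpa using B.t_ne i
      comm := fun i j x => by
        obtain ⟨f, -, rfl⟩ := hrep x
        rw [hθ', hθ', hθ', hθ']
        congr 1; ext n; simp only [pd_coeff]; exact B.comm _ _ _
      θ_t := fun i => by rw [hθalg, B.θ_t]
      θ_t_ne := fun i j h => by rw [hθalg, B.θ_t_ne i j h, map_zero]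
      pow := fun i => by
        ext x
        obtain ⟨f, -, rfl⟩ := hrep x
        rw [hθpow]
        refine Eq.trans ?_ (hθ' i f).symm
        congr 1; ext n; rw [hpdpow, B.pow]; rfl
      fin := fun x => by
        obtain ⟨f, -, rfl⟩ := hrep x
        refine Set.Finite.subset (Set.Finite.biUnion f.support.finite_toSet (fun n _ => B.fin (f.coeff n))) ?_
        intro i hi
        simp only [Set.mem_setOf_eq, Set.mem_iUnion, hθ'] at hi ⊢
        by_contra hcon
        push Not at hcon
        apply hi
        have : pd (B.θ i) f = 0 := by
          ext n
          rw [pd_coeff, coeff_zero]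
          by_cases hn : n ∈ f.support
          · exact hcon n (by simpa using hn)
          · rw [notMem_support_iff.1 hn, map_zero]
        rw [this, map_zero] }
  have hκ : κ ^ (p - 1) = alg c := by
    rw [alg_, ← sub_eq_zero, ← map_pow, ← map_sub, hq, map_mul, hmkg, zero_mul]
  refine ⟨B', alg, κ, hκ, hθalg, fun i => ?_, fun i => rfl, ?_, ?_, ?_, ?_⟩
  · change θ' i κ = 0
    rw [hθ', pd_X, map_zero]
  · intro a x
    obtain ⟨f, hf, rfl⟩ := hrep x
    rw [alg_, ← map_mul, hρ f hf, hρ, coeff_C_mul]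
    rw [degree_lt_iff_coeff_zero] at hf ⊢
    intro m hm; rw [coeff_C_mul, hf m hm, mul_zero]
  · have : (1 : K') = mk 1 := by simp
    rw [this, hρ, coeff_one_zero]
    rw [degree_one]; exact_mod_cast hgi.natDegree_pos
  · intro j x
    obtain ⟨f, hf, rfl⟩ := hrep x
    change ρ (θ' j _) = _
    rw [hθ', hρ f hf, hρ _ (pd_natDegree _ _ hf), pd_coeff]
  · intro x
    obtain ⟨f, hf, rfl⟩ := hrep x
    have hκp : κ ^ p = alg c * κ := by
      rw [← hκ, ← pow_succ]; congr 1; have := hp.one_lt; omega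
    let f2 : K[X] := ∑ l ∈ Finset.range g.natDegree, C (f.coeff l ^ p * c ^ l) * X ^ l
    have hf1 : f = ∑ l ∈ Finset.range g.natDegree, C (f.coeff l) * X ^ l := by
      apply Polynomial.as_sum_range_C_mul_X_pow' 
      rcases eq_or_ne f 0 with h | h
      · rw [h, natDegree_zero]; exact hgi.natDegree_pos
      · rw [degree_eq_natDegree h] at hf; exact_mod_cast hf
    have h2 : (mk f) ^ p = mk f2 := by
      conv_lhs => rw [hf1]
      rw [map_sum, sum_pow_char, map_sum]
      refine Finset.sum_congr rfl fun l _ => ?_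
      rw [map_mul, map_mul, map_pow, mul_pow, ← pow_mul, mul_comm l p, pow_mul]
      change _ * (κ ^ p) ^ l = _
      rw [hκp, mul_pow, ← alg_, ← alg_, map_mul, map_pow, map_pow, mul_assoc]
    rw [h2, hρ f hf, hρ f2]
    · simp only [f2, finsetSum_coeff, coeff_C_mul_X_pow]
      rw [Finset.sum_eq_single_of_mem 0 (by simpa using hgi.natDegree_pos)]
      · simp
      · intro b _ hb; rw [if_neg hb.symm]
    · rw [degree_lt_iff_coeff_zero]
      intro m hm
      simp only [f2, finsetSum_coeff, coeff_C_mul_X_pow]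
      apply Finset.sum_eq_zero
      intro b hb
      rw [if_neg]
      have := Finset.mem_range.1 hb; omega

lemma exists_ext {p : ℕ} [Fact p.Prime] {K : Type u} [Field K] [CharP K p] {I : Type*} (B : PB p K I)
    (c : K) (hc : c ≠ 0) (hθ : ∀ i, B.θ i c = 0) :
    ∃ (K' : Type u) (_ : Field K') (_ : CharP K' p) (B' : PB p K' I) (alg : K →+* K') (κ : K')
      (ρ : K' →+ K),
      κ ^ (p - 1) = alg c ∧ (∀ i x, B'.θ i (alg x) = alg (B.θ i x)) ∧
      (∀ i, B'.θ i κ = 0) ∧ (∀ i, B'.t i = alg (B.t i)) ∧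
      (∀ a x, ρ (alg a * x) = a * ρ x) ∧ ρ 1 = 1 ∧
      (∀ j x, ρ (B'.θ j x) = B.θ j (ρ x)) ∧ ∀ x, ρ (x ^ p) = ρ x ^ p := by
  have hp : p.Prime := Fact.out
  have hdeg : (X ^ (p - 1) - C c).natDegree = p - 1 := natDegree_X_pow_sub_C
  obtain ⟨g, hgm, hgi, q, hq⟩ := exists_monic_irreducible_factor (X ^ (p - 1) - C c)
    (not_isUnit_of_natDegree_pos _ (by have := hp.one_lt; omega))
  haveI : Fact (Irreducible g) := ⟨hgi⟩
  haveI : CharP (AdjoinRoot g) p := charP_of_injective_algebraMap (algebraMap K (AdjoinRoot g)).injective p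
  let ρ : AdjoinRoot g →+ K := ((lcoeff K 0).comp (AdjoinRoot.modByMonicHom hgm)).toAddMonoidHom
  have hρ : ∀ f : K[X], f.degree < g.natDegree → ρ (AdjoinRoot.mk g f) = f.coeff 0 := by
    intro f hf
    change (AdjoinRoot.modByMonicHom hgm (AdjoinRoot.mk g f)).coeff 0 = _
    rw [AdjoinRoot.modByMonicHom_mk, (modByMonic_eq_self_iff hgm).2]
    rwa [degree_eq_natDegree hgm.ne_zero]
  obtain ⟨B', alg, κ, h⟩ := exists_ext_aux B c hc hθ g q hgm hgi hq (AdjoinRoot.mk g)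
    AdjoinRoot.mk_surjective (fun f => AdjoinRoot.mk_eq_zero) ρ hρ
  exact ⟨AdjoinRoot g, inferInstance, inferInstance, B', alg, κ, ρ, h⟩

end KW
end

noncomputable section
namespace KW
set_option linter.all false
universe u

section T
variable {p : ℕ} [Fact p.Prime] {K : Type u} [Field K] [CharP K p] {I : Type*} 

lemma neg_pow_char' (x : K) : (-x) ^ p = - x ^ p := by
  have := map_neg (frobenius K p) x
  simpa [frobenius_def] using this

lemma der_const_mul (θ : Derivation ℤ K K) (a x : K) (h : θ a = 0) : θ (a * x) = a * θ x := by
  rw [Derivation.leibniz, h]; simp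

lemma Dm_pow_const_mul (θ : Derivation ℤ K K) (a x : K) (h : θ a = 0) (n : ℕ) :
    (Dm θ ^ n) (a * x) = a * (Dm θ ^ n) x := by
  induction n generalizing x with
  | zero => rfl
  | succ n ih => 
    rw [pow_succ, Module.End.mul_apply, Module.End.mul_apply]
    change (Dm θ ^ n) (θ (a * x)) = _
    rw [der_const_mul _ _ _ h, ih]; rfl

lemma Dm_pow_map {K' : Type*} [Field K'] (θ : Derivation ℤ K K) (θ' : Derivation ℤ K' K')
    (alg : K →+* K') (h : ∀ x, θ' (alg x) = alg (θ x)) (n : ℕ) (x : K) :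
    (Dm θ' ^ n) (alg x) = alg ((Dm θ ^ n) x) := by
  induction n generalizing x with
  | zero => rfl
  | succ n ih => 
    rw [pow_succ, Module.End.mul_apply, pow_succ, Module.End.mul_apply]
    change (Dm θ' ^ n) (θ' (alg x)) = _
    rw [h, ih]; rfl

lemma Dm_pow_pred_apply (B : PB p K I) (i : I) (x : K) :
    (Dm (B.θ i) ^ (p - 1)) (B.θ i x) = B.θ i x := by
  have hp : p.Prime := Fact.out
  have := congrArg (fun f => f x) (B.pow i)
  rw [← pow_sub_one_mul hp.ne_zero] at this
  exact this

lemma lemT (B : PB p K I) [LinearOrder I] (i : I) (h w : K) (h0 : h ≠ 0)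
    (hw : B.θ i w = h - 1) (hjh : ∀ j, i < j → B.θ j h = 0) (hjw : ∀ j, i < j → B.θ j w = 0) :
    ∃ x : I → K, x i = h ∧ (∀ j, i < j → x j = 0) ∧ {j | x j ≠ 0}.Finite ∧
      (∀ j k, B.θ k (x j) = B.θ j (x k)) ∧ ∃ g, ∀ j, x j ^ p - h ^ p * x j = B.θ j g := by
  have hp : p.Prime := Fact.out
  have h1p := hp.one_lt
  obtain ⟨K', _, _, B', alg, κ, ρ, hκ, hθ, hθκ, ht, hρm, hρ1, hρθ, hρp⟩ :=
    exists_ext B ((h ^ p)⁻¹) (inv_ne_zero (pow_ne_zero _ h0)) (fun i => by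
      rw [Derivation.leibniz_inv, der_pow_char]; simp)
  have halg0 : alg h ≠ 0 := by simpa using h0
  have hκ0 : κ ≠ 0 := by
    rintro rfl
    rw [zero_pow (by omega)] at hκ
    exact inv_ne_zero (pow_ne_zero p h0) ((map_eq_zero alg).1 hκ.symm)
  have hκp : κ ^ p = κ * (alg h ^ p)⁻¹ := by
    rw [← map_pow, ← map_inv₀, ← hκ, ← pow_succ']; congr 1; omega
  have hθp : (Dm (B.θ i) ^ (p - 1)) h = h - 1 := by
    have e : h = 1 + B.θ i w := by rw [hw]; ring
    have e1 : (Dm (B.θ i) ^ (p - 1)) (1 : K) = 0 := by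
      obtain ⟨q, hq⟩ : ∃ q, p - 1 = q + 1 := ⟨p - 2, by omega⟩
      rw [hq, pow_succ, Module.End.mul_apply]
      have : (Dm (B.θ i)) 1 = 0 := (B.θ i).map_one_eq_zero
      rw [this, map_zero]
    have e2 : (Dm (B.θ i) ^ (p - 1)) (B.θ i w) = B.θ i w := Dm_pow_pred_apply B i w
    rw [← hw]
    conv_lhs => rw [e, map_add, e1, e2, zero_add]
  let X : Module.End ℤ K' := Dm (B'.θ i) + Lm (-(κ * alg h))
  have hX : X ^ p = X := by
    have e1 : (-(κ * alg h)) ^ p = - κ := by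
      rw [neg_pow_char', mul_pow, hκp, mul_assoc, inv_mul_cancel₀ (pow_ne_zero _ halg0), mul_one]
    have e2 : (Dm (B'.θ i) ^ (p - 1)) (-(κ * alg h)) = -(κ * (alg h - 1)) := by
      rw [map_neg, Dm_pow_const_mul _ _ _ (hθκ i), Dm_pow_map (B.θ i) _ alg (hθ i), hθp]; simp
    rw [jacobson, B'.pow, e1, e2]
    ext z
    simp [X]; ring
  obtain ⟨q, hq1, hqT, hqc⟩ := exists_idem X hX
  have : ∃ c, q c 1 ≠ 0 := by
    by_contra hcon
    push Not at hcon
    have := congrArg (fun f => f (1 : K')) hq1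
    simp [hcon] at this
  obtain ⟨c, hc⟩ := this
  set yc := q c 1 with hyc
  have hyi : B'.θ i yc = κ * alg h * yc + c.val * yc := by
    have := congrArg (fun f => f (1 : K')) (hqT c)
    have e : (ZMod.castHom (dvd_refl p) (Module.End ℤ K')) c = ((c.val : ℕ) : Module.End ℤ K') := by
      conv_lhs => rw [← ZMod.natCast_zmod_val c]
      rw [map_natCast]
    rw [e] at this
    have : B'.θ i yc + -(κ * alg h) * yc = c.val * yc := by
      have h3 : (((c.val : ℕ) : Module.End ℤ K') * q c) 1 = c.val * yc := by
        rw [Module.End.mul_apply, Module.End.natCast_apply, nsmul_eq_mul]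
      rw [← h3, ← this]; rfl
    rw [← this]; ring
  have hyj : ∀ j, i < j → B'.θ j yc = 0 := by
    intro j hj
    have hcom : Commute (Dm (B'.θ j)) X := by
      change _ * _ = _ * _
      ext z
      have e : B'.θ j (κ * alg h) = 0 := by
        rw [der_const_mul _ _ _ (hθκ j), hθ, hjh j hj]; simp
      have e' : B'.θ j (-(κ * alg h)) = 0 := by rw [map_neg, e, neg_zero]
      change B'.θ j (B'.θ i z + -(κ * alg h) * z) = B'.θ i (B'.θ j z) + -(κ * alg h) * B'.θ j z
      rw [map_add, der_const_mul _ _ _ e', B'.comm]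
    have h3 := hqc (Dm (B'.θ j)) hcom c
    have h4 := congrArg (fun f => f (1 : K')) h3.eq
    have h5 : (Dm (B'.θ j)) 1 = 0 := (B'.θ j).map_one_eq_zero
    simp only [Module.End.mul_apply, h5, map_zero] at h4
    exact h4
  let y : K' := yc * ((B'.t i)⁻¹) ^ c.val
  have hti := B'.t_ne i
  have hy0 : y ≠ 0 := mul_ne_zero hc (pow_ne_zero _ (inv_ne_zero hti))
  have hyi' : B'.θ i y = κ * alg h * y := by
    have e : B'.θ i ((B'.t i)⁻¹ ^ c.val) = - c.val * ((B'.t i)⁻¹) ^ c.val := by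
      rw [Derivation.leibniz_pow, Derivation.leibniz_inv, B'.θ_t, nsmul_eq_mul]
      rcases Nat.eq_zero_or_pos c.val with h | h
      · simp [h]
      · obtain ⟨m, hm⟩ : ∃ m, c.val = m + 1 := ⟨c.val - 1, by omega⟩
        rw [hm, Nat.add_sub_cancel]
        simp only [smul_eq_mul, inv_pow, pow_succ]
        field_simp
    rw [Derivation.leibniz, e, hyi]
    simp only [smul_eq_mul, y]; ring
  have hyj' : ∀ j, i < j → B'.θ j y = 0 := by
    intro j hj
    rw [Derivation.leibniz, hyj j hj, Derivation.leibniz_pow, Derivation.leibniz_inv,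
      B'.θ_t_ne j i hj.ne']
    simp
  obtain ⟨G, hG⟩ := logfix B' y
  refine ⟨fun j => ρ (κ⁻¹ * (B'.θ j y / y)), ?_, ?_, ?_, ?_, - (h ^ p * ρ (κ⁻¹ * (G / y ^ p))), ?_⟩
  · have : κ⁻¹ * (B'.θ i y / y) = alg h * 1 := by rw [hyi']; field_simp
    simp only [this]; rw [hρm, hρ1, mul_one]
  · intro j hj; simp only [hyj' j hj]; simp
  · refine (B'.fin y).subset ?_
    intro j hj hcon
    apply hj; simp only [hcon]; simp
  · intro j k
    have hκi : ∀ k, B'.θ k κ⁻¹ = 0 := fun k => by rw [Derivation.leibniz_inv, hθκ]; simp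
    simp only []
    rw [← hρθ, ← hρθ, der_const_mul _ _ _ (hκi _), der_const_mul _ _ _ (hκi _),
      Derivation.leibniz_div, Derivation.leibniz_div, B'.comm j k]
    congr 3
    simp only [smul_eq_mul]; ring
  · intro j
    have hκi : B'.θ j κ⁻¹ = 0 := by rw [Derivation.leibniz_inv, hθκ]; simp
    have h1 : B'.θ j (κ⁻¹ * (G / y ^ p)) = κ⁻¹ * (B'.θ j y / y) - κ⁻¹ * (B'.θ j y / y) ^ p := by
      rw [der_const_mul _ _ _ hκi, der_div_pow, ← hG j, div_pow, sub_div, mul_sub]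
      congr 2
      have : y ^ p = y ^ (p - 1) * y := by rw [← pow_succ]; congr 1; omega
      rw [this]; field_simp
    have h2 : (κ⁻¹ * (B'.θ j y / y)) ^ p = alg (h ^ p) * (κ⁻¹ * (B'.θ j y / y) ^ p) := by
      rw [mul_pow, inv_pow, hκp, map_pow, mul_inv, inv_inv]; ring
    have h3 : B.θ j (h ^ p * ρ (κ⁻¹ * (G / y ^ p))) = h ^ p * ρ (B'.θ j (κ⁻¹ * (G / y ^ p))) := by
      rw [der_const_mul _ _ _ (der_pow_char _ _), hρθ]
    simp only []
    rw [map_neg, h3, h1, ← hρp, h2, hρm, map_sub]; ring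

end T
end KW
end

noncomputable section
namespace KW
set_option linter.all false
universe u

section S
variable {p : ℕ} [Fact p.Prime] {K : Type u} [Field K] [CharP K p] {I : Type*} (B : PB p K I)

lemma Dm_comm (i j : I) : Commute (Dm (B.θ i)) (Dm (B.θ j)) := by
  change _ * _ = _ * _
  ext x; exact B.comm i j x

/-- projector onto the kernel of `θ i` -/
def pr (i : I) : Module.End ℤ K := 1 - Dm (B.θ i) ^ (p - 1)

lemma pr_comm (i j : I) : Commute (Dm (B.θ j)) (pr B i) :=
  (Commute.one_right _).sub_right ((Dm_comm B j i).pow_right _)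

lemma pr_θ_self (i : I) (x : K) : pr B i (B.θ i x) = 0 := by
  simp only [pr, LinearMap.sub_apply, Module.End.one_apply]
  rw [Dm_pow_pred_apply, sub_self]

lemma θ_pr (i j : I) (x : K) : B.θ j (pr B i x) = pr B i (B.θ j x) :=
  congrArg (fun f => f x) (pr_comm B i j).eq

lemma pr_eq_self (i : I) (x : K) (h : B.θ i x = 0) : pr B i x = x := by
  have hp : p.Prime := Fact.out
  obtain ⟨q, hq⟩ : ∃ q, p - 1 = q + 1 := ⟨p - 2, by have := hp.two_le; omega⟩
  simp only [pr, LinearMap.sub_apply, Module.End.one_apply]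
  rw [hq, pow_succ, Module.End.mul_apply]
  have : (Dm (B.θ i)) x = 0 := h
  rw [this, map_zero, sub_zero]

lemma θ_pow_comm (i j : I) (n : ℕ) (x : K) : B.θ j ((Dm (B.θ i) ^ n) x) = (Dm (B.θ i) ^ n) (B.θ j x) :=
  congrArg (fun f => f x) ((Dm_comm B j i).pow_right n).eq

/-- sum of the images of `θ l`, `l ∈ Λ` -/
def RR (Λ : Finset I) : AddSubgroup K := AddSubgroup.closure {y | ∃ l ∈ Λ, ∃ x, y = B.θ l x}

lemma RR_mem {Λ : Finset I} {l : I} (h : l ∈ Λ) (x : K) : B.θ l x ∈ RR B Λ :=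
  AddSubgroup.subset_closure ⟨l, h, x, rfl⟩

lemma RR_mono {Λ Λ' : Finset I} (h : Λ ⊆ Λ') : RR B Λ ≤ RR B Λ' :=
  AddSubgroup.closure_mono fun _ ⟨l, hl, x, e⟩ => ⟨l, h hl, x, e⟩

lemma RR_map {Λ : Finset I} (P : Module.End ℤ K) (hP : ∀ j, Commute (Dm (B.θ j)) P) {x : K}
    (hx : x ∈ RR B Λ) : P x ∈ RR B Λ := by
  induction hx using AddSubgroup.closure_induction with
  | mem y hy =>
    obtain ⟨l, hl, x, rfl⟩ := hy
    have : P (B.θ l x) = B.θ l (P x) := (congrArg (fun f => f x) (hP l).eq).symm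
    rw [this]; exact RR_mem B hl _
  | zero => simp [zero_mem]
  | add x y _ _ h1 h2 => rw [map_add]; exact add_mem h1 h2
  | neg x _ h => rw [map_neg]; exact neg_mem h

lemma exists_proj (Λ : Finset I) : ∃ P : Module.End ℤ K, (∀ u ∈ RR B Λ, P u = 0) ∧
    (∀ u, (∀ l ∈ Λ, B.θ l u = 0) → P u = u) ∧ ∀ j, Commute (Dm (B.θ j)) P := by
  classical
  induction Λ using Finset.induction_on with
  | empty =>
    refine ⟨1, ?_, fun u _ => rfl, fun j => Commute.one_right _⟩
    intro u hu
    have : RR B ∅ = ⊥ := by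
      rw [RR, AddSubgroup.closure_eq_bot_iff]; rintro y ⟨l, hl, _⟩; simp at hl
    rw [this] at hu; simpa using hu
  | insert i Λ hi ih =>
    obtain ⟨P, h1, h2, h3⟩ := ih
    refine ⟨P * pr B i, ?_, ?_, fun j => (h3 j).mul_right (pr_comm B i j)⟩
    · intro u hu
      induction hu using AddSubgroup.closure_induction with
      | mem y hy =>
        obtain ⟨l, hl, x, rfl⟩ := hy
        rw [Module.End.mul_apply]
        rcases Finset.mem_insert.1 hl with rfl | hl
        · rw [pr_θ_self, map_zero]
        · rw [← θ_pr]; exact h1 _ (RR_mem B hl _)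
      | zero => simp
      | add x y _ _ h1 h2 => rw [map_add, h1, h2, add_zero]
      | neg x _ h => rw [map_neg, h, neg_zero]
    · intro u hu
      rw [Module.End.mul_apply, pr_eq_self B i u (hu i (by simp)), h2]
      intro l hl; exact hu l (by simp [hl])

lemma RR_zero {Λ : Finset I} {u : K} (hu : u ∈ RR B Λ) (h : ∀ l ∈ Λ, B.θ l u = 0) : u = 0 := by
  obtain ⟨P, h1, h2, -⟩ := exists_proj B Λ
  rw [← h2 u h, h1 u hu]

variable [LinearOrder I]

/-- the graded piece `T_i` -/
def TT (i : I) : AddSubgroup K where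
  carrier := {s | (∀ j, i < j → B.θ j s = 0) ∧ (Dm (B.θ i) ^ (p - 1)) s = s}
  zero_mem' := ⟨by simp, by simp⟩
  add_mem' := by
    rintro a b ⟨h1, h2⟩ ⟨h3, h4⟩
    refine ⟨fun j hj => by rw [map_add, h1 j hj, h3 j hj, add_zero], by rw [map_add, h2, h4]⟩
  neg_mem' := by
    rintro a ⟨h1, h2⟩
    refine ⟨fun j hj => by rw [map_neg, h1 j hj, neg_zero], by rw [map_neg, h2]⟩

lemma TT_eq {i : I} {s : K} (hs : s ∈ TT B i) : s = B.θ i ((Dm (B.θ i) ^ (p - 2)) s) := by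
  have hp : p.Prime := Fact.out
  have h := hs.2
  rw [show p - 1 = (p - 2) + 1 by have := hp.two_le; omega, pow_succ'] at h
  exact h.symm

/-- sums of elements of the `T_j`, `j ∈ σ` -/
def SS (σ : Finset I) : Set K := {s | ∃ f : I → K, (∀ j ∈ σ, f j ∈ TT B j) ∧ s = ∑ j ∈ σ, f j}

lemma SS_zero (σ : Finset I) : (0 : K) ∈ SS B σ := ⟨0, fun j _ => zero_mem _, by simp⟩

lemma SS_add {σ : Finset I} {a b : K} (ha : a ∈ SS B σ) (hb : b ∈ SS B σ) : a + b ∈ SS B σ := by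
  obtain ⟨f, hf, rfl⟩ := ha
  obtain ⟨g, hg, rfl⟩ := hb
  exact ⟨f + g, fun j hj => add_mem (hf j hj) (hg j hj), by simp [Finset.sum_add_distrib]⟩

lemma SS_of_TT {σ : Finset I} {i : I} (hi : i ∈ σ) {a : K} (ha : a ∈ TT B i) : a ∈ SS B σ := by
  refine ⟨fun j => if j = i then a else 0, fun j hj => ?_, ?_⟩
  · simp only []
    split_ifs with h
    · rw [h]; exact ha
    · exact zero_mem _
  · simp [hi]

lemma mem_SS (σ J : Finset I) : ∀ x : K, (∀ j ∉ J, B.θ j x = 0) → x ∈ RR B σ →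
    (∀ j ∉ σ, B.θ j x ∈ RR B (σ.filter (j < ·))) → x ∈ SS B σ := by
  induction J using Finset.induction_on_max with
  | empty =>
    intro x h1 h2 h3
    rw [RR_zero B h2 (fun l _ => h1 l (by simp))]
    exact SS_zero B σ
  | insert i J hi ih =>
    intro x h1 h2 h3
    have hgt : ∀ j, i < j → B.θ j x = 0 := by
      intro j hj
      apply h1
      rw [Finset.mem_insert]
      rintro (h | h)
      · exact hj.ne' h
      · exact absurd (hi j h) (not_lt.2 hj.le)
    by_cases his : i ∈ σ
    · have e : x = pr B i x + (Dm (B.θ i) ^ (p - 1)) x := by simp [pr]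
      rw [e]
      refine SS_add B (ih _ ?_ ?_ ?_) (SS_of_TT B his ⟨?_, ?_⟩)
      · intro j hj
        rw [θ_pr]
        by_cases hji : j = i
        · rw [hji, pr_θ_self]
        · rw [h1 j (by simp [hji, hj]), map_zero]
      · exact RR_map B _ (fun j => pr_comm B i j) h2
      · intro j hj
        rw [θ_pr]
        exact RR_map B _ (fun j => pr_comm B i j) (h3 j hj)
      · intro j hj
        rw [θ_pow_comm, hgt j hj, map_zero]
      · have hp : p.Prime := Fact.out
        rw [← Module.End.mul_apply, ← pow_add]
        have : p - 1 + (p - 1) = (p - 2) + p := by have := hp.two_le; omega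
        rw [this, pow_add, B.pow, ← pow_succ]
        congr 2; have := hp.two_le; omega
    · apply ih x _ h2 h3
      intro j hj
      by_cases hji : j = i
      · subst hji
        refine RR_zero B (h3 j his) ?_
        intro l hl
        rw [B.comm, hgt l (Finset.mem_filter.1 hl).2, map_zero]
      · exact h1 j (by simp [hji, hj])

lemma const_add_ne_zero (τ : Finset I) (κ : K) (hκ : κ ≠ 0) (hθ : ∀ i, B.θ i κ = 0) (s : I → K)
    (hs : ∀ i ∈ τ, s i ∈ TT B i) : κ + ∑ i ∈ τ, s i ≠ 0 := by
  intro h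
  have h1 : κ ∈ RR B τ := by
    rw [eq_neg_of_add_eq_zero_left h]
    refine neg_mem (sum_mem fun i hi => ?_)
    rw [TT_eq B (hs i hi)]
    exact RR_mem B hi _
  exact hκ (RR_zero B h1 fun l _ => hθ l)

end S
end KW
end

noncomputable section
namespace KW
set_option linter.all false
universe u
open Module

section ext
variable {I : Type*} [LinearOrder I] {R M : Type*} [CommRing R] [AddCommGroup M] [Module R M]
  (b : Basis I R M)

lemma BB_eq (σ : Finset I) : b.ExteriorAlgebra σ = 
    (List.ofFn fun i => ExteriorAlgebra.ι R (b (σ.orderEmbOfFin rfl i))).prod := by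
  rw [ExteriorAlgebra.basis_apply_ofCard b (rfl : σ.card = σ.card)]
  simp only [ExteriorAlgebra.ιMulti_family, ExteriorAlgebra.ιMulti_apply]
  rfl

lemma BB_empty : b.ExteriorAlgebra ∅ = 1 := by
  rw [BB_eq]; simp

lemma BB_singleton (i : I) : b.ExteriorAlgebra {i} = ExteriorAlgebra.ι R (b i) := by
  rw [BB_eq, List.ofFn_congr (Finset.card_singleton i)]
  have : ({i} : Finset I).orderEmbOfFin rfl (Fin.cast (Finset.card_singleton i).symm 0) = i := by
    have := Finset.orderEmbOfFin_mem ({i} : Finset I) rfl (Fin.cast (Finset.card_singleton i).symm 0)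
    exact Finset.mem_singleton.1 this
  simp [this]

lemma ι_mul_BB_of_mem {i : I} {σ : Finset I} (h : i ∈ σ) :
    ExteriorAlgebra.ι R (b i) * b.ExteriorAlgebra σ = 0 := by
  have := ExteriorAlgebra.basis_mul_of_not_disjoint b (Set.powersetCard.ofCard (Finset.card_singleton i))
    (Set.powersetCard.ofCard (rfl : σ.card = σ.card)) (by simpa using h)
  rw [← BB_singleton]
  exact this

lemma ι_mul_BB {i : I} {σ : Finset I} (h : i ∉ σ) : ∃ ε : R, (ε = 1 ∨ ε = -1) ∧
    ExteriorAlgebra.ι R (b i) * b.ExteriorAlgebra σ = ε • b.ExteriorAlgebra (insert i σ) := by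
  have hd : Disjoint (Set.powersetCard.ofCard (Finset.card_singleton i)).val
    (Set.powersetCard.ofCard (rfl : σ.card = σ.card)).val := by simpa using h
  have := ExteriorAlgebra.basis_mul_of_disjoint b (Set.powersetCard.ofCard (Finset.card_singleton i))
    (Set.powersetCard.ofCard (rfl : σ.card = σ.card)) hd
  rw [← BB_singleton]
  have e : (Set.powersetCard.disjUnion hd).val = insert i σ := by
    ext x; simp
  change b.ExteriorAlgebra {i} * b.ExteriorAlgebra σ = _ • b.ExteriorAlgebra ((Set.powersetCard.disjUnion hd).val) at this
  rw [e] at this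
  rw [this]
  rcases Int.units_eq_one_or (Equiv.Perm.sign (Set.powersetCard.permOfDisjoint hd)) with h | h <;> rw [h]
  · exact ⟨1, Or.inl rfl, by simp⟩
  · exact ⟨-1, Or.inr rfl, by simp⟩
end ext

section DFfacts
variable {p : ℕ} {K : Type u} [Field K]

lemma dForm_add (a b : K) : dForm K (a + b) = dForm K a + dForm K b := by simp [dForm]
lemma dForm_zero : dForm K 0 = 0 := by simp [dForm]
lemma dForm_mul (a b : K) : dForm K (a * b) = a • dForm K b + b • dForm K a := by
  simp [dForm]
lemma dLog_eq (a : K) : dLog K a = a⁻¹ • dForm K a := by simp [dForm, dLog]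
lemma dForm_eq (a : K) (h : a ≠ 0) : dForm K a = a • dLog K a := by
  rw [dLog_eq, smul_smul, mul_inv_cancel₀ h, one_smul]
lemma dForm_sq (a : K) : dForm K a * dForm K a = 0 := ExteriorAlgebra.ι_sq_zero _
lemma dForm_inv (a : K) : dForm K a⁻¹ = (-(a⁻¹ ^ 2)) • dForm K a := by
  simp [dForm, Derivation.leibniz_inv]
lemma dForm_pow_char [Fact p.Prime] [CharP K p] (a : K) : dForm K (a ^ p) = 0 := by
  rw [dForm, Derivation.leibniz_pow, ← Nat.cast_smul_eq_nsmul K, CharP.cast_eq_zero]; simp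
lemma dLog_mul (a b : K) (ha : a ≠ 0) (hb : b ≠ 0) : dLog K (a * b) = dLog K a + dLog K b := by
  rw [dLog_eq, dLog_eq, dLog_eq, dForm_mul, smul_add, smul_smul, smul_smul, mul_inv, add_comm]
  congr 2 <;> field_simp

variable (S : DiffStr p K)

lemma d_smul_one (a : K) : S.d (a • 1) = dForm K a := by
  rw [S.d_smul, S.d_one]; simp
lemma d_dForm (a : K) : S.d (dForm K a) = 0 := by
  rw [← d_smul_one S, S.d_d]
lemma d_dForm_mul (a : K) (ω : DF K) : S.d (dForm K a * ω) = - (dForm K a * S.d ω) := by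
  have := S.d_d (a • ω)
  rw [S.d_smul, map_add, S.d_smul, S.d_d, smul_zero, add_zero] at this
  exact eq_neg_of_add_eq_zero_left this
lemma d_dLog_mul (a : K) (ω : DF K) : S.d (dLog K a * ω) = - (dLog K a * S.d ω) := by
  rw [dLog_eq, smul_mul_assoc, S.d_smul, d_dForm_mul, dForm_inv, smul_mul_assoc, ← mul_assoc, dForm_sq]
  simp
lemma d_logList (l : List K) : S.d (l.map (dLog K)).prod = 0 := by
  induction l with
  | nil => simpa using S.d_one
  | cons a l ih => rw [List.map_cons, List.prod_cons, d_dLog_mul, ih]; simp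
lemma logForm_eq {n : ℕ} (x : Fin n → K) : logForm K x = ((List.ofFn x).map (dLog K)).prod := by
  rw [logForm, List.map_ofFn]; rfl
lemma d_logForm {n : ℕ} (x : Fin n → K) : S.d (logForm K x) = 0 := by
  rw [logForm_eq, d_logList]

lemma logList_mem (l : List K) : (l.map (dLog K)).prod ∈ omegaPow K l.length := by
  induction l with
  | nil => rw [omegaPow]; simp [Submodule.one_eq_range]
  | cons a l ih =>
    rw [List.map_cons, List.prod_cons, List.length_cons, omegaPow, pow_succ']
    exact Submodule.mul_mem_mul ⟨_, rfl⟩ ih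

lemma logList_eq_logForm (l : List K) : (l.map (dLog K)).prod = logForm K l.get := by
  rw [logForm_eq, List.ofFn_get]

/-- additive induction on forms of degree n -/
lemma omegaPow_ind (n : ℕ) (M : AddSubgroup (DF K))
    (H : ∀ (a : K) (l : List K), l.length = n → (∀ x ∈ l, x ≠ 0) → a • (l.map (dLog K)).prod ∈ M) :
    ∀ ω ∈ omegaPow K n, ω ∈ M := by
  induction n generalizing M with
  | zero =>
    intro ω hω
    rw [omegaPow, pow_zero, Submodule.mem_one] at hω
    obtain ⟨a, rfl⟩ := hω
    have := H a [] rfl (by simp)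
    simpa [Algebra.algebraMap_eq_smul_one] using this
  | succ n ih =>
    intro ω hω
    rw [omegaPow, pow_succ'] at hω
    induction hω using Submodule.mul_induction_on' with
    | add x _ y _ h1 h2 => exact add_mem h1 h2
    | mem_mul_mem x hx y hy =>
      obtain ⟨w, rfl⟩ := hx
      have hw : w ∈ Submodule.span K (Set.range (KaehlerDifferential.D ℤ K)) := by
        rw [KaehlerDifferential.span_range_derivation]; trivial
      induction hw using Submodule.span_induction generalizing y with
      | zero => simp [zero_mem]
      | add a b _ _ h1 h2 => rw [map_add, add_mul]; exact add_mem (h1 y hy) (h2 y hy)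
      | smul c a _ h1 =>
        rw [map_smul, smul_mul_assoc, ← mul_smul_comm]
        exact h1 _ (Submodule.smul_mem _ _ hy)
      | mem a ha =>
        obtain ⟨f, rfl⟩ := ha
        refine ih (M.comap (AddMonoidHom.mulLeft (dForm K f))) ?_ y hy
        intro a l hl hl0
        change dForm K f * _ ∈ M
        by_cases hf : f = 0
        · rw [hf, dForm_zero, zero_mul]; exact zero_mem _
        · have := H (a * f) (f :: l) (by simp [hl]) (by simpa [hf] using hl0)
          rw [dForm_eq f hf, mul_smul_comm, smul_mul_assoc, smul_smul]
          simpa using this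

end DFfacts
end KW
end

noncomputable section
namespace KW
set_option linter.all false
universe u
open Module

/-- a `p`-basis in terms of logarithmic differentials -/
structure Frame (K : Type u) [Field K] (I : Type*) where
  b : Basis I K (KaehlerDifferential ℤ K)
  t : I → K
  t_ne : ∀ i, t i ≠ 0
  hb : ∀ i, b i = (t i)⁻¹ • KaehlerDifferential.D ℤ K (t i)

section frame
variable {K : Type u} [Field K] {I : Type*} (A : Frame K I)

/-- the coordinate derivations -/
def Frame.θ (i : I) : Derivation ℤ K K := (A.b.coord i).compDer (KaehlerDifferential.D ℤ K)

lemma Frame.θ_apply (i : I) (x : K) : A.θ i x = A.b.repr (KaehlerDifferential.D ℤ K x) i := rfl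

lemma Frame.D_t (i : I) : KaehlerDifferential.D ℤ K (A.t i) = A.t i • A.b i := by
  rw [A.hb, smul_smul, mul_inv_cancel₀ (A.t_ne i), one_smul]

lemma Frame.θ_t (i : I) : A.θ i (A.t i) = A.t i := by
  rw [A.θ_apply, A.D_t]; simp

lemma Frame.θ_t_ne (i j : I) (h : i ≠ j) : A.θ i (A.t j) = 0 := by
  rw [A.θ_apply, A.D_t]; simp [Finsupp.single_apply, h.symm]

lemma Frame.der_zero (δ : Derivation ℤ K K) (h : ∀ i, δ (A.t i) = 0) (x : K) : δ x = 0 := by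
  have h1 : δ.liftKaehlerDifferential = 0 := by
    apply A.b.ext
    intro i
    rw [A.hb, map_smul, Derivation.liftKaehlerDifferential_comp_D, h]; simp
  rw [← Derivation.liftKaehlerDifferential_comp_D, h1]; rfl

lemma Frame.der_ext (δ δ' : Derivation ℤ K K) (h : ∀ i, δ (A.t i) = δ' (A.t i)) : δ = δ' := by
  ext x
  have := A.der_zero (δ - δ') (fun i => by simp [h]) x
  exact sub_eq_zero.1 this

lemma Frame.θ_t' [DecidableEq I] (i j : I) : A.θ i (A.t j) = if i = j then A.t j else 0 := by
  split_ifs with h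
  · rw [h, A.θ_t]
  · exact A.θ_t_ne i j h

/-- The associated system of derivations. -/
def Frame.PB (p : ℕ) [Fact p.Prime] [CharP K p] : PB p K I where
  θ := A.θ
  t := A.t
  t_ne := A.t_ne
  θ_t := A.θ_t
  θ_t_ne := A.θ_t_ne
  comm := by
    classical
    intro i j x
    have := A.der_zero ⁅A.θ i, A.θ j⁆ (fun l => by
      rw [Derivation.commutator_apply, A.θ_t', A.θ_t']
      by_cases h1 : i = l <;> by_cases h2 : j = l <;> simp [h1, h2, A.θ_t, A.θ_t_ne]) x
    rw [Derivation.commutator_apply] at this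
    exact sub_eq_zero.1 this
  pow := by
    intro i
    have hp : p.Prime := Fact.out
    have h1 : ∀ n l, (Dm (A.θ i) ^ (n + 1)) (A.t l) = A.θ i (A.t l) := by
      intro n l
      induction n with
      | zero => simp
      | succ n ih =>
        rw [pow_succ', Module.End.mul_apply, ih]
        change A.θ i (A.θ i (A.t l)) = _
        by_cases h : i = l
        · rw [← h, A.θ_t, A.θ_t]
        · rw [A.θ_t_ne _ _ h, map_zero]
    have : powDer p (A.θ i) = A.θ i := by
      apply A.der_ext
      intro l
      have := h1 (p - 1) l
      rw [Nat.sub_add_cancel hp.one_lt.le] at this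
      exact this
    ext x
    exact congrArg (fun f : Derivation ℤ K K => f x) this
  fin := fun x => (Finsupp.finite_support (A.b.repr (KaehlerDifferential.D ℤ K x)))

end frame

section forms
variable {K : Type u} [Field K] {I : Type*} [LinearOrder I] (A : Frame K I)

/-- basis of forms -/
def Frame.e (i : I) : DF K := ExteriorAlgebra.ι K (A.b i)
def Frame.BB : Basis (Finset I) K (DF K) := A.b.ExteriorAlgebra
abbrev Frame.co (σ : Finset I) : DF K →ₗ[K] K := A.BB.coord σ

lemma Frame.e_eq (i : I) : A.e i = dLog K (A.t i) := by rw [Frame.e, A.hb]; rfl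

lemma Frame.dForm_eq (a : K) (J : Finset I) (hJ : ∀ i ∉ J, A.θ i a = 0) :
    dForm K a = ∑ i ∈ J, A.θ i a • A.e i := by
  have h1 : KaehlerDifferential.D ℤ K a = ∑ i ∈ J, A.θ i a • A.b i := by
    conv_lhs => rw [← A.b.linearCombination_repr (KaehlerDifferential.D ℤ K a),
      Finsupp.linearCombination_apply]
    refine Finsupp.sum_of_support_subset _ ?_ _ (by simp)
    intro i hi
    by_contra hcon
    exact (Finsupp.mem_support_iff.1 hi) (hJ i hcon)
  rw [dForm, h1, map_sum]
  simp [Frame.e]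

lemma Frame.dForm_eq' (a : K) : ∃ J : Finset I, (∀ i ∉ J, A.θ i a = 0) ∧
    dForm K a = ∑ i ∈ J, A.θ i a • A.e i := by
  refine ⟨(A.b.repr (KaehlerDifferential.D ℤ K a)).support, fun i hi => ?_, ?_⟩
  · exact Finsupp.notMem_support_iff.1 hi
  · apply A.dForm_eq
    intro i hi
    exact Finsupp.notMem_support_iff.1 hi

/-- list of the logarithmic factors of a basis form -/
def Frame.lst (σ : Finset I) : List K := List.ofFn fun i => A.t (σ.orderEmbOfFin rfl i)

lemma Frame.BB_eq (σ : Finset I) : A.BB σ = ((A.lst σ).map (dLog K)).prod := by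
  rw [Frame.BB, KW.BB_eq, Frame.lst, List.map_ofFn]
  congr 2
  funext i
  exact A.e_eq _

lemma Frame.lst_length (σ : Finset I) : (A.lst σ).length = σ.card := by simp [Frame.lst]
lemma Frame.mem_lst (σ : Finset I) {x : K} (hx : x ∈ A.lst σ) : ∃ i ∈ σ, x = A.t i := by
  rw [Frame.lst, List.mem_ofFn] at hx
  obtain ⟨i, rfl⟩ := hx
  exact ⟨_, Finset.orderEmbOfFin_mem _ _ _, rfl⟩

lemma Frame.BB_mem (σ : Finset I) : A.BB σ ∈ omegaPow K σ.card := by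
  rw [A.BB_eq, ← A.lst_length]; exact logList_mem _

lemma Frame.e_mul_of_mem {i : I} {σ : Finset I} (h : i ∈ σ) : A.e i * A.BB σ = 0 :=
  ι_mul_BB_of_mem _ h

lemma Frame.e_mul {i : I} {σ : Finset I} (h : i ∉ σ) : ∃ ε : K, (ε = 1 ∨ ε = -1) ∧
    A.e i * A.BB σ = ε • A.BB (insert i σ) := ι_mul_BB _ h

lemma Frame.BB_empty : A.BB ∅ = 1 := KW.BB_empty _

lemma Frame.co_BB (σ ρ : Finset I) : A.co σ (A.BB ρ) = if σ = ρ then 1 else 0 := by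
  rw [Frame.co, Basis.coord_apply, Basis.repr_self, Finsupp.single_apply]
  simp [eq_comm]

variable {p : ℕ} (S : DiffStr p K)

lemma Frame.d_BB (σ : Finset I) : S.d (A.BB σ) = 0 := by rw [A.BB_eq, d_logList]

lemma Frame.d_smul_BB (a : K) (σ : Finset I) : S.d (a • A.BB σ) = dForm K a * A.BB σ := by
  rw [S.d_smul, A.d_BB, smul_zero, add_zero]

/-- induction on forms -/
lemma Frame.ind (P : Finset I → Prop) (M : AddSubgroup (DF K)) (H : ∀ σ, P σ → ∀ a : K, a • A.BB σ ∈ M)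
    (x : DF K) (hx : ∀ σ, ¬ P σ → A.co σ x = 0) : x ∈ M := by
  rw [← A.BB.linearCombination_repr x, Finsupp.linearCombination_apply]
  refine sum_mem fun σ hσ => ?_
  apply H
  by_contra hcon
  exact (Finsupp.mem_support_iff.1 hσ) (hx σ hcon)

end forms
end KW
end

noncomputable section
namespace KW
set_option linter.all false
universe u
open Module

section colex
variable {I : Type*} [LinearOrder I]

lemma clt_iff {ρ σ : Finset I} : toColex ρ < toColex σ ↔ ∃ a ∈ σ, a ∉ ρ ∧ ∀ b ∈ ρ, b ∉ σ → b < a :=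
  Finset.Colex.toColex_lt_toColex_iff_exists_forall_lt

lemma colex_wf [WellFoundedLT I] : WellFounded (fun ρ σ : Finset I => toColex ρ < toColex σ) := by
  let f : Finset I → Colex (I →₀ ℕ) := fun σ => toColex (Finsupp.indicator σ (fun _ _ => 1))
  have hf : ∀ ρ σ : Finset I, toColex ρ < toColex σ → f ρ < f σ := by
    intro ρ σ h
    obtain ⟨a, ha, hb, hc⟩ := clt_iff.1 h
    have hv : ∀ (τ : Finset I) j, (ofColex (f τ)) j = if j ∈ τ then 1 else 0 := by
      intro τ j
      simp [f, Finsupp.indicator_apply]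
    -- reduce to a statement where the top differing index witnesses the comparison
    classical
    have hne : (σ \ ρ).Nonempty := ⟨a, by simp [ha, hb]⟩
    let m := (σ \ ρ).max' hne
    have hm := Finset.mem_sdiff.1 (Finset.max'_mem _ hne)
    have ham : a ≤ m := Finset.le_max' _ _ (by simp [ha, hb])
    refine Finsupp.Colex.lt_iff.2 ⟨m, ?_, ?_⟩
    · intro j hj
      rw [hv, hv]
      by_cases h1 : j ∈ ρ <;> by_cases h2 : j ∈ σ <;> simp only [h1, h2, if_true, if_false]
      · exact absurd (hc j h1 h2) (not_lt.2 (ham.trans hj.le))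
      · exact absurd (Finset.le_max' (σ \ ρ) j (by simp [h1, h2])) (not_le.2 hj)
    · rw [hv, hv, if_neg hm.2, if_pos hm.1]; exact Nat.zero_lt_one
  exact Subrelation.wf (fun {a b} h => hf a b h) (InvImage.wf f wellFounded_lt)

lemma clt_insert_lt {ρ : Finset I} {i j : I} (hj : j ∉ ρ) (hij : i < j) :
    toColex (insert i ρ) < toColex (insert j ρ) := by
  rw [clt_iff]
  refine ⟨j, by simp, by simp [hj, hij.ne'], ?_⟩
  intro b hb hb'
  simp only [Finset.mem_insert, not_or] at hb hb'
  rcases hb with rfl | h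
  · exact hij
  · exact absurd h hb'.2

end colex

section forms
variable {K : Type u} [Field K] {I : Type*} [LinearOrder I] (A : Frame K I)

lemma Frame.dB_mem' (N : AddSubgroup (DF K)) (a : K) (ρ : Finset I) (j : I)
    (H : ∀ i ∉ ρ, i ≠ j → A.θ i a • A.BB (insert i ρ) ∈ N) :
    dForm K a * A.BB ρ - A.θ j a • (A.e j * A.BB ρ) ∈ N := by
  obtain ⟨J, hJ, -⟩ := A.dForm_eq' a
  have h2 := A.dForm_eq a (insert j J) (fun i hi => hJ i (by simp at hi; tauto))
  rw [h2, Finset.sum_mul, ← Finset.add_sum_erase _ _ (Finset.mem_insert_self j J), smul_mul_assoc,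
    add_sub_cancel_left]
  refine sum_mem fun i hi => ?_
  rw [smul_mul_assoc]
  by_cases h : i ∈ ρ
  · rw [A.e_mul_of_mem h, smul_zero]; exact zero_mem _
  · obtain ⟨ε, hε, e⟩ := A.e_mul h
    have := H i h (Finset.ne_of_mem_erase hi)
    rw [e]
    rcases hε with rfl | rfl
    · simpa using this
    · simpa using this

lemma Frame.dB_mem (N : AddSubgroup (DF K)) (a : K) (ρ : Finset I)
    (H : ∀ i ∉ ρ, A.θ i a • A.BB (insert i ρ) ∈ N) : dForm K a * A.BB ρ ∈ N := by
  obtain ⟨J, hJ, h2⟩ := A.dForm_eq' a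
  rw [h2, Finset.sum_mul]
  refine sum_mem fun i hi => ?_
  rw [smul_mul_assoc]
  by_cases h : i ∈ ρ
  · rw [A.e_mul_of_mem h, smul_zero]; exact zero_mem _
  · obtain ⟨ε, hε, e⟩ := A.e_mul h
    have := H i h
    rw [e]
    rcases hε with rfl | rfl
    · simpa using this
    · simpa using this

/-- forms with only terms below `σ` -/
def Frame.Llt (σ : Finset I) : Submodule K (DF K) where
  carrier := {x | ∀ ρ, ¬ (toColex ρ < toColex σ) → A.co ρ x = 0}
  zero_mem' := by intro ρ _; simp
  add_mem' := by
    intro a b ha hb ρ h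
    rw [map_add, ha ρ h, hb ρ h, add_zero]
  smul_mem' := by
    intro c a ha ρ h
    rw [map_smul, ha ρ h, smul_zero]

lemma Frame.smul_BB_mem_Llt (a : K) {ρ σ : Finset I} (h : toColex ρ < toColex σ) :
    a • A.BB ρ ∈ A.Llt σ := by
  refine Submodule.smul_mem _ _ ?_
  intro τ hτ
  rw [A.co_BB, if_neg]
  rintro rfl; exact hτ h

/-- forms with only terms up to `σ` -/
def Frame.Lle (σ : Finset I) : Submodule K (DF K) where
  carrier := {x | ∀ ρ, ¬ (toColex ρ ≤ toColex σ) → A.co ρ x = 0}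
  zero_mem' := by intro ρ _; simp
  add_mem' := by
    intro a b ha hb ρ h
    rw [map_add, ha ρ h, hb ρ h, add_zero]
  smul_mem' := by
    intro c a ha ρ h
    rw [map_smul, ha ρ h, smul_zero]

lemma Frame.Llt_le_Lle (σ : Finset I) : A.Llt σ ≤ A.Lle σ := fun x hx ρ hρ => hx ρ fun h => hρ h.le

lemma Frame.Llt_iff {σ : Finset I} {x : DF K} (hx : x ∈ A.Lle σ) : x ∈ A.Llt σ ↔ A.co σ x = 0 := by
  constructor
  · intro h; exact h σ (lt_irrefl _)
  · intro h ρ hρ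
    by_cases he : ρ = σ
    · rw [he, h]
    · refine hx ρ fun hle => hρ (lt_of_le_of_ne hle fun h => he (toColex_inj.1 h))

lemma Frame.BB_mem_Lle (a : K) (σ : Finset I) : a • A.BB σ ∈ A.Lle σ := by
  refine Submodule.smul_mem _ _ ?_
  intro τ hτ
  rw [A.co_BB, if_neg]
  rintro rfl; exact hτ le_rfl

variable {p : ℕ} [Fact p.Prime] [CharP K p] (S : DiffStr p K)

lemma Frame.co_d_mem_RR (σ : Finset I) (ω : DF K) : A.co σ (S.d ω) ∈ RR (A.PB p) σ := by
  refine A.ind (fun _ => True) ((RR (A.PB p) σ).comap ((A.co σ).toAddMonoidHom.comp S.d)) ?_ ω (by simp)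
  intro ρ _ a
  change A.co σ (S.d (a • A.BB ρ)) ∈ RR (A.PB p) σ
  rw [A.d_smul_BB]
  refine A.dB_mem ((RR (A.PB p) σ).comap (A.co σ).toAddMonoidHom) a ρ ?_
  intro i hi
  change A.co σ _ ∈ RR (A.PB p) σ
  rw [map_smul, A.co_BB]
  split_ifs with h
  · rw [smul_eq_mul, mul_one]; exact RR_mem (A.PB p) (by simp [h]) a
  · simp [zero_mem]

lemma Frame.co_d_insert (σ : Finset I) (j : I) (hj : j ∉ σ) (y : DF K) (hy : y ∈ A.Lle σ) :
    ∃ ε : K, (ε = 1 ∨ ε = -1) ∧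
      A.co (insert j σ) (S.d y) - ε * A.θ j (A.co σ y) ∈ RR (A.PB p) (σ.filter (j < ·)) := by
  obtain ⟨ε, hε, he⟩ := A.e_mul hj
  refine ⟨ε, hε, ?_⟩
  refine A.ind (fun ρ => toColex ρ ≤ toColex σ) ((RR (A.PB p) (σ.filter (j < ·))).comap
    (((A.co (insert j σ)).toAddMonoidHom.comp S.d) -
      (AddMonoidHom.mulLeft ε).comp ((A.θ j).toLinearMap.toAddMonoidHom.comp (A.co σ).toAddMonoidHom))) ?_ y hy
  intro ρ hρ a
  change A.co (insert j σ) (S.d (a • A.BB ρ)) - ε * A.θ j (A.co σ (a • A.BB ρ)) ∈ RR (A.PB p) (σ.filter (j < ·))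
  rw [A.d_smul_BB]
  by_cases hρσ : ρ = σ
  · subst hρσ
    have h1 := A.dB_mem' ((⊥ : AddSubgroup K).comap (A.co (insert j ρ)).toAddMonoidHom) a ρ j (by
      intro i hi hij
      change A.co (insert j ρ) _ = 0
      rw [map_smul, A.co_BB, if_neg, smul_zero]
      intro h
      have : j ∈ insert i ρ := by rw [← h]; simp
      rw [Finset.mem_insert] at this
      tauto)
    have h1 : A.co (insert j ρ) (dForm K a * A.BB ρ - A.θ j a • (A.e j * A.BB ρ)) = 0 := h1
    rw [map_sub, sub_eq_zero] at h1
    rw [h1, he, map_smul, map_smul, map_smul, A.co_BB, A.co_BB, if_pos rfl, if_pos rfl]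
    simp [mul_comm, zero_mem]
  · have hlt : toColex ρ < toColex σ := lt_of_le_of_ne hρ fun h => hρσ (toColex_inj.1 h)
    rw [map_smul _ a, A.co_BB, if_neg (Ne.symm hρσ), smul_zero, map_zero, mul_zero, sub_zero]
    refine A.dB_mem ((RR (A.PB p) (σ.filter (j < ·))).comap (A.co (insert j σ)).toAddMonoidHom) a ρ ?_
    intro i hi
    change A.co (insert j σ) _ ∈ RR (A.PB p) (σ.filter (j < ·))
    rw [map_smul, A.co_BB]
    split_ifs with h
    · rw [smul_eq_mul, mul_one]
      refine RR_mem (A.PB p) ?_ a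
      have hij : i ≠ j := by
        rintro rfl
        apply hρσ
        rw [← Finset.erase_insert hi, ← h, Finset.erase_insert hj]
      have his : i ∈ σ := by
        have : i ∈ insert j σ := by rw [h]; simp
        rw [Finset.mem_insert] at this; tauto
      have hjρ : j ∈ ρ := by
        have : j ∈ insert i ρ := by rw [← h]; simp
        rw [Finset.mem_insert] at this
        rcases this with h | h
        · exact absurd h.symm hij
        · exact h
      obtain ⟨c, hc, hcρ, hb⟩ := clt_iff.1 hlt
      have hci : c = i := by
        have : c ∈ insert i ρ := by rw [← h]; simp [hc]
        rw [Finset.mem_insert] at this; tauto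
      rw [Finset.mem_filter]
      refine ⟨his, ?_⟩
      rw [← hci]
      exact hb j hjρ hj
    · simp [zero_mem]

/-- Lemma X -/
lemma Frame.lemX (σ : Finset I) (z : DF K) (hz : S.d z ∈ A.Lle σ) : A.co σ (S.d z) ∈ SS (A.PB p) σ := by
  refine mem_SS (A.PB p) σ ((A.PB p).fin (A.co σ (S.d z))).toFinset _ ?_ (A.co_d_mem_RR S σ z) ?_
  · intro j hj
    by_contra hcon
    exact hj (by simpa using hcon)
  · intro j hj
    obtain ⟨ε, hε, h⟩ := A.co_d_insert S σ j hj _ hz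
    rw [S.d_d, map_zero, zero_sub] at h
    have h := neg_mem h
    rw [neg_neg] at h
    change A.θ j (A.co σ (S.d z)) ∈ RR (A.PB p) (σ.filter (j < ·))
    rcases hε with rfl | rfl
    · simpa using h
    · simpa using h

/-- Lemma Y -/
lemma Frame.lemY (σ : Finset I) (j : I) (hj : j ∈ σ) (s : K) (hs : s ∈ TT (A.PB p) j) :
    ∃ u : K, (∀ k, A.θ k s = 0 → A.θ k u = 0) ∧ S.d (u • A.BB (σ.erase j)) - s • A.BB σ ∈ A.Llt σ := by
  obtain ⟨ε, hε, he⟩ := A.e_mul (Finset.notMem_erase j σ)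
  rw [Finset.insert_erase hj] at he
  have hεε : ε * ε = 1 := by rcases hε with rfl | rfl <;> simp
  have hθε : ∀ k, A.θ k ε = 0 := by intro k; rcases hε with rfl | rfl <;> simp
  set w := (Dm ((A.PB p).θ j) ^ (p - 2)) s with hw
  have hsw : s = A.θ j w := TT_eq (A.PB p) hs
  have hkw : ∀ k, A.θ k s = 0 → A.θ k w = 0 := by
    intro k hk
    have := θ_pow_comm (A.PB p) j k (p - 2) s
    rw [hw]
    refine this.trans ?_
    have : ((A.PB p).θ k) s = 0 := hk
    rw [this, map_zero]
  refine ⟨ε * w, ?_, ?_⟩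
  · intro k hk
    rw [der_const_mul _ _ _ (hθε k), hkw k hk, mul_zero]
  · have h1 := A.dB_mem' (A.Llt σ).toAddSubgroup (ε * w) (σ.erase j) j ?_
    · rw [A.d_smul_BB]
      rw [he, smul_smul, der_const_mul _ _ _ (hθε j), ← hsw, mul_right_comm, hεε, one_mul] at h1
      exact h1
    · intro i hi hij
      rcases lt_or_gt_of_ne hij with h | h
      · apply A.smul_BB_mem_Llt
        have := clt_insert_lt (Finset.notMem_erase j σ) h
        rwa [Finset.insert_erase hj] at this
      · rw [der_const_mul _ _ _ (hθε i), hkw i (hs.1 i h)]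
        simp [zero_mem]

end forms
end KW
end

noncomputable section
namespace KW
set_option linter.all false
universe u
open Module

lemma exists_semi {E F' : Type*} [Field E] [Field F'] (φ : E →+* F') {I : Type*}
    (b : Basis I E (KaehlerDifferential ℤ E)) (c : I → KaehlerDifferential ℤ F') :
    ∃ Ψ : DF E →+* DF F', (∀ (a : E) (w : DF E), Ψ (a • w) = φ a • Ψ w) ∧
      ∀ i, Ψ (ExteriorAlgebra.ι E (b i)) = ExteriorAlgebra.ι F' (c i) := by
  letI : Algebra E (DF F') := ((algebraMap F' (DF F')).comp φ).toAlgebra' (by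
    intro a x
    exact Algebra.commutes (φ a) x)
  have hsm : ∀ (a : E) (x : DF F'), a • x = φ a • x := by
    intro a x
    rw [Algebra.smul_def, Algebra.smul_def]; rfl
  let f : KaehlerDifferential ℤ E →ₗ[E] DF F' := b.constr E (fun i => ExteriorAlgebra.ι F' (c i))
  have hfb : ∀ i, f (b i) = ExteriorAlgebra.ι F' (c i) := fun i => b.constr_basis _ _ _
  have hr : ∀ m, ∃ y, f m = ExteriorAlgebra.ι F' y := by
    intro m
    have hm : m ∈ Submodule.span E (Set.range b) := b.mem_span m
    induction hm using Submodule.span_induction with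
    | mem x hx => obtain ⟨i, rfl⟩ := hx; exact ⟨_, hfb i⟩
    | zero => exact ⟨0, by simp⟩
    | add x y _ _ hx hy =>
      obtain ⟨x', hx⟩ := hx
      obtain ⟨y', hy⟩ := hy
      exact ⟨x' + y', by rw [map_add, hx, hy, map_add]⟩
    | smul a x _ hx =>
      obtain ⟨x', hx⟩ := hx
      exact ⟨φ a • x', by rw [map_smul, hx, hsm, map_smul]⟩
  let Φ : DF E →ₐ[E] DF F' := ExteriorAlgebra.lift E ⟨f, by
    intro m
    obtain ⟨y, hy⟩ := hr m
    rw [hy, ExteriorAlgebra.ι_sq_zero]⟩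
  refine ⟨Φ.toRingHom, ?_, ?_⟩
  · intro a w
    exact (map_smul Φ a w).trans (hsm _ _)
  · intro i
    refine (ExteriorAlgebra.lift_ι_apply E _ _ _).trans (hfb i)

section leib
variable {p : ℕ} {K : Type u} [Field K] (S : DiffStr p K)

lemma logList_mul_d (l : List K) (w : DF K) :
    S.d ((l.map (dLog K)).prod * w) = (-1) ^ l.length * ((l.map (dLog K)).prod * S.d w) := by
  induction l with
  | nil => simp
  | cons a l ih =>
    rw [List.map_cons, List.prod_cons, mul_assoc, d_dLog_mul, ih, List.length_cons, pow_succ]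
    have : Commute (dLog K a) ((-1) ^ l.length) := (Commute.neg_one_right _).pow_right _
    rw [← mul_assoc, this.eq]
    simp [mul_assoc]

lemma leibniz (n : ℕ) (u : DF K) (hu : u ∈ omegaPow K n) (w : DF K) :
    S.d (u * w) = S.d u * w + (-1) ^ n * (u * S.d w) := by
  let M : AddSubgroup (DF K) :=
    { carrier := {u | S.d (u * w) = S.d u * w + (-1) ^ n * (u * S.d w)}
      zero_mem' := by simp
      add_mem' := by
        intro a b ha hb
        simp only [Set.mem_setOf_eq] at *
        rw [add_mul, map_add, map_add, ha, hb]; noncomm_ring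
      neg_mem' := by
        intro a ha
        simp only [Set.mem_setOf_eq] at *
        rw [neg_mul, map_neg, map_neg, ha]; noncomm_ring }
  refine omegaPow_ind n M ?_ u hu
  intro a l hl _
  change S.d _ = _
  rw [smul_mul_assoc, S.d_smul, logList_mul_d, S.d_smul, d_logList, hl]
  simp [mul_assoc]

lemma ι_mem (x : KaehlerDifferential ℤ K) : ExteriorAlgebra.ι K x ∈ omegaPow K 1 := by
  rw [omegaPow, pow_one]; exact ⟨x, rfl⟩

lemma leibniz1 (u : DF K) (hu : u ∈ omegaPow K 1) (w : DF K) :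
    S.d (u * w) = S.d u * w - u * S.d w := by
  rw [leibniz S 1 u hu]; simp [sub_eq_add_neg]

lemma omegaPow_mul {m n : ℕ} {u w : DF K} (hu : u ∈ omegaPow K m) (hw : w ∈ omegaPow K n) :
    u * w ∈ omegaPow K (m + n) := by
  rw [omegaPow, pow_add]; exact Submodule.mul_mem_mul hu hw

end leib

section forms
variable {K : Type u} [Field K] {I : Type*} [LinearOrder I] (A : Frame K I)

/-- forms of degree n, by coordinates -/
def Frame.Gr (n : ℕ) : Submodule K (DF K) where
  carrier := {x | ∀ ρ : Finset I, ¬ (ρ.card = n) → A.co ρ x = 0}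
  zero_mem' := by intro ρ _; simp
  add_mem' := by
    intro a b ha hb ρ h
    rw [map_add, ha ρ h, hb ρ h, add_zero]
  smul_mem' := by
    intro c a ha ρ h
    rw [map_smul, ha ρ h, smul_zero]

lemma Frame.BB_mem_Gr (a : K) {ρ : Finset I} {n : ℕ} (h : ρ.card = n) : a • A.BB ρ ∈ A.Gr n := by
  refine Submodule.smul_mem _ _ ?_
  intro τ hτ
  rw [A.co_BB, if_neg]
  rintro rfl; exact hτ h

lemma Frame.dForm_mul_Gr (a : K) {n : ℕ} {w : DF K} (hw : w ∈ A.Gr n) : dForm K a * w ∈ A.Gr (n + 1) := by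
  refine A.ind (fun ρ => ρ.card = n) ((A.Gr (n+1)).toAddSubgroup.comap (AddMonoidHom.mulLeft (dForm K a)))
    ?_ w hw
  intro σ hσ c
  change dForm K a * (c • A.BB σ) ∈ (A.Gr (n+1))
  rw [mul_smul_comm]
  refine Submodule.smul_mem _ _ ?_
  refine A.dB_mem (A.Gr (n+1)).toAddSubgroup a σ ?_
  intro i hi
  exact A.BB_mem_Gr _ (by rw [Finset.card_insert_of_notMem hi, hσ])

lemma Frame.omegaPow_le_Gr (n : ℕ) {w : DF K} (hw : w ∈ omegaPow K n) : w ∈ A.Gr n := by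
  refine omegaPow_ind n (A.Gr n).toAddSubgroup ?_ w hw
  intro a l hl _
  refine Submodule.smul_mem _ _ ?_
  clear hw
  induction l generalizing n with
  | nil =>
    simp only [List.length_nil] at hl
    subst hl
    have := A.BB_mem_Gr 1 (ρ := ∅) (n := 0) rfl
    rw [A.BB_empty, one_smul] at this
    simpa using this
  | cons x l ih =>
    subst hl
    rw [List.map_cons, List.prod_cons, dLog_eq, smul_mul_assoc]
    exact Submodule.smul_mem _ _ (A.dForm_mul_Gr _ (ih l.length rfl (by simp_all)))

variable (p : ℕ) [Fact p.Prime] [CharP K p]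

/-- Frobenius on coordinates -/
def Frame.Fr : DF K →+* DF K := (exists_semi (frobenius K p) A.b A.b).choose

lemma Frame.Fr_smul (a : K) (w : DF K) : A.Fr p (a • w) = a ^ p • A.Fr p w :=
  (exists_semi (frobenius K p) A.b A.b).choose_spec.1 a w

lemma Frame.Fr_e (i : I) : A.Fr p (A.e i) = A.e i :=
  (exists_semi (frobenius K p) A.b A.b).choose_spec.2 i

lemma Frame.Fr_BB' (σ : Finset I) : A.Fr p (A.BB σ) = A.BB σ := by
  rw [A.BB_eq, Frame.lst, List.map_ofFn, map_list_prod, List.map_ofFn]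
  congr 2
  funext i
  simp only [Function.comp_apply]
  rw [← A.e_eq, A.Fr_e]

lemma Frame.Fr_BB (a : K) (σ : Finset I) : A.Fr p (a • A.BB σ) = a ^ p • A.BB σ := by
  rw [A.Fr_smul, A.Fr_BB']

lemma Frame.co_Fr (σ : Finset I) (w : DF K) : A.co σ (A.Fr p w) = (A.co σ w) ^ p := by
  let M : AddSubgroup (DF K) :=
    { carrier := {u | A.co σ (A.Fr p u) = (A.co σ u) ^ p}
      zero_mem' := by simp [(Fact.out : p.Prime).ne_zero]
      add_mem' := by
        intro a b ha hb
        simp only [Set.mem_setOf_eq] at *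
        rw [map_add, map_add, ha, hb, map_add, add_pow_char]
      neg_mem' := by
        intro a ha
        simp only [Set.mem_setOf_eq] at *
        rw [map_neg, map_neg, ha, map_neg, neg_pow_char'] }
  refine A.ind (fun _ => True) M ?_ w (by simp)
  intro ρ _ a
  change A.co σ _ = _
  rw [A.Fr_BB, map_smul, map_smul, A.co_BB]
  split_ifs <;> simp [(Fact.out : p.Prime).ne_zero]

variable {p} (S : DiffStr p K)

lemma Frame.d_Fr (w : DF K) : S.d (A.Fr p w) = 0 := by
  refine A.ind (fun _ => True) ((⊥ : AddSubgroup (DF K)).comap (S.d.comp (A.Fr p).toAddMonoidHom)) ?_ w (by simp)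
  intro ρ _ a
  change S.d (A.Fr p _) = 0
  rw [A.Fr_BB, A.d_smul_BB, dForm_pow_char, zero_mul]

lemma Frame.sp_Fr (n : ℕ) (w : DF K) (hw : w ∈ omegaPow K n) :
    ∃ η ∈ omegaPred K n, S.sp w - A.Fr p w = S.d η := by
  have := A.ind (fun ρ => ρ.card = n) (((omegaPred K n).toAddSubgroup.map S.d).comap
    (S.sp - (A.Fr p).toAddMonoidHom)) ?_ w (A.omegaPow_le_Gr n hw)
  · obtain ⟨η, h1, h2⟩ := this
    exact ⟨η, h1, h2.symm⟩
  intro ρ hρ a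
  have hl := A.lst_length ρ
  rw [hρ] at hl
  subst hl
  obtain ⟨η, h1, h2⟩ := S.sp_log _ a (A.lst ρ).get
  rw [← logList_eq_logForm, ← A.BB_eq] at h2
  refine ⟨η, h1, ?_⟩
  change S.d η = S.sp _ - A.Fr p _
  rw [A.Fr_BB, h2]; abel

end forms
end KW
end

noncomputable section
namespace KW
set_option linter.all false
universe u
open Module

section forms
variable {K : Type u} [Field K] {I : Type*} [LinearOrder I] (A : Frame K I)
variable {p : ℕ} [Fact p.Prime] [CharP K p] (S : DiffStr p K)

lemma d_pow_smul (a : K) (w : DF K) : S.d (a ^ p • w) = a ^ p • S.d w := by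
  rw [S.d_smul, dForm_pow_char, zero_mul, zero_add]

lemma Frame.closed_one_form (J : Finset I) (x : I → K) (hx : ∀ j ∉ J, x j = 0)
    (hsymm : ∀ j k, A.θ k (x j) = A.θ j (x k)) : S.d (∑ l ∈ J, x l • A.e l) = 0 := by
  have h1 : ∀ l, S.d (x l • A.e l) = ∑ k ∈ J, A.θ k (x l) • (A.e k * A.e l) := by
    intro l
    have h2 : S.d (A.e l) = 0 := by
      rw [A.e_eq]; simpa using d_logList S [A.t l]
    rw [S.d_smul, h2, smul_zero, add_zero, A.dForm_eq (x l) J, Finset.sum_mul]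
    · simp
    · intro i hi
      rw [hsymm, hx i hi, map_zero]
  rw [map_sum]
  simp_rw [h1]
  rw [← Finset.sum_product']
  refine Finset.sum_involution (fun a _ => (a.2, a.1)) ?_ ?_ ?_ ?_
  · rintro ⟨a, b⟩ _
    simp only
    rw [hsymm, ← smul_add]
    have : A.e b * A.e a + A.e a * A.e b = 0 := ExteriorAlgebra.ι_add_mul_swap _ _
    rw [this, smul_zero]
  · rintro ⟨a, b⟩ _ h1 h2
    simp only [Prod.mk.injEq] at h2
    obtain ⟨rfl, -⟩ := h2
    apply h1
    simp only
    have : A.e b * A.e b = 0 := ExteriorAlgebra.ι_sq_zero _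
    rw [this, smul_zero]
  · rintro ⟨a, b⟩ h
    simp only [Finset.mem_product] at *; tauto
  · rintro ⟨a, b⟩ h; rfl

lemma Frame.e_mul_mem (M : AddSubgroup (DF K)) (a : K) (i : I) (ρ : Finset I)
    (H : i ∉ ρ → a • A.BB (insert i ρ) ∈ M) : a • (A.e i * A.BB ρ) ∈ M := by
  by_cases h : i ∈ ρ
  · rw [A.e_mul_of_mem h, smul_zero]; exact zero_mem _
  · obtain ⟨ε, hε, e⟩ := A.e_mul h
    have := H h
    rw [e]
    rcases hε with rfl | rfl
    · simpa using this
    · simpa using this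

lemma colex_bdd {i : I} {ρ τ : Finset I} (hτ : ∀ x ∈ τ, x < i) (h : toColex ρ ≤ toColex τ) :
    ∀ x ∈ ρ, x < i := by
  intro x hx
  rcases h.eq_or_lt with h | h
  · rw [toColex_inj] at h; subst h; exact hτ x hx
  · obtain ⟨a, ha, -, hb⟩ := clt_iff.1 h
    by_cases hxt : x ∈ τ
    · exact hτ x hxt
    · exact (hb x hx hxt).trans (hτ a ha)

lemma colex_insert {i : I} {ρ τ : Finset I} (hτ : ∀ x ∈ τ, x < i) (h : toColex ρ < toColex τ) :
    toColex (insert i ρ) < toColex (insert i τ) := by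
  obtain ⟨a, ha, hb, hc⟩ := clt_iff.1 h
  refine clt_iff.2 ⟨a, by simp [ha], ?_, ?_⟩
  · simp [hb, (hτ a ha).ne]
  · intro b hb hb'
    simp only [Finset.mem_insert, not_or] at hb hb'
    exact hc b (hb.resolve_left hb'.1) hb'.2

lemma Frame.lead_mul (i : I) (τ : Finset I) (hτ : ∀ x ∈ τ, x < i) (J : Finset I) (x : I → K) (hi : i ∈ J)
    (hx : ∀ j, i < j → x j = 0) (c : K) (v : DF K) (hv : v - c • A.BB τ ∈ A.Llt τ) :
    (∑ l ∈ J, x l • A.e l) * v - (x i * c) • (A.e i * A.BB τ) ∈ A.Llt (insert i τ) := by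
  have hvle : v ∈ A.Lle τ := by
    have := add_mem (A.Llt_le_Lle τ hv) (A.BB_mem_Lle c τ)
    simpa using this
  have h1 : ∀ l, l < i → ∀ ρ : Finset I, toColex ρ ≤ toColex τ → ∀ a : K,
      a • (A.e l * A.BB ρ) ∈ A.Llt (insert i τ) := by
    intro l hl ρ hρ a
    refine A.e_mul_mem (A.Llt (insert i τ)).toAddSubgroup a l ρ fun _ => ?_
    apply A.smul_BB_mem_Llt
    have hb := colex_bdd hτ hρ
    refine clt_iff.2 ⟨i, by simp, ?_, ?_⟩
    · intro hm
      rcases Finset.mem_insert.1 hm with h | h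
      · exact hl.ne' h
      · exact lt_irrefl _ (hb i h)
    · intro b hm _
      rcases Finset.mem_insert.1 hm with h | h
      · rw [h]; exact hl
      · exact hb b h
  have h2 : ∀ ρ : Finset I, toColex ρ < toColex τ → ∀ a : K,
      a • (A.e i * A.BB ρ) ∈ A.Llt (insert i τ) := by
    intro ρ hρ a
    refine A.e_mul_mem (A.Llt (insert i τ)).toAddSubgroup a i ρ fun _ => ?_
    apply A.smul_BB_mem_Llt
    exact colex_insert hτ hρ
  have h3 : ∀ l, l < i → ∀ w ∈ A.Lle τ, A.e l * w ∈ A.Llt (insert i τ) := by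
    intro l hl w hw
    refine A.ind (fun ρ => toColex ρ ≤ toColex τ)
      ((A.Llt (insert i τ)).toAddSubgroup.comap (AddMonoidHom.mulLeft (A.e l))) ?_ w hw
    intro ρ hρ a
    change A.e l * (a • A.BB ρ) ∈ A.Llt (insert i τ)
    rw [mul_smul_comm]
    exact h1 l hl ρ hρ a
  have h4 : ∀ w ∈ A.Llt τ, A.e i * w ∈ A.Llt (insert i τ) := by
    intro w hw
    refine A.ind (fun ρ => toColex ρ < toColex τ)
      ((A.Llt (insert i τ)).toAddSubgroup.comap (AddMonoidHom.mulLeft (A.e i))) ?_ w hw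
    intro ρ hρ a
    change A.e i * (a • A.BB ρ) ∈ A.Llt (insert i τ)
    rw [mul_smul_comm]
    exact h2 ρ hρ a
  have h5 : (∑ l ∈ J, x l • A.e l) * v - (x i * c) • (A.e i * A.BB τ) =
      x i • (A.e i * (v - c • A.BB τ)) + ∑ l ∈ J.erase i, x l • (A.e l * v) := by
    rw [← Finset.add_sum_erase _ _ hi, add_mul, Finset.sum_mul, mul_sub, smul_sub, mul_smul_comm, smul_smul]
    simp only [smul_mul_assoc]
    abel
  rw [h5]
  refine add_mem (Submodule.smul_mem _ _ (h4 _ hv)) (sum_mem fun l hl => ?_)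
  rcases lt_trichotomy l i with h | h | h
  · exact Submodule.smul_mem _ _ (h3 l h v hvle)
  · exact absurd h (Finset.ne_of_mem_erase hl)
  · rw [hx l h, zero_smul]; exact zero_mem _

lemma Frame.lift (κ : K) (hκ0 : κ ≠ 0) (hκ : ∀ i, A.θ i κ = 0) (s : I → K) (τ : Finset I) :
    (∀ i ∈ τ, s i ∈ TT (A.PB p) i) →
    ∃ v, v - ((κ + ∑ i ∈ τ, s i) / κ) • A.BB τ ∈ A.Llt τ ∧ S.d v = 0 ∧
      ∃ z, A.Fr p v = ((κ + ∑ i ∈ τ, s i) / κ) ^ p • v + S.d z := by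
  induction τ using Finset.induction_on_max with
  | empty =>
    intro _
    refine ⟨1, ?_, S.d_one, 0, ?_⟩
    · rw [Finset.sum_empty, add_zero, div_self hκ0, A.BB_empty, one_smul, sub_self]; exact zero_mem _
    · rw [Finset.sum_empty, add_zero, div_self hκ0]; simp
  | insert i τ hτ ih =>
    intro hs
    have hiτ : i ∉ τ := fun h => lt_irrefl _ (hτ i h)
    obtain ⟨v, hv, hdv, z, hz⟩ := ih (fun j hj => hs j (by simp [hj]))
    have hsi := hs i (by simp)
    set b' := κ + ∑ i ∈ τ, s i with hb'
    have hb'0 : b' ≠ 0 := const_add_ne_zero (A.PB p) τ κ hκ0 hκ s (fun j hj => hs j (by simp [hj]))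
    have hb0 : κ + ∑ j ∈ insert i τ, s j ≠ 0 := const_add_ne_zero (A.PB p) _ κ hκ0 hκ s hs
    have hbb : κ + ∑ j ∈ insert i τ, s j = b' + s i := by
      rw [Finset.sum_insert hiτ, hb']; ring
    rw [hbb] at hb0 ⊢
    have hθb : ∀ j, i ≤ j → A.θ j b'⁻¹ = 0 := by
      intro j hj
      have : A.θ j b' = 0 := by
        rw [hb', map_add, hκ, zero_add, map_sum]
        refine Finset.sum_eq_zero fun l hl => ?_
        exact (hs l (by simp [hl])).1 j ((hτ l hl).trans_le hj)
      rw [Derivation.leibniz_inv, this, smul_zero]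
    set W := (Dm ((A.PB p).θ i) ^ (p - 2)) (s i) with hW
    have hsw : s i = A.θ i W := TT_eq (A.PB p) hsi
    have hkw : ∀ k, A.θ k (s i) = 0 → A.θ k W = 0 := by
      intro k hk
      have := θ_pow_comm (A.PB p) i k (p - 2) (s i)
      rw [hW]
      refine this.trans ?_
      have : ((A.PB p).θ k) (s i) = 0 := hk
      rw [this, map_zero]
    set h := 1 + b'⁻¹ * s i with hh
    have hhb : h * b' = b' + s i := by rw [hh]; field_simp
    have hh0 : h ≠ 0 := by
      rintro h0; rw [h0, zero_mul] at hhb; exact hb0 hhb.symm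
    obtain ⟨x, hxi, hxj, hfin, hsymm, g, hg⟩ := lemT (A.PB p) i h (b'⁻¹ * W) hh0
      (by
        change A.θ i _ = _
        rw [der_const_mul _ _ _ (hθb i le_rfl), ← hsw, hh]; ring)
      (by
        intro j hj
        change A.θ j _ = _
        rw [hh, map_add, der_const_mul _ _ _ (hθb j hj.le)]
        have : A.θ j (s i) = 0 := hsi.1 j hj
        rw [this]; simp)
      (by
        intro j hj
        change A.θ j _ = _
        rw [der_const_mul _ _ _ (hθb j hj.le), hkw j (hsi.1 j hj), mul_zero])
    set J := hfin.toFinset with hJ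
    have hxJ : ∀ j ∉ J, x j = 0 := by
      intro j hj; by_contra hc; exact hj (by simpa [hJ] using hc)
    have hiJ : i ∈ J := by simpa [hJ, hxi] using hh0
    set η := ∑ l ∈ J, x l • A.e l with hη
    have hdη : S.d η = 0 := A.closed_one_form S J x hxJ hsymm
    have hη1 : η ∈ omegaPow K 1 := sum_mem fun l _ => Submodule.smul_mem _ _ (ι_mem _)
    have hFη : A.Fr p η = h ^ p • η + dForm K g := by
      rw [A.dForm_eq g J, hη, map_sum, Finset.smul_sum, ← Finset.sum_add_distrib]
      · refine Finset.sum_congr rfl fun l _ => ?_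
        have : A.θ l g = x l ^ p - h ^ p * x l := (hg l).symm
        rw [A.Fr_smul, A.Fr_e, this, smul_smul, ← add_smul]
        congr 1; ring
      · intro l hl
        have : A.θ l g = x l ^ p - h ^ p * x l := (hg l).symm
        rw [this, hxJ l hl]
        simp [(Fact.out : p.Prime).ne_zero]
    have hlead := A.lead_mul i τ hτ J x hiJ hxj (b' / κ) v hv
    obtain ⟨ε, hε, he⟩ := A.e_mul hiτ
    have hεε : ε * ε = 1 := by rcases hε with rfl | rfl <;> simp
    have hεp : ε ^ p = ε := by
      rcases hε with rfl | rfl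
      · simp
      · rw [neg_pow_char', one_pow]
    set c := b' / κ with hc
    have hbc : (b' + s i) / κ = h * c := by rw [← hhb, hc]; ring
    rw [hbc]
    refine ⟨ε • (η * v), ?_, ?_, ε • (-(h ^ p • (η * z)) + (c ^ p * g) • v + g • S.d z), ?_⟩
    · rw [he, smul_smul] at hlead
      have := Submodule.smul_mem _ ε hlead
      rw [smul_sub, smul_smul, hxi] at this
      have e1 : ε * (h * c * ε) = h * c := by linear_combination (h * c) * hεε
      rwa [e1] at this
    · rw [← hεp, d_pow_smul, leibniz1 S η hη1, hdη, hdv]; simp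
    · rw [A.Fr_smul, map_mul, hFη, hz, hεp]
      conv_rhs => rw [← hεp]
      rw [d_pow_smul, hεp, map_add, map_add, map_neg, d_pow_smul, leibniz1 S η hη1, hdη, S.d_smul,
        S.d_smul, S.d_d, hdv]
      have : dForm K (c ^ p * g) = c ^ p • dForm K g := by
        rw [dForm_mul, dForm_pow_char, smul_zero, add_zero]
      rw [this, mul_pow]
      simp only [add_mul, mul_add, smul_mul_assoc, mul_smul_comm, smul_add, smul_smul, zero_mul, mul_zero,
        smul_zero, add_zero, zero_sub, smul_neg, neg_neg]
      rw [show ε * (c ^ p * h ^ p) = h ^ p * c ^ p * ε by ring]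
      abel

lemma Frame.lift1 (a : K) (s : I → K) (τ : Finset I) 
    (hs : ∀ i ∈ τ, s i ∈ TT (A.PB p) i) (ha : a = a ^ p + ∑ i ∈ τ, s i) : 
    ∃ v, v - a • A.BB τ ∈ A.Llt τ ∧ ∃ z, A.Fr p v - v = S.d z := by
  by_cases ha0 : a = 0
  · refine ⟨0, ?_, 0, by simp⟩
    rw [ha0]; simp
  obtain ⟨v, h1, h2, z, h3⟩ := A.lift S (a ^ p) (pow_ne_zero _ ha0) (fun i => der_pow_char _ _) s τ hs
  rw [← ha] at h1 h3
  refine ⟨a ^ p • v, ?_, (a ^ p) ^ p • z, ?_⟩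
  · have := Submodule.smul_mem _ (a ^ p) h1
    rw [smul_sub, smul_smul, mul_div_cancel₀ _ (pow_ne_zero _ ha0)] at this
    exact this
  · rw [A.Fr_smul, h3, d_pow_smul, smul_add, smul_smul, ← mul_pow, mul_div_cancel₀ _ (pow_ne_zero _ ha0)]
    abel

end forms
end KW
end

noncomputable section
namespace KW
set_option linter.all false
universe u
open Module

section forms
variable {K : Type u} [Field K] {I : Type*} [LinearOrder I] (A : Frame K I) (I₀ : Set I)

def Frame.DD : AddSubgroup K where
  carrier := {a | ∀ j ∉ I₀, A.θ j a = 0}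
  zero_mem' := by intro j _; simp
  add_mem' := by intro a b ha hb j hj; rw [map_add, ha j hj, hb j hj, add_zero]
  neg_mem' := by intro a ha j hj; rw [map_neg, ha j hj, neg_zero]

def Frame.AA (n : ℕ) : AddSubgroup (DF K) where
  carrier := {x | ∀ ρ : Finset I, A.co ρ x ∈ A.DD I₀ ∧ (¬ ((∀ i ∈ ρ, i ∈ I₀) ∧ ρ.card = n) → A.co ρ x = 0)}
  zero_mem' := by intro ρ; rw [map_zero]; exact ⟨zero_mem _, fun _ => rfl⟩
  add_mem' := by
    intro a b ha hb ρ
    rw [map_add]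
    exact ⟨add_mem (ha ρ).1 (hb ρ).1, fun h => by rw [(ha ρ).2 h, (hb ρ).2 h, add_zero]⟩
  neg_mem' := by
    intro a ha ρ
    rw [map_neg]
    exact ⟨neg_mem (ha ρ).1, fun h => by rw [(ha ρ).2 h, neg_zero]⟩

lemma Frame.smul_BB_mem_AA {n : ℕ} (a : K) (ha : a ∈ A.DD I₀) (σ : Finset I) (h : ∀ i ∈ σ, i ∈ I₀)
    (hn : σ.card = n) : a • A.BB σ ∈ A.AA I₀ n := by
  intro ρ
  rw [map_smul, A.co_BB]
  split_ifs with hr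
  · subst hr
    refine ⟨by simpa using ha, fun h' => absurd ⟨h, hn⟩ h'⟩
  · rw [smul_zero]; exact ⟨zero_mem _, fun _ => rfl⟩

variable {p : ℕ} [Fact p.Prime] [CharP K p] (S : DiffStr p K)

def Frame.CC (n : ℕ) : AddSubgroup (DF K) := AddSubgroup.closure
  ({x | ∃ a ∈ A.DD I₀, ∃ σ : Finset I, (∀ i ∈ σ, i ∈ I₀) ∧ σ.card = n ∧ x = (a ^ p - a) • A.BB σ} ∪
   {x | ∃ u ∈ A.DD I₀, ∃ τ : Finset I, (∀ i ∈ τ, i ∈ I₀) ∧ τ.card + 1 = n ∧ x = S.d (u • A.BB τ)})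

lemma Frame.CC_le (n : ℕ) : A.CC I₀ S n ≤ A.AA I₀ n := by
  rw [Frame.CC, AddSubgroup.closure_le]
  rintro x (⟨a, ha, σ, h1, h2, rfl⟩ | ⟨u, hu, τ, h1, h2, rfl⟩)
  · refine A.smul_BB_mem_AA I₀ _ ?_ σ h1 h2
    refine sub_mem (fun j hj => der_pow_char _ _) ha
  · rw [A.d_smul_BB]
    refine A.dB_mem _ u τ fun i hi => ?_
    by_cases hiI : i ∈ I₀
    · refine A.smul_BB_mem_AA I₀ _ ?_ _ ?_ ?_
      · intro j hj
        have := (A.PB p).comm j i u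
        refine this.trans ?_
        have : (A.PB p).θ j u = 0 := hu j hj
        rw [this, map_zero]
      · intro k hk
        rcases Finset.mem_insert.1 hk with h | h
        · rw [h]; exact hiI
        · exact h1 k h
      · rw [Finset.card_insert_of_notMem hi, h2]
    · rw [hu i hiI, zero_smul]; exact zero_mem _

lemma Frame.descend (x v : DF K) (Q : Prop) (h0 : x = 0 → Q)
    (H : ∀ σ, (A.co σ x ≠ 0 ∨ A.co σ v ≠ 0) → x ∈ A.Lle σ → v ∈ A.Lle σ → Q) : Q := by
  classical
  let T : Finset (Finset I) := (A.BB.repr x).support ∪ (A.BB.repr v).support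
  have hT : ∀ σ, σ ∈ T ↔ (A.co σ x ≠ 0 ∨ A.co σ v ≠ 0) := by intro σ; simp [T, Frame.co]
  by_cases hne : T.Nonempty
  · obtain ⟨σ, hσ, hmax⟩ := T.exists_max_image (fun σ => toColex σ) hne
    refine H σ ((hT σ).1 hσ) ?_ ?_
    · intro ρ hρ
      by_contra hc
      exact hρ (hmax ρ ((hT ρ).2 (Or.inl hc)))
    · intro ρ hρ
      by_contra hc
      exact hρ (hmax ρ ((hT ρ).2 (Or.inr hc)))
  · apply h0
    rw [Finset.not_nonempty_iff_eq_empty] at hne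
    have : (A.BB.repr x).support = ∅ := by
      apply Finset.subset_empty.1; rw [← hne]; exact Finset.subset_union_left
    simpa using this

lemma Frame.Fr_Lle {σ : Finset I} {v : DF K} (hv : v ∈ A.Lle σ) : A.Fr p v ∈ A.Lle σ := by
  intro ρ hρ
  rw [A.co_Fr, hv ρ hρ, zero_pow (Fact.out : p.Prime).ne_zero]

lemma Frame.sub_lead {σ : Finset I} {v : DF K} (hv : v ∈ A.Lle σ) : v - A.co σ v • A.BB σ ∈ A.Llt σ := by
  rw [A.Llt_iff (sub_mem hv (A.BB_mem_Lle _ _)), map_sub, map_smul, A.co_BB, if_pos rfl]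
  simp

lemma Frame.key_aux [WellFoundedLT I] (hI : ∀ i ∈ I₀, ∀ j ∉ I₀, i < j) (n : ℕ) (σ : Finset I) :
    ∀ x v z : DF K, x ∈ A.AA I₀ n → x ∈ A.Lle σ → v ∈ A.Lle σ → x = A.Fr p v - v + S.d z →
      x ∈ A.CC I₀ S n := by
  induction σ using (colex_wf (I := I)).induction with
  | h σ ih =>
  have ih' : ∀ x v z : DF K, x ∈ A.AA I₀ n → x ∈ A.Llt σ → v ∈ A.Llt σ → x = A.Fr p v - v + S.d z →
      x ∈ A.CC I₀ S n := by
    intro x v z hx hxσ hvσ hxv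
    refine A.descend x v _ (fun h => by rw [h]; exact zero_mem _) ?_
    intro σ' h1 h2 h3
    refine ih σ' ?_ x v z hx h2 h3 hxv
    by_contra hc
    rcases h1 with h | h
    · exact h (hxσ σ' hc)
    · exact h (hvσ σ' hc)
  intro x v z hx hxσ hvσ hxv
  have hdz : S.d z = x - A.Fr p v + v := by rw [hxv]; abel
  have hdzσ : S.d z ∈ A.Lle σ := by
    rw [hdz]; exact add_mem (sub_mem hxσ (A.Fr_Lle hvσ)) hvσ
  obtain ⟨f, hf, hs⟩ := A.lemX S σ z hdzσ
  have hco : A.co σ x = A.co σ v ^ p - A.co σ v + ∑ j ∈ σ, f j := by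
    rw [hxv, map_add, map_sub, A.co_Fr, hs]
  set a := A.co σ v with ha
  by_cases hξ : A.co σ x = 0
  · have hxlt := (A.Llt_iff hxσ).2 hξ
    obtain ⟨v₁, hv₁, z₁, hz₁⟩ := A.lift1 S a f σ hf (by rw [hξ] at hco; linear_combination hco)
    refine ih' x (v - v₁) (z + z₁) hx hxlt ?_ ?_
    · have := sub_mem (A.sub_lead hvσ) hv₁
      rw [← ha] at this
      simpa using this
    · rw [hxv, map_sub, map_add, ← hz₁]; abel
  · obtain ⟨hσ1, hσ2⟩ : (∀ i ∈ σ, i ∈ I₀) ∧ σ.card = n := by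
      by_contra hc; exact hξ ((hx σ).2 hc)
    have hfD : ∀ i ∈ σ, ∀ j ∉ I₀, A.θ j (f i) = 0 := by
      intro i hi j hj
      exact (hf i hi).1 j (hI i (hσ1 i hi) j hj)
    have haD : a ∈ A.DD I₀ := by
      intro j hj
      have h1 := (hx σ).1 j hj
      rw [hco, map_add, map_sub, der_pow_char, map_sum, Finset.sum_eq_zero (fun i hi => hfD i hi j hj)] at h1
      simpa using h1
    have hY : ∀ i, ∃ u : K, i ∈ σ → (∀ k, A.θ k (f i) = 0 → A.θ k u = 0) ∧
        S.d (u • A.BB (σ.erase i)) - f i • A.BB σ ∈ A.Llt σ := by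
      intro i
      by_cases hi : i ∈ σ
      · obtain ⟨u, hu⟩ := A.lemY S σ i hi (f i) (hf i hi)
        exact ⟨u, fun _ => hu⟩
      · exact ⟨0, fun h => absurd h hi⟩
    choose u hu using hY
    have hc1 : (a ^ p - a) • A.BB σ ∈ A.CC I₀ S n :=
      AddSubgroup.subset_closure (Or.inl ⟨a, haD, σ, hσ1, hσ2, rfl⟩)
    have hc2 : ∑ i ∈ σ, S.d (u i • A.BB (σ.erase i)) ∈ A.CC I₀ S n := by
      refine sum_mem fun i hi => AddSubgroup.subset_closure (Or.inr ⟨u i, ?_, σ.erase i, ?_, ?_, rfl⟩)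
      · intro j hj; exact (hu i hi).1 j (hfD i hi j hj)
      · intro j hj; exact hσ1 j (Finset.mem_of_mem_erase hj)
      · rw [Finset.card_erase_add_one hi, hσ2]
    have hc := add_mem hc1 hc2
    set y := (a ^ p - a) • A.BB σ + ∑ i ∈ σ, S.d (u i • A.BB (σ.erase i)) with hy
    have : x - y ∈ A.CC I₀ S n := by
      refine ih' (x - y) (v - a • A.BB σ) (z - ∑ i ∈ σ, u i • A.BB (σ.erase i)) ?_ ?_ (A.sub_lead hvσ) ?_
      · exact sub_mem hx (A.CC_le I₀ S n hc)
      · have h1 := A.sub_lead hxσ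
        have h2 : ∑ i ∈ σ, (S.d (u i • A.BB (σ.erase i)) - f i • A.BB σ) ∈ A.Llt σ :=
          sum_mem fun i hi => (hu i hi).2
        have h3 := sub_mem h1 h2
        rw [hco, add_smul, Finset.sum_sub_distrib, ← Finset.sum_smul] at h3
        convert h3 using 1
        rw [hy]; abel
      · rw [map_sub, map_sub, map_sum, A.Fr_BB, hy, hxv, sub_smul]; abel
    have := add_mem this hc
    simpa using this

lemma Frame.key [WellFoundedLT I] (hI : ∀ i ∈ I₀, ∀ j ∉ I₀, i < j) (n : ℕ) (x v z : DF K)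
    (hx : x ∈ A.AA I₀ n) (h : x = A.Fr p v - v + S.d z) : x ∈ A.CC I₀ S n := by
  refine A.descend x v _ (fun h => by rw [h]; exact zero_mem _) ?_
  intro σ _ h1 h2
  exact A.key_aux I₀ S hI n σ x v z hx h1 h2 h

end forms
end KW
end

noncomputable section
namespace KW
set_option linter.all false
universe u
open Module

lemma exists_frame {F : Type*} {E : Type u} [Field F] [Field E] [Algebra F E] :
    ∃ (I : Type u) (_ : LinearOrder I) (_ : WellFoundedLT I) (A : Frame E I) (I₀ : Set I),
      (∀ i ∈ I₀, ∀ j ∉ I₀, i < j) ∧ (∀ i ∈ I₀, ∃ f : F, A.t i = algebraMap F E f) ∧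
      ∀ (f : F), ∀ j ∉ I₀, A.θ j (algebraMap F E f) = 0 := by
  classical
  obtain ⟨B1, h1s, h1span, h1li⟩ := exists_linearIndependent E
    (Set.range fun f : F => KaehlerDifferential.D ℤ E (algebraMap F E f))
  have h1li : LinearIndepOn E id B1 := h1li
  obtain ⟨B2, h2s, h12, h2span, h2li⟩ := exists_linearIndepOn_id_extension h1li
    (t := Set.range (KaehlerDifferential.D ℤ E)) (by
      intro x hx
      obtain ⟨f, rfl⟩ := h1s hx
      exact ⟨_, rfl⟩)
  have htop : ⊤ ≤ Submodule.span E (Set.range (Subtype.val : B2 → KaehlerDifferential ℤ E)) := by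
    rw [Subtype.range_coe, ← KaehlerDifferential.span_range_derivation ℤ E, Submodule.span_le]
    exact h2span
  let b0 : Basis B2 E (KaehlerDifferential ℤ E) := Basis.mk h2li htop
  have hb0 : ∀ i, b0 i = i.1 := fun i => (Basis.mk_apply h2li htop i).trans rfl
  have ht : ∀ i : B2, ∃ x : E, KaehlerDifferential.D ℤ E x = i.1 ∧
      (i.1 ∈ B1 → ∃ f : F, x = algebraMap F E f) := by
    intro i
    by_cases h : i.1 ∈ B1
    · obtain ⟨f, hf⟩ := h1s h
      exact ⟨_, hf, fun _ => ⟨f, rfl⟩⟩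
    · obtain ⟨x, hx⟩ := h2s i.2
      exact ⟨x, hx, fun h' => absurd h' h⟩
  choose t ht1 ht2 using ht
  have ht0 : ∀ i, t i ≠ 0 := by
    intro i h
    have h1 := ht1 i
    rw [h, map_zero, ← hb0] at h1
    exact b0.ne_zero i h1.symm
  let g : B2 → Bool ×ₗ Cardinal.{u} := fun i => toLex (decide (i.1 ∉ B1), embeddingToCardinal i)
  have hg : Function.Injective g := by
    intro i j h
    have : embeddingToCardinal i = embeddingToCardinal j := congrArg (fun x => (ofLex x).2) h
    exact embeddingToCardinal.injective this
  letI : LinearOrder B2 := LinearOrder.lift' g hg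
  have hlt : ∀ i j : B2, i < j ↔ g i < g j := fun i j => Iff.rfl
  let A : Frame E B2 :=
    { b := b0.isUnitSMul (w := fun i => (t i)⁻¹) (fun i => (inv_ne_zero (ht0 i)).isUnit)
      t := t
      t_ne := ht0
      hb := by intro i; rw [Basis.isUnitSMul_apply, hb0, ht1] }
  refine ⟨B2, inferInstance, ⟨InvImage.wf g wellFounded_lt⟩, A, {i | i.1 ∈ B1}, ?_, ?_, ?_⟩
  · intro i hi j hj
    rw [hlt, Prod.Lex.toLex_lt_toLex]
    left
    simp only [Set.mem_setOf_eq] at hi hj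
    simp [hi, hj]
  · intro i hi
    exact ht2 i hi
  · intro f j hj
    rw [A.θ_apply]
    have hmem : KaehlerDifferential.D ℤ E (algebraMap F E f) ∈ Submodule.span E B1 := by
      rw [h1span]; exact Submodule.subset_span ⟨f, rfl⟩
    have hle : Submodule.span E B1 ≤ LinearMap.ker (A.b.coord j) := by
      rw [Submodule.span_le]
      intro x hx
      have : x = t ⟨x, h12 hx⟩ • A.b ⟨x, h12 hx⟩ := by
        rw [← A.D_t]; exact (ht1 ⟨x, h12 hx⟩).symm
      rw [SetLike.mem_coe, LinearMap.mem_ker, this, map_smul, Basis.coord_apply, Basis.repr_self,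
        Finsupp.single_eq_of_ne, smul_zero]
      rintro rfl
      exact hj hx
    exact hle hmem

section forms
variable {K : Type u} [Field K] {I : Type*} [LinearOrder I] (A : Frame K I) (I₀ : Set I)

lemma Frame.AA_ind (n : ℕ) (M : AddSubgroup (DF K))
    (H : ∀ σ : Finset I, (∀ i ∈ σ, i ∈ I₀) → σ.card = n → ∀ a ∈ A.DD I₀, a • A.BB σ ∈ M)
    (x : DF K) (hx : x ∈ A.AA I₀ n) : x ∈ M := by
  rw [← A.BB.linearCombination_repr x, Finsupp.linearCombination_apply]
  refine sum_mem fun σ hσ => ?_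
  have h : A.co σ x ≠ 0 := by simpa using hσ
  obtain ⟨h1, h2⟩ : (∀ i ∈ σ, i ∈ I₀) ∧ σ.card = n := by
    by_contra hc; exact h ((hx σ).2 hc)
  exact H σ h1 h2 _ (hx σ).1

lemma Frame.DD_mul {a b : K} (ha : a ∈ A.DD I₀) (hb : b ∈ A.DD I₀) : a * b ∈ A.DD I₀ := by
  intro j hj
  rw [Derivation.leibniz, ha j hj, hb j hj]; simp

lemma Frame.DD_inv {a : K} (ha : a ∈ A.DD I₀) : a⁻¹ ∈ A.DD I₀ := by
  intro j hj
  rw [Derivation.leibniz_inv, ha j hj]; simp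

lemma Frame.AA_smul {n : ℕ} {a : K} (ha : a ∈ A.DD I₀) {x : DF K} (hx : x ∈ A.AA I₀ n) : a • x ∈ A.AA I₀ n := by
  intro ρ
  rw [map_smul]
  exact ⟨A.DD_mul I₀ ha (hx ρ).1, fun h => by rw [(hx ρ).2 h, smul_zero]⟩

lemma Frame.AA_dForm {p : ℕ} [Fact p.Prime] [CharP K p] {n : ℕ} {y : K} (hy : y ∈ A.DD I₀) {x : DF K} (hx : x ∈ A.AA I₀ n) :
    dForm K y * x ∈ A.AA I₀ (n + 1) := by
  refine A.AA_ind I₀ n ((A.AA I₀ (n + 1)).comap (AddMonoidHom.mulLeft (dForm K y))) ?_ x hx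
  intro σ h1 h2 a ha
  change dForm K y * (a • A.BB σ) ∈ A.AA I₀ (n + 1)
  rw [mul_smul_comm]
  refine A.AA_smul I₀ ha ?_
  refine A.dB_mem _ y σ fun i hi => ?_
  by_cases hiI : i ∈ I₀
  · refine A.smul_BB_mem_AA I₀ _ ?_ _ ?_ ?_
    · intro j hj
      have := (A.PB p).comm j i y
      refine this.trans ?_
      have : (A.PB p).θ j y = 0 := hy j hj
      rw [this, map_zero]
    · intro k hk
      rcases Finset.mem_insert.1 hk with h | h
      · rw [h]; exact hiI
      · exact h1 k h
    · rw [Finset.card_insert_of_notMem hi, h2]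
  · rw [hy i hiI, zero_smul]; exact zero_mem _

lemma Frame.AA_list {p : ℕ} [Fact p.Prime] [CharP K p] (l : List K) (hl : ∀ y ∈ l, y ∈ A.DD I₀) :
    (l.map (dLog K)).prod ∈ A.AA I₀ l.length := by
  induction l with
  | nil =>
    have := A.smul_BB_mem_AA I₀ (n := 0) 1 (fun j hj => by simp) ∅ (by simp) rfl
    rw [A.BB_empty, one_smul] at this
    simpa using this
  | cons y l ih =>
    rw [List.map_cons, List.prod_cons, dLog_eq, smul_mul_assoc]
    exact A.AA_smul I₀ (A.DD_inv I₀ (hl y (by simp))) (A.AA_dForm I₀ (p := p) (hl y (by simp))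
      (ih (fun z hz => hl z (by simp [hz]))))

end forms

section res
variable {p : ℕ} {F E : Type*} [Field F] [Field E] [Algebra F E]
    {SF : DiffStr p F} {SE : DiffStr p E} (R : DiffRes p F E SF SE)

lemma res_dLog (a : F) : R.res (dLog F a) = dLog E (algebraMap F E a) := by
  rw [dLog_eq, R.res_smul, R.res_dForm, dLog_eq, map_inv₀]

lemma res_logList (l : List F) : R.res (l.map (dLog F)).prod = ((l.map (algebraMap F E)).map (dLog E)).prod := by
  induction l with
  | nil => simpa using R.res_one
  | cons a l ih => 
    rw [List.map_cons, List.prod_cons, R.res_mul, res_dLog, ih]; simp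

lemma res_AA [Fact p.Prime] [CharP E p] {I : Type*} [LinearOrder I] (A : Frame E I) (I₀ : Set I)
    (h : ∀ f : F, algebraMap F E f ∈ A.DD I₀) (n : ℕ) (ω : DF F) (hω : ω ∈ omegaPow F n) :
    R.res ω ∈ A.AA I₀ n := by
  refine omegaPow_ind n ((A.AA I₀ n).comap R.res) ?_ ω hω
  intro a l hl _
  change R.res _ ∈ A.AA I₀ n
  rw [R.res_smul, res_logList]
  refine A.AA_smul I₀ (h a) ?_
  have := A.AA_list I₀ (p := p) (l.map (algebraMap F E)) (by
    intro y hy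
    obtain ⟨f, -, rfl⟩ := List.mem_map.1 hy
    exact h f)
  rwa [List.length_map, hl] at this

end res
end KW
end

noncomputable section
namespace KW
set_option linter.all false
universe u
open Module

section gen
variable {p : ℕ} {K : Type*} [Field K] (S : DiffStr p K)

lemma sp_logList (a : K) (l : List K) : ∃ η ∈ omegaPred K l.length,
    S.sp (a • (l.map (dLog K)).prod) = a ^ p • (l.map (dLog K)).prod + S.d η := by
  rw [logList_eq_logForm]; exact S.sp_log _ a _

lemma d_mem_hRel (n : ℕ) (η : DF K) (hη : η ∈ omegaPred K n) : S.d η ∈ hRel S n :=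
  (le_sup_right : _ ≤ hRel S n) ⟨η, hη, rfl⟩

lemma as_mem_hRel (n : ℕ) (v : DF K) (hv : v ∈ omegaPow K n) : S.sp v - v ∈ hRel S n :=
  (le_sup_left : _ ≤ hRel S n) ⟨v, hv, rfl⟩

lemma hRel_iff (n : ℕ) (x : DF K) : x ∈ hRel S n ↔
    ∃ v ∈ omegaPow K n, ∃ z ∈ omegaPred K n, x = S.sp v - v + S.d z := by
  constructor
  · intro h
    obtain ⟨y, ⟨v, hv, rfl⟩, w, ⟨z, hz, rfl⟩, rfl⟩ := AddSubgroup.mem_sup.1 h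
    exact ⟨v, hv, z, hz, rfl⟩
  · rintro ⟨v, hv, z, hz, rfl⟩
    exact add_mem (as_mem_hRel S n v hv) (d_mem_hRel S n z hz)

lemma pow_sub_mem (a : K) (l : List K) (n : ℕ) (hn : l.length = n) :
    a ^ p • (l.map (dLog K)).prod - a • (l.map (dLog K)).prod ∈ hRel S n := by
  subst hn
  obtain ⟨η, h1, h2⟩ := sp_logList S a l
  have h3 := as_mem_hRel S _ _ (Submodule.smul_mem _ a (logList_mem l))
  have h4 := sub_mem h3 (d_mem_hRel S _ η h1)
  rw [h2] at h4
  convert h4 using 1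
  abel

lemma pow_pow_sub_mem (a : K) (l : List K) (n : ℕ) (hn : l.length = n) (e : ℕ) :
    a ^ p ^ e • (l.map (dLog K)).prod - a • (l.map (dLog K)).prod ∈ hRel S n := by
  induction e with
  | zero => simp [zero_mem]
  | succ e ih =>
    have := add_mem (pow_sub_mem S (a ^ p ^ e) l n hn) ih
    rw [← pow_mul, ← pow_succ] at this
    simpa using this

lemma logList_nu (l : List K) (n : ℕ) (hn : l.length = n) : (l.map (dLog K)).prod ∈ nuSet S n := by
  subst hn
  refine ⟨logList_mem l, ?_⟩
  obtain ⟨η, h1, h2⟩ := sp_logList S 1 l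
  rw [one_pow, one_smul] at h2
  exact ⟨η, h1, by rw [h2]; abel⟩

lemma logList_comm (l : List K) (a : K) : (l.map (dLog K)).prod * dLog K a =
    (-1) ^ l.length * (dLog K a * (l.map (dLog K)).prod) := by
  induction l with
  | nil => simp
  | cons b l ih =>
    have h1 : dLog K a * dLog K b + dLog K b * dLog K a = 0 := ExteriorAlgebra.ι_add_mul_swap _ _
    have h2 : dLog K b * dLog K a = - (dLog K a * dLog K b) := by
      rw [eq_neg_iff_add_eq_zero, add_comm]; exact h1
    have : Commute (dLog K b) ((-1) ^ l.length) := (Commute.neg_one_right _).pow_right _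
    rw [List.map_cons, List.prod_cons, mul_assoc, ih, ← mul_assoc (dLog K b), this.eq, mul_assoc,
      ← mul_assoc (dLog K b), h2, List.length_cons, pow_succ]
    simp [mul_assoc]

end gen

section ctx
variable (p : ℕ) (F : Type*) {E : Type u} [Field F] [Field E] [Algebra F E]
  {I : Type*} [LinearOrder I] (A : Frame E I) (I₀ : Set I)

structure Ctx where
  φ : E →+* F
  e : ℕ
  hφ : ∀ a, algebraMap F E (φ a) = a ^ p ^ e
  Ψ : DF E →+* DF F
  hΨ : ∀ (a : E) (w : DF E), Ψ (a • w) = φ a • Ψ w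
  f : I → F
  hf : ∀ i ∈ I₀, A.t i = algebraMap F E (f i)
  hΨe : ∀ i ∈ I₀, Ψ (A.e i) = dLog F (f i)
  hD : ∀ f : F, algebraMap F E f ∈ A.DD I₀

variable {p F A I₀} [Fact p.Prime] [CharP F p] [CharP E p]
  {SF : DiffStr p F} {SE : DiffStr p E} (R : DiffRes p F E SF SE) (C : Ctx p F A I₀)

lemma Ctx.φ_alg (y : F) : C.φ (algebraMap F E y) = y ^ p ^ C.e := by
  apply (algebraMap F E).injective
  rw [C.hφ, map_pow]

def NN (n : ℕ) : AddSubgroup (DF F) := AddSubgroup.closure ((hRel SF (n + 1) : Set (DF F)) ∪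
        { x | ∃ u η : DF F, u ∈ omegaPow F 1 ∧ R.res u ∈ hRel SE 1 ∧
            η ∈ nuSet SF n ∧ x = u * η })

lemma hRel_le_NN (n : ℕ) : hRel SF (n + 1) ≤ NN R n := fun x hx =>
  AddSubgroup.subset_closure (Or.inl hx)

lemma neg_one_pow_mul_mem {M : AddSubgroup (DF F)} {x : DF F} (h : x ∈ M) (k : ℕ) : (-1) ^ k * x ∈ M := by
  rcases neg_one_pow_eq_or (DF F) k with h' | h' <;> rw [h'] <;> simpa using h

/-- (G) -/
lemma Ctx.G (n : ℕ) (κ : E) (hκ : dForm E κ = 0) (g : F) (hg : g ≠ 0) (P w : List F)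
    (hn : P.length + w.length = n) :
    C.φ (κ * algebraMap F E g) • ((P.map (dLog F)).prod * dLog F g * (w.map (dLog F)).prod) ∈ NN R n := by
  rw [logList_comm, mul_assoc, ← mul_smul_comm]
  refine neg_one_pow_mul_mem ?_ _
  rw [mul_assoc, ← List.prod_append, ← List.map_append, ← smul_mul_assoc]
  refine AddSubgroup.subset_closure (Or.inr ⟨_, _, ?_, ?_, logList_nu SF (P ++ w) n (by simpa using hn), rfl⟩)
  · exact Submodule.smul_mem _ _ (ι_mem _)
  · rw [R.res_smul, res_dLog, C.hφ]
    have h1 := pow_pow_sub_mem SE (κ * algebraMap F E g) [algebraMap F E g] 1 rfl C.e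
    rw [List.map_cons, List.map_nil, List.prod_singleton] at h1
    have hg' : algebraMap F E g ≠ 0 := by simpa using hg
    have h2 : (κ * algebraMap F E g) • dLog E (algebraMap F E g) = SE.d ((κ * algebraMap F E g) • 1) := by
      rw [d_smul_one, dForm_mul, hκ, smul_zero, add_zero, mul_smul, ← dForm_eq _ hg']
    have h3 : SE.d ((κ * algebraMap F E g) • 1) ∈ hRel SE 1 := by
      apply d_mem_hRel
      change _ ∈ omegaPow E 0
      exact Submodule.smul_mem _ _ (by simpa using logList_mem ([] : List E))
    have := add_mem h1 h3
    rw [← h2] at this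
    simpa using this

/-- good elements -/
def Ctx.G0 (C : Ctx p F A I₀) (g : F) : Prop := g ≠ 0 ∧ C.Ψ (dLog E (algebraMap F E g)) = dLog F g

lemma Ctx.G0_one : C.G0 1 := by
  refine ⟨one_ne_zero, ?_⟩
  simp [dLog]

lemma Ctx.G0_mul {a b : F} (ha : C.G0 a) (hb : C.G0 b) : C.G0 (a * b) := by
  refine ⟨mul_ne_zero ha.1 hb.1, ?_⟩
  rw [map_mul, dLog_mul _ _ (by simpa using ha.1) (by simpa using hb.1), map_add, ha.2, hb.2,
    dLog_mul _ _ ha.1 hb.1]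

lemma Ctx.G0_pow {a : F} (ha : C.G0 a) (n : ℕ) : C.G0 (a ^ n) := by
  induction n with
  | zero => rw [pow_zero]; exact C.G0_one
  | succ n ih => rw [pow_succ]; exact C.G0_mul ih ha

lemma Ctx.G0_f (i : I) (hi : i ∈ I₀) : C.G0 (C.f i) := by
  have h := C.hf i hi
  refine ⟨?_, ?_⟩
  · intro h0
    rw [h0, map_zero] at h
    exact A.t_ne i h
  · rw [← h, ← A.e_eq, C.hΨe i hi]

lemma Ctx.G0_prod (J : Finset I) (hJ : ∀ i ∈ J, i ∈ I₀) (α : I → ℕ) : C.G0 (∏ i ∈ J, C.f i ^ α i) :=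
  Finset.prod_induction _ C.G0 (fun _ _ => C.G0_mul) C.G0_one (fun i hi => C.G0_pow (C.G0_f i (hJ i hi)) _)

lemma Ctx.DD_ind (M : AddSubgroup E) (H : ∀ κ : E, dForm E κ = 0 → ∀ g : F, C.G0 g →
    κ * algebraMap F E g ∈ M) (x : E) (hx : x ∈ A.DD I₀) : x ∈ M := by
  set J := ((A.PB p).fin x).toFinset with hJ
  have hJ' : ∀ i, i ∈ J ↔ A.θ i x ≠ 0 := by intro i; simp [hJ]; rfl
  have hJI : ∀ i ∈ J, i ∈ I₀ := by
    intro i hi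
    by_contra hc
    exact (hJ' i).1 hi (hx i hc)
  refine weight_ind (A.PB p) J M ?_ x ?_
  · intro κ hκ α
    have h1 : ∏ i ∈ J, (A.PB p).t i ^ α i = algebraMap F E (∏ i ∈ J, C.f i ^ α i) := by
      rw [map_prod]
      refine Finset.prod_congr rfl fun i hi => ?_
      rw [map_pow, ← C.hf i (hJI i hi)]; rfl
    rw [h1]
    refine H κ ?_ _ (C.G0_prod J hJI α)
    rw [A.dForm_eq κ ∅ (fun i _ => hκ i)]; simp
  · intro i hi
    by_contra hc
    exact hi ((hJ' i).2 hc)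

lemma Ctx.Ψ_dForm {g : F} (hg : C.G0 g) : C.Ψ (dForm E (algebraMap F E g)) = C.φ (algebraMap F E g) • dLog F g := by
  rw [dForm_eq _ (by simpa using hg.1), C.hΨ, hg.2]

lemma dForm_const {κ : E} (hκ : dForm E κ = 0) (x : E) : dForm E (κ * x) = κ • dForm E x := by
  rw [dForm_mul, hκ, smul_zero, add_zero]

lemma dForm_neg' (x : E) : dForm E (-x) = - dForm E x := by
  have := dForm_add x (-x)
  rw [add_neg_cancel, dForm_zero] at this
  exact (neg_eq_of_add_eq_zero_right this.symm).symm

/-- (1') -/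
lemma Ctx.L1 (n : ℕ) (v : E) (hv : v ∈ A.DD I₀) (P w : List F) (hn : P.length + w.length = n) :
    (P.map (dLog F)).prod * C.Ψ (dForm E v) * (w.map (dLog F)).prod ∈ NN R n := by
  let M : AddSubgroup E :=
    { carrier := {v | (P.map (dLog F)).prod * C.Ψ (dForm E v) * (w.map (dLog F)).prod ∈ NN R n}
      zero_mem' := by simp [dForm_zero, zero_mem]
      add_mem' := by
        intro a b ha hb
        simp only [Set.mem_setOf_eq] at *
        rw [dForm_add, map_add, mul_add, add_mul]; exact add_mem ha hb
      neg_mem' := by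
        intro a ha
        simp only [Set.mem_setOf_eq] at *
        rw [dForm_neg', map_neg, mul_neg, neg_mul]; exact neg_mem ha }
  refine C.DD_ind M ?_ v hv
  intro κ hκ g hg
  change _ ∈ NN R n
  rw [dForm_const hκ, C.hΨ, C.Ψ_dForm hg, smul_smul, ← map_mul, mul_smul_comm, smul_mul_assoc]
  exact C.G R n κ hκ g hg.1 P w hn

/-- (3') -/
lemma Ctx.L3 (n : ℕ) (b : E) (hb : b ∈ A.DD I₀) (y : F) (hy : y ≠ 0) (P w : List F)
    (hn : P.length + w.length = n) :
    (P.map (dLog F)).prod * (C.φ b • C.Ψ (dForm E (algebraMap F E y)) -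
      C.φ (b * algebraMap F E y) • dLog F y) * (w.map (dLog F)).prod ∈ NN R n := by
  let M : AddSubgroup E :=
    { carrier := {b | (P.map (dLog F)).prod * (C.φ b • C.Ψ (dForm E (algebraMap F E y)) -
      C.φ (b * algebraMap F E y) • dLog F y) * (w.map (dLog F)).prod ∈ NN R n}
      zero_mem' := by simp [zero_mem]
      add_mem' := by
        intro a b ha hb
        simp only [Set.mem_setOf_eq] at *
        have := add_mem ha hb
        rw [← add_mul, ← mul_add] at this
        convert this using 3
        rw [add_mul, map_add, map_add, add_smul, add_smul]; abel
      neg_mem' := by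
        intro a ha
        simp only [Set.mem_setOf_eq] at *
        have := neg_mem ha
        rw [← neg_mul, ← mul_neg] at this
        convert this using 3
        rw [neg_mul, map_neg, map_neg, neg_smul, neg_smul]; abel }
  refine C.DD_ind M ?_ b hb
  intro κ hκ g hg
  change _ ∈ NN R n
  set y' := algebraMap F E y with hy'
  set g' := algebraMap F E g with hg'
  have h1 := C.G R n κ hκ (g * y) (mul_ne_zero hg.1 hy) P w hn
  rw [dLog_mul _ _ hg.1 hy, map_mul (algebraMap F E), ← hg', ← hy', ← smul_mul_assoc, ← mul_smul_comm] at h1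
  have hmem : κ * (g' * y') ∈ A.DD I₀ := by
    refine A.DD_mul I₀ ?_ (A.DD_mul I₀ (C.hD g) (C.hD y))
    intro j hj
    have h0 : KaehlerDifferential.D ℤ E κ = 0 := (ExteriorAlgebra.ι_eq_zero_iff _).1 hκ
    rw [A.θ_apply, h0]; simp
  have h2 := C.L1 R n (κ * (g' * y')) hmem P w hn
  have h3 := sub_mem h2 h1
  rw [← sub_mul, ← mul_sub] at h3
  convert h3 using 3
  rw [dForm_const hκ, dForm_mul, C.hΨ, map_add, C.hΨ, C.hΨ, C.Ψ_dForm hg, ← hg']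
  simp only [map_mul, smul_add, smul_smul]
  rw [show C.φ κ * (C.φ y' * C.φ g') = C.φ κ * (C.φ g' * C.φ y') by ring, 
    show C.φ κ * C.φ g' * C.φ y' = C.φ κ * (C.φ g' * C.φ y') by ring]
  abel

lemma Ctx.Ψ_BB (σ : Finset I) (hσ : ∀ i ∈ σ, i ∈ I₀) :
    ∃ l : List F, l.length = σ.card ∧ C.Ψ (A.BB σ) = (l.map (dLog F)).prod := by
  refine ⟨List.ofFn fun i => C.f (σ.orderEmbOfFin rfl i), by simp, ?_⟩
  rw [A.BB_eq, Frame.lst, List.map_ofFn, map_list_prod, List.map_ofFn, List.map_ofFn]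
  congr 2
  funext i
  simp only [Function.comp_apply]
  rw [← A.e_eq, C.hΨe _ (hσ _ (Finset.orderEmbOfFin_mem _ _ _))]

lemma Ctx.L4 (n k : ℕ) (x : DF E) (hx : x ∈ A.AA I₀ k) (y : F) (hy : y ≠ 0) (w : List F)
    (hn : k + w.length = n) :
    C.Ψ x * (C.Ψ (dLog E (algebraMap F E y)) - dLog F y) * (w.map (dLog F)).prod ∈ NN R n := by
  refine A.AA_ind I₀ k ((NN R n).comap ((AddMonoidHom.mulRight
    ((C.Ψ (dLog E (algebraMap F E y)) - dLog F y) * (w.map (dLog F)).prod)).comp C.Ψ.toAddMonoidHom)) ?_ x hx |>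
    fun h => (by rw [mul_assoc]; exact h)
  intro σ h1 h2 a ha
  change C.Ψ (a • A.BB σ) * ((C.Ψ (dLog E (algebraMap F E y)) - dLog F y) * (w.map (dLog F)).prod) ∈ NN R n
  obtain ⟨l, hl, hlΨ⟩ := C.Ψ_BB σ h1
  rw [C.hΨ, hlΨ, ← mul_assoc]
  have hy' : algebraMap F E y ≠ 0 := by simpa using hy
  have := C.L3 R n (a * (algebraMap F E y)⁻¹) (A.DD_mul I₀ ha (A.DD_inv I₀ (C.hD y))) y hy l w (by omega)
  rw [mul_assoc a, inv_mul_cancel₀ hy', mul_one, map_mul, mul_smul, ← C.hΨ, ← dLog_eq, ← smul_sub,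
    mul_smul_comm] at this
  rwa [smul_mul_assoc]

lemma Ctx.L5 (n : ℕ) (a : E) (ha : a ∈ A.DD I₀) (ys : List F) : ∀ (zs : List F) (hys : ∀ y ∈ ys, y ≠ 0)
    (hn : ys.length + zs.length = n + 1),
    C.Ψ (a • ((ys.map (algebraMap F E)).map (dLog E)).prod) * (zs.map (dLog F)).prod -
      C.φ a • ((ys.map (dLog F)).prod * (zs.map (dLog F)).prod) ∈ NN R n := by
  induction ys using List.reverseRecOn with
  | nil =>
    intro zs _ _
    simp [C.hΨ, zero_mem]
  | append_singleton ys y ih =>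
    intro zs hys hn
    have hy : y ≠ 0 := hys y (by simp)
    have hlen : ys.length + (zs.length + 1) = n + 1 := by simp at hn; omega
    have h1 := ih (y :: zs) (fun z hz => hys z (by simp [hz])) (by simpa using hlen)
    have hAA := A.AA_smul I₀ ha (A.AA_list I₀ (p := p) (ys.map (algebraMap F E)) (by
      intro y hy
      obtain ⟨f, -, rfl⟩ := List.mem_map.1 hy
      exact C.hD f))
    have h2 := C.L4 R n _ _ hAA y hy zs (by rw [List.length_map]; omega)
    have h3 := add_mem h1 h2
    convert h3 using 1
    simp only [List.map_append, List.prod_append, List.map_cons, List.map_nil, List.prod_singleton,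
      List.prod_cons, List.prod_nil, map_one, one_mul, C.hΨ, map_mul, smul_mul_assoc, mul_sub, sub_mul, smul_sub, mul_assoc]
    abel

lemma Ctx.L6 (n : ℕ) (ω : DF F) (hω : ω ∈ omegaPow F (n + 1)) : C.Ψ (R.res ω) - ω ∈ NN R n := by
  refine omegaPow_ind (n + 1) ((NN R n).comap ((C.Ψ.toAddMonoidHom.comp R.res) - AddMonoidHom.id _)) ?_ ω hω
  intro a l hl hl0
  change C.Ψ (R.res _) - _ ∈ NN R n
  rw [R.res_smul, res_logList]
  have h1 := C.L5 R n (algebraMap F E a) (C.hD a) l [] hl0 (by simpa using hl)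
  simp only [List.map_nil, List.prod_nil, mul_one] at h1
  have h2 := hRel_le_NN R n (pow_pow_sub_mem SF a l (n + 1) hl C.e)
  rw [← C.φ_alg] at h2
  have := add_mem h1 h2
  simpa using this

lemma Ctx.L7 (n : ℕ) (x : DF E) (hx : x ∈ A.CC I₀ SE (n + 1)) : C.Ψ x ∈ NN R n := by
  have : A.CC I₀ SE (n + 1) ≤ (NN R n).comap C.Ψ.toAddMonoidHom := by
    rw [Frame.CC, AddSubgroup.closure_le]
    rintro x (⟨a, ha, σ, h1, h2, rfl⟩ | ⟨u, hu, τ, h1, h2, rfl⟩)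
    · change C.Ψ _ ∈ NN R n
      obtain ⟨l, hl, hlΨ⟩ := C.Ψ_BB σ h1
      rw [C.hΨ, hlΨ, map_sub, map_pow, sub_smul]
      exact hRel_le_NN R n (pow_sub_mem SF _ l _ (by omega))
    · change C.Ψ _ ∈ NN R n
      obtain ⟨l, hl, hlΨ⟩ := C.Ψ_BB τ h1
      rw [A.d_smul_BB, map_mul, hlΨ]
      have := C.L1 R n u hu [] l (by simp; omega)
      simpa using this
  exact this hx

lemma Ctx.forward (C : Ctx p F A I₀) [WellFoundedLT I] (hI : ∀ i ∈ I₀, ∀ j ∉ I₀, i < j) (n : ℕ) (ω : DF F)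
    (hω : ω ∈ omegaPow F (n + 1)) (h : R.res ω ∈ hRel SE (n + 1)) : ω ∈ NN R n := by
  obtain ⟨v, hv, z, hz, he⟩ := (hRel_iff SE _ _).1 h
  obtain ⟨η, -, hη⟩ := A.sp_Fr SE _ v hv
  have hk := A.key I₀ SE hI (n + 1) (R.res ω) v (z + η) (res_AA R A I₀ C.hD _ ω hω) (by
    rw [he, map_add, ← hη]; abel)
  have := sub_mem (C.L7 R n _ hk) (C.L6 R n ω hω)
  simpa using this

end ctx
end KW
end

namespace KW
set_option linter.all false
universe u
open Module

section back
variable {p : ℕ} {F : Type*} {E : Type u} [Field F] [Field E] [Algebra F E]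
    {SF : DiffStr p F} {SE : DiffStr p E} (R : DiffRes p F E SF SE)

lemma res_pred (m : ℕ) (z : DF F) (hz : z ∈ omegaPred F m) : R.res z ∈ omegaPred E m := by
  cases m with
  | zero =>
    have : z = 0 := hz
    rw [this, map_zero]; exact zero_mem _
  | succ m => exact R.res_grade m z hz

lemma res_sp (m : ℕ) (v : DF F) (hv : v ∈ omegaPow F m) :
    ∃ y ∈ omegaPred E m, R.res (SF.sp v) - SE.sp (R.res v) = SE.d y := by
  have := omegaPow_ind m (((omegaPred E m).toAddSubgroup.map SE.d).comap
    (R.res.comp SF.sp - SE.sp.comp R.res)) ?_ v hv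
  · obtain ⟨y, h1, h2⟩ := this
    exact ⟨y, h1, h2.symm⟩
  intro a l hl _
  subst hl
  obtain ⟨y1, h1, e1⟩ := sp_logList SF a l
  obtain ⟨y2, h2, e2⟩ := sp_logList SE (algebraMap F E a) (l.map (algebraMap F E))
  rw [List.length_map] at h2
  refine ⟨R.res y1 - y2, sub_mem (res_pred R _ _ h1) h2, ?_⟩
  change SE.d _ = R.res (SF.sp _) - SE.sp (R.res _)
  rw [e1, R.res_smul, res_logList, e2, map_add, R.res_smul, res_logList, R.res_d, map_pow, map_sub]
  abel

variable [Fact p.Prime] [CharP F p] [CharP E p]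

lemma backward {I : Type*} [LinearOrder I] (A : Frame E I) (n : ℕ) (ω : DF F) (h : ω ∈ NN R n) :
    R.res ω ∈ hRel SE (n + 1) := by
  have : NN R n ≤ (hRel SE (n + 1)).comap R.res := by
    rw [NN, AddSubgroup.closure_le]
    rintro x (hx | ⟨u, η, hu, hru, hη, rfl⟩)
    · change R.res x ∈ hRel SE (n + 1)
      obtain ⟨v, hv, z, hz, rfl⟩ := (hRel_iff SF _ _).1 hx
      obtain ⟨y, hy, e⟩ := res_sp R _ v hv
      refine (hRel_iff SE _ _).2 ⟨R.res v, R.res_grade _ _ hv, y + R.res z, add_mem hy (res_pred R _ _ hz), ?_⟩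
      rw [map_add, map_sub, R.res_d, map_add, ← e]; abel
    · change R.res (u * η) ∈ hRel SE (n + 1)
      obtain ⟨v, hv, z, hz, e1⟩ := (hRel_iff SE _ _).1 hru
      obtain ⟨hη1, z1, hz1, e2⟩ := hη
      obtain ⟨y, hy, e3⟩ := res_sp R _ η hη1
      set η' := R.res η with hη'
      have hη'g : η' ∈ omegaPow E n := R.res_grade _ _ hη1
      obtain ⟨y1, hy1, e4⟩ := A.sp_Fr SE 1 v hv
      have hvη : v * η' ∈ omegaPow E (n + 1) := by
        rw [add_comm]; exact omegaPow_mul hv hη'g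
      obtain ⟨y2, hy2, e5⟩ := A.sp_Fr SE (n + 1) (v * η') hvη
      obtain ⟨y3, hy3, e6⟩ := A.sp_Fr SE n η' hη'g
      have e7 : A.Fr p η' = η' + SE.d (R.res z1 - y - y3) := by
        rw [map_sub, map_sub, ← e3, ← e6, ← R.res_d, ← e2, map_sub]; abel
      have hy4 : R.res z1 - y - y3 ∈ omegaPred E n := sub_mem (sub_mem (res_pred R _ _ hz1) hy) hy3
      set y4 := R.res z1 - y - y3
      have hdη : SE.d η' = 0 := by
        have := A.d_Fr SE η'
        rw [e7, map_add, SE.d_d, add_zero] at this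
        exact this
      have hFv : A.Fr p v ∈ omegaPow E 1 := by
        have : A.Fr p v = SE.sp v - SE.d y1 := by rw [← e4]; abel
        rw [this]
        exact sub_mem (SE.sp_grade 1 v hv) (SE.d_grade 0 y1 hy1)
      have l0 : ∀ y ∈ omegaPow E 0, SE.d (y * η') = SE.d y * η' := by
        intro y hy
        rw [leibniz SE 0 y hy, hdη]; simp
      have l1 : SE.d (A.Fr p v * y4) = - (A.Fr p v * SE.d y4) := by
        rw [leibniz1 SE _ hFv, A.d_Fr]; simp
      have g0 : ∀ y ∈ omegaPow E 0, y * η' ∈ omegaPow E n := by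
        intro y hy
        have := omegaPow_mul hy hη'g
        rwa [zero_add] at this
      have g1 : A.Fr p v * y4 ∈ omegaPow E n := by
        clear_value y4
        cases n with
        | zero =>
          have : y4 = 0 := hy4
          rw [this, mul_zero]; exact zero_mem _
        | succ k =>
          have := omegaPow_mul hFv (show y4 ∈ omegaPow E k from hy4)
          rwa [add_comm] at this
      refine (hRel_iff SE _ _).2 ⟨v * η', hvη, -y2 + A.Fr p v * y4 + y1 * η' + z * η', ?_, ?_⟩
      · change _ ∈ omegaPow E n
        exact add_mem (add_mem (add_mem (neg_mem hy2) g1) (g0 y1 hy1)) (g0 z hz)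
      · rw [R.res_mul, e1, map_add, map_add, map_add, map_neg, l1, l0 y1 hy1, l0 z hz, ← e5, ← e4, map_mul (A.Fr p), e7, ← hη']
        noncomm_ring
  exact this h

end back

lemma exists_phi (p : ℕ) [Fact p.Prime] (F E : Type*) [Field F] [Field E] [Algebra F E]
    [CharP F p] [CharP E p] (r : ℕ) (b : Fin r → F) (m : Fin r → ℕ)
    (β : Fin r → E) (hβ : ∀ i, β i ^ p ^ m i = algebraMap F E (b i))
    (hgen : Algebra.adjoin F (Set.range β) = ⊤) :
    ∃ (e : ℕ) (φ : E →+* F), ∀ a, algebraMap F E (φ a) = a ^ p ^ e := by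
  set e := ∑ i, m i with he
  have h1 : ∀ a : E, ∃ x : F, algebraMap F E x = a ^ p ^ e := by
    intro a
    have ha : a ∈ Algebra.adjoin F (Set.range β) := by rw [hgen]; trivial
    induction ha using Algebra.adjoin_induction with
    | mem x hx =>
      obtain ⟨i, rfl⟩ := hx
      obtain ⟨k, hk⟩ : ∃ k, e = m i + k :=
        Nat.exists_eq_add_of_le (Finset.single_le_sum (fun _ _ => Nat.zero_le _) (Finset.mem_univ i))
      exact ⟨b i ^ p ^ k, by rw [map_pow, ← hβ, ← pow_mul, ← pow_add, ← hk]⟩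
    | algebraMap f => exact ⟨f ^ p ^ e, by rw [map_pow]⟩
    | add x y _ _ hx hy =>
      obtain ⟨x', hx⟩ := hx
      obtain ⟨y', hy⟩ := hy
      exact ⟨x' + y', by rw [map_add, hx, hy, add_pow_char_pow]⟩
    | mul x y _ _ hx hy =>
      obtain ⟨x', hx⟩ := hx
      obtain ⟨y', hy⟩ := hy
      exact ⟨x' * y', by rw [map_mul, hx, hy, mul_pow]⟩
  choose φ hφ using h1
  have hinj := (algebraMap F E).injective
  have hp : p ^ e ≠ 0 := pow_ne_zero _ (Fact.out : p.Prime).ne_zero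
  have q1 : φ 1 = 1 := hinj (by rw [hφ]; simp)
  have q2 : ∀ x y, φ (x * y) = φ x * φ y := fun x y => hinj (by rw [map_mul, hφ, hφ, hφ, mul_pow])
  have q3 : φ 0 = 0 := hinj (by rw [hφ, map_zero, zero_pow hp])
  have q4 : ∀ x y, φ (x + y) = φ x + φ y :=
    fun x y => hinj (by rw [map_add, hφ, hφ, hφ, add_pow_char_pow])
  exact ⟨e, RingHom.mk (MonoidHom.mk (OneHom.mk φ q1) q2) q3 q4, hφ⟩

end KW

theorem hKernel_eq_hKernel_two_wedge_nu
    (p : ℕ) (hp : p.Prime) (F E : Type*) [Field F] [Field E] [Algebra F E]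
    [CharP F p] [CharP E p]
    (SF : DiffStr p F) (SE : DiffStr p E) (R : DiffRes p F E SF SE)
    (r : ℕ) (b : Fin r → F) (m : Fin r → ℕ)
    (hb : ∀ i, ¬ ∃ y : F, y ^ p = b i) (hm : ∀ i, 1 ≤ m i)
    (β : Fin r → E) (hβ : ∀ i, β i ^ p ^ m i = algebraMap F E (b i))
    (hgen : Algebra.adjoin F (Set.range β) = ⊤)
    (n : ℕ) (ω : DF F) (hω : ω ∈ omegaPow F (n + 1)) :
    R.res ω ∈ hRel SE (n + 1) ↔
      ω ∈ AddSubgroup.closure ((hRel SF (n + 1) : Set (DF F)) ∪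
        { x | ∃ u η : DF F, u ∈ omegaPow F 1 ∧ R.res u ∈ hRel SE 1 ∧
            η ∈ nuSet SF n ∧ x = u * η }) := by
  haveI : Fact p.Prime := ⟨hp⟩
  classical
  obtain ⟨I, _, _, A, I₀, hI, hf, hD⟩ := KW.exists_frame (F := F) (E := E)
  obtain ⟨e, φ, hφ⟩ := KW.exists_phi p F E r b m β hβ hgen
  have hf' : ∀ i, ∃ f : F, i ∈ I₀ → A.t i = algebraMap F E f := by
    intro i
    by_cases h : i ∈ I₀
    · obtain ⟨f, h⟩ := hf i h
      exact ⟨f, fun _ => h⟩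
    · exact ⟨0, fun h' => absurd h' h⟩
  choose f hf using hf'
  obtain ⟨Ψ, hΨ, hΨe⟩ := KW.exists_semi φ A.b (fun i => (f i)⁻¹ • KaehlerDifferential.D ℤ F (f i))
  let C : KW.Ctx p F A I₀ :=
    { φ := φ, e := e, hφ := hφ, Ψ := Ψ, hΨ := hΨ, f := f, hf := hf, hΨe := fun i _ => hΨe i,
      hD := fun f j hj => hD f j hj }
  constructor
  · intro h
    exact KW.Ctx.forward R C hI n ω hω h
  · intro h
    exact KW.backward R A n ω h
end
end

section
/- Let F be a field of characteristic p > 0 and E = F(b_1^{1/p^{m_1}},…,b_r^{1/p^{m_r}}) a purely inseparable extension of F with p-independent elements b_1,…,b_r ∈ F and integers m_1,…,m_r ≥ 1. Then Ω^n(E/F) = Σ_{i=1}^r db_i ∧ Ω_F^{n-1}. In particular, ν_n(E/F) = { ω_1 ∧ (db_1/b_1) + … + ω_r ∧ (db_r/b_r) ∈ ν_n(F) : ω_1,…,ω_r ∈ Ω_F^{n-1} }. -/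
noncomputable section

/-- `p`-independence of `b₁,…,b_r ∈ F`: `[F^p(b₁,…,b_r) : F^p] = p^r`, expressed as the
linear independence over `F^p` of the `p^r` monomials `∏ bᵢ^{eᵢ}`, `0 ≤ eᵢ < p`. -/
def PIndep (p : ℕ) {F : Type*} [Field F] {r : ℕ} (b : Fin r → F) : Prop :=
  ∀ c : (Fin r → Fin p) → F,
    (∑ e : Fin r → Fin p, c e ^ p * ∏ i, b i ^ (e i : ℕ)) = 0 → ∀ e, c e = 0

open scoped TensorProduct

/-- The monomials in `p`-independent elements with exponents `< p^M` are linearly independent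
over `F^{p^M}`. -/
theorem pIndep_iter (p : ℕ) (hp : p.Prime) {F : Type*} [Field F] [CharP F p] {r : ℕ}
    (b : Fin r → F) (hb : PIndep p b) {κ : Type*} (M : ℕ) :
    ∀ (K : Finset κ) (f : κ → Fin r → ℕ) (_ : Set.InjOn f K)
      (_ : ∀ k ∈ K, ∀ i, f k i < p ^ M) (c : κ → F)
      (_ : ∑ k ∈ K, c k ^ p ^ M * ∏ i, b i ^ f k i = 0), ∀ k ∈ K, c k = 0 := by
  classical
  have : Fact p.Prime := ⟨hp⟩
  induction M with
  | zero =>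
    intro K f hinj hlt c hsum k hk
    have hf : ∀ k ∈ K, f k = 0 := fun k hk => by
      funext i
      have := hlt k hk i
      simp at this
      simpa using this
    have hK : K = {k} := by
      ext l
      simp only [Finset.mem_singleton]
      constructor
      · intro hl
        exact hinj hl hk ((hf l hl).trans (hf k hk).symm)
      · rintro rfl
        exact hk
    rw [hK] at hsum
    simpa [hf k hk] using hsum
  | succ M ih =>
    intro K f hinj hlt c hsum k hk
    let red : κ → Fin r → Fin p := fun k i => ⟨f k i % p, Nat.mod_lt _ hp.pos⟩
    have key : ∑ e : Fin r → Fin p,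
        (∑ k ∈ K with red k = e, c k ^ p ^ M * ∏ i, b i ^ (f k i / p)) ^ p
          * ∏ i, b i ^ (e i : ℕ) = 0 := by
      rw [← hsum, ← Finset.sum_fiberwise K red]
      refine Finset.sum_congr rfl fun e _ => ?_
      rw [sum_pow_char, Finset.sum_mul]
      refine Finset.sum_congr rfl fun l hl => ?_
      obtain ⟨-, rfl⟩ := Finset.mem_filter.1 hl
      rw [mul_pow, ← pow_mul, ← pow_succ, ← Finset.prod_pow, mul_assoc, ← Finset.prod_mul_distrib]
      congr 1
      refine Finset.prod_congr rfl fun i _ => ?_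
      rw [← pow_mul, ← pow_add]
      congr 1
      exact Nat.div_add_mod' _ _
    have h0 := hb _ key (red k)
    refine ih (K.filter fun l => red l = red k) (fun l i => f l i / p) ?_ ?_ c h0 k
      (by simp [hk])
    · intro x hx y hy hxy
      simp only [Finset.coe_filter, Set.mem_ofPred_eq] at hx hy
      refine hinj hx.1 hy.1 ?_
      funext i
      have h1 : f x i / p = f y i / p := congrFun hxy i
      have h2 : red x i = red y i := by rw [hx.2, hy.2]
      have h3 : f x i % p = f y i % p := congrArg Fin.val h2
      rw [← Nat.div_add_mod (f x i) p, h1, h3, Nat.div_add_mod]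
    · intro l hl i
      have := hlt l (Finset.mem_filter.1 hl).1 i
      exact Nat.div_lt_of_lt_mul (by rwa [pow_succ'] at this)

/-- The monomials in the roots `β` with small exponents are linearly independent over `F`. -/
theorem roots_indep (p : ℕ) (hp : p.Prime) {F E : Type*} [Field F] [Field E] [Algebra F E]
    [CharP F p] [CharP E p] {r : ℕ} (b : Fin r → F) (m : Fin r → ℕ) (hb : PIndep p b)
    (β : Fin r → E) (hβ : ∀ i, β i ^ p ^ m i = algebraMap F E (b i))
    (c : (∀ i, Fin (p ^ m i)) → F)
    (hc : ∑ k, algebraMap F E (c k) * ∏ i, β i ^ (k i : ℕ) = 0) : c = 0 := by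
  classical
  have : Fact p.Prime := ⟨hp⟩
  let M := ∑ i, m i
  have hM : ∀ i, m i ≤ M := fun i => Finset.single_le_sum (f := m) (fun _ _ => Nat.zero_le _)
    (Finset.mem_univ i)
  have h1 : ∑ k : (∀ i, Fin (p ^ m i)), c k ^ p ^ M * ∏ i, b i ^ ((k i : ℕ) * p ^ (M - m i)) = 0 := by
    apply (algebraMap F E).injective
    rw [map_zero]
    have h2 := congrArg (· ^ p ^ M) hc
    beta_reduce at h2
    rw [zero_pow (pow_pos hp.pos _).ne', sum_pow_char_pow] at h2
    rw [← h2, map_sum]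
    refine Finset.sum_congr rfl fun k _ => ?_
    rw [map_mul, map_pow, map_prod, mul_pow, ← Finset.prod_pow]
    congr 1
    refine Finset.prod_congr rfl fun i _ => ?_
    rw [map_pow, ← hβ, ← pow_mul, ← pow_mul]
    congr 1
    rw [mul_left_comm, ← pow_add, Nat.add_sub_cancel' (hM i)]
  funext k
  refine pIndep_iter p hp b hb M Finset.univ _ ?_ ?_ c h1 k (Finset.mem_univ _)
  · intro x _ y _ hxy
    funext i
    have := congrFun hxy i
    exact Fin.ext (Nat.eq_of_mul_eq_mul_right (pow_pos hp.pos _) this)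
  · intro k _ i
    calc (k i : ℕ) * p ^ (M - m i) < p ^ m i * p ^ (M - m i) :=
          Nat.mul_lt_mul_of_pos_right (k i).2 (pow_pos hp.pos _)
      _ = p ^ M := by rw [← pow_add, Nat.add_sub_cancel' (hM i)]

/-- Ring homomorphisms `F → T` extend to `E` once the `b i` get compatible roots in `T`. -/
theorem exists_extension (p : ℕ) (hp : p.Prime) {F E T : Type*} [Field F] [Field E] [Algebra F E]
    [CharP F p] [CharP E p] [CommRing T] {r : ℕ} (b : Fin r → F) (m : Fin r → ℕ) (hb : PIndep p b)
    (β : Fin r → E) (hβ : ∀ i, β i ^ p ^ m i = algebraMap F E (b i))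
    (hgen : Algebra.adjoin F (Set.range β) = ⊤)
    (φ : F →+* T) (t : Fin r → T) (ht : ∀ i, t i ^ p ^ m i = φ (b i))
    (π : T →+* E) (hπφ : ∀ a, π (φ a) = algebraMap F E a) (hπt : ∀ i, π (t i) = β i) :
    ∃ δ : E →+* T, (∀ a, δ (algebraMap F E a) = φ a) ∧ ∀ x, π (δ x) = x := by
  classical
  let Φ : MvPolynomial (Fin r) F →+* T := MvPolynomial.eval₂Hom φ t
  let ev : MvPolynomial (Fin r) F →+* E := (MvPolynomial.aeval β : _ →ₐ[F] E).toRingHom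
  have hev : π.comp Φ = ev := by
    apply MvPolynomial.ringHom_ext
    · intro a
      simp [Φ, ev, hπφ]
    · intro i
      simp [Φ, ev, hπt]
  have hsurj : Function.Surjective ev := by
    have : (MvPolynomial.aeval β : MvPolynomial (Fin r) F →ₐ[F] E).range = ⊤ := by
      rw [← Algebra.adjoin_range_eq_range_aeval, hgen]
    exact (AlgHom.range_eq_top _).1 this
  have hred : ∀ P, ∃ c : (∀ i, Fin (p ^ m i)) → F,
      Φ P = ∑ k, φ (c k) * ∏ i, t i ^ (k i : ℕ) := by
    intro P
    induction P using MvPolynomial.induction_on' with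
    | monomial u a =>
      let k0 : ∀ i, Fin (p ^ m i) := fun i => ⟨u i % p ^ m i, Nat.mod_lt _ (pow_pos hp.pos _)⟩
      refine ⟨Pi.single k0 (a * ∏ i, b i ^ (u i / p ^ m i)), ?_⟩
      rw [Finset.sum_eq_single k0]
      · rw [Pi.single_eq_same, map_mul, map_prod, mul_assoc, ← Finset.prod_mul_distrib]
        simp only [Φ, MvPolynomial.coe_eval₂Hom, MvPolynomial.eval₂_monomial]
        rw [Finsupp.prod_fintype _ _ (by simp)]
        congr 1
        refine Finset.prod_congr rfl fun i _ => ?_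
        rw [map_pow, ← ht, ← pow_mul, ← pow_add]
        congr 1
        exact (Nat.div_add_mod _ _).symm
      · intro k _ hk
        rw [Pi.single_eq_of_ne hk, map_zero, zero_mul]
      · simp
    | add P Q hP hQ =>
      obtain ⟨c, hc⟩ := hP
      obtain ⟨c', hc'⟩ := hQ
      refine ⟨c + c', ?_⟩
      rw [map_add, hc, hc', ← Finset.sum_add_distrib]
      simp [add_mul]
  have hker : ∀ P, ev P = 0 → Φ P = 0 := by
    intro P hP
    obtain ⟨c, hc⟩ := hred P
    have h0 : c = 0 := by
      apply roots_indep p hp b m hb β hβ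
      rw [← hev, RingHom.comp_apply, hc] at hP
      simpa [hπφ, hπt] using hP
    rw [hc, h0]
    simp
  let δ : E →+* T := RingHom.liftOfSurjective ev hsurj ⟨Φ, fun P hP => hker P hP⟩
  have hδ : ∀ P, δ (ev P) = Φ P := fun P =>
    RingHom.liftOfRightInverse_comp_apply ev _ (Function.rightInverse_surjInv hsurj) ⟨Φ, fun P hP => hker P hP⟩ P
  refine ⟨δ, fun a => ?_, fun x => ?_⟩
  · have := hδ (MvPolynomial.C a)
    simpa [ev, Φ] using this
  · obtain ⟨P, rfl⟩ := hsurj x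
    rw [hδ, ← hev]
    rfl

/-- Extension of derivations killing the `b i`. -/
theorem exists_derivation (p : ℕ) (hp : p.Prime) {F E V : Type*} [Field F] [Field E] [Algebra F E]
    [CharP F p] [CharP E p] [AddCommGroup V] [Module F V] {r : ℕ} (b : Fin r → F) (m : Fin r → ℕ)
    (hb : PIndep p b)
    (β : Fin r → E) (hβ : ∀ i, β i ^ p ^ m i = algebraMap F E (b i))
    (hgen : Algebra.adjoin F (Set.range β) = ⊤) (hm : ∀ i, 1 ≤ m i)
    (D : Derivation ℤ F V) (hD : ∀ i, D (b i) = 0) :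
    ∃ δ : Derivation ℤ E (E ⊗[F] V), ∀ a, δ (algebraMap F E a) = 1 ⊗ₜ D a := by
  let φ : F →+* TrivSqZeroExt E (E ⊗[F] V) :=
    { toFun := fun a => TrivSqZeroExt.inl (algebraMap F E a) + TrivSqZeroExt.inr (1 ⊗ₜ D a)
      map_one' := by ext <;> simp
      map_zero' := by ext <;> simp
      map_add' := fun x y => by ext <;> simp [TensorProduct.tmul_add]
      map_mul' := fun x y => by
        ext
        · simp
        · simp [TensorProduct.tmul_add, TensorProduct.tmul_smul, algebraMap_smul] }
  obtain ⟨δ, h1, h2⟩ := exists_extension p hp b m hb β hβ hgen φ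
    (fun i => TrivSqZeroExt.inl (β i)) (fun i => by
      refine (TrivSqZeroExt.inl_pow (β i) (p ^ m i)).trans ?_
      rw [hβ]
      ext <;> simp [φ, hD])
    (TrivSqZeroExt.fstHom E E (E ⊗[F] V)).toRingHom (fun a => by simp [φ]) (fun i => by simp)
  have h3 : ∀ x, (δ x).fst = x := h2
  refine ⟨Derivation.mk' (AddMonoidHom.toIntLinearMap
    { toFun := fun x => (δ x).snd
      map_zero' := by simp
      map_add' := by simp }) ?_, ?_⟩
  · intro x y
    simp [h3]
  · intro a
    show (δ (algebraMap F E a)).snd = _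
    rw [h1]
    simp [φ]

/-- A degree-preserving retraction argument. -/
theorem sub_map_mem {F : Type*} [Field F] {r : ℕ} (b : Fin r → F)
    (e : KaehlerDifferential ℤ F →ₗ[F] KaehlerDifferential ℤ F)
    (he : ∀ v, ∃ a : Fin r → F, v - e v = ∑ i, a i • KaehlerDifferential.D ℤ F (b i))
    (n : ℕ) (ω : DF F) (hω : ω ∈ omegaPow F n) :
    ∃ η : Fin r → DF F, (∀ i, η i ∈ omegaPred F n) ∧
        ω - ExteriorAlgebra.map e ω = ∑ i, dForm F (b i) * η i := by
  unfold omegaPow at hω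
  induction hω using Submodule.pow_induction_on_left' with
  | algebraMap a => exact ⟨0, fun i => by simp, by simp⟩
  | add x y i hx hy h1 h2 =>
    obtain ⟨η, hη, h⟩ := h1
    obtain ⟨η', hη', h'⟩ := h2
    refine ⟨η + η', fun i => add_mem (hη i) (hη' i), ?_⟩
    simp only [Pi.add_apply, mul_add, Finset.sum_add_distrib, ← h, ← h', map_add]
    abel
  | mem_mul w hw k x hx h1 =>
    obtain ⟨v, rfl⟩ := hw
    obtain ⟨η, hη, h⟩ := h1
    obtain ⟨a, ha⟩ := he v
    refine ⟨fun i => a i • x - ExteriorAlgebra.ι F (e v) * η i, fun i => ?_, ?_⟩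
    · refine sub_mem (Submodule.smul_mem _ _ hx) ?_
      cases k with
      | zero =>
        have : η i = 0 := by simpa [omegaPred] using hη i
        simp [this]
      | succ k =>
        show _ ∈ _ ^ (k + 1)
        rw [pow_succ']
        exact Submodule.mul_mem_mul ⟨_, rfl⟩ (hη i)
    · have hs : ExteriorAlgebra.ι F v - ExteriorAlgebra.ι F (e v) = ∑ i, a i • dForm F (b i) := by
        rw [← map_sub, ha, map_sum]
        simp [dForm]
      have hsw : ∀ i, dForm F (b i) * (ExteriorAlgebra.ι F (e v) * η i)
          = - (ExteriorAlgebra.ι F (e v) * (dForm F (b i) * η i)) := by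
        intro i
        rw [← mul_assoc, ← mul_assoc, ← neg_mul, dForm]
        congr 1
        exact eq_neg_of_add_eq_zero_left (ExteriorAlgebra.ι_add_mul_swap _ _)
      simp only [mul_sub, hsw, Finset.sum_sub_distrib, sub_neg_eq_add, Finset.sum_add_distrib,
        Finset.sum_neg_distrib]
      rw [← Finset.mul_sum, ← h, map_mul, ExteriorAlgebra.map_apply_ι]
      have : ∑ i, dForm F (b i) * a i • x
          = (ExteriorAlgebra.ι F v - ExteriorAlgebra.ι F (e v)) * x := by
        rw [hs, Finset.sum_mul]
        simp
      rw [this]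
      noncomm_ring

/-- The comparison map out of the forms of `E`. -/
theorem exists_comparison {F E W V : Type*} [Field F] [Field E] [Algebra F E]
    [AddCommGroup V] [Module F V] [AddCommGroup W] [Module E W] (ψ : W →ₗ[E] E ⊗[F] V) :
    ∃ Ψ : ExteriorAlgebra E W →ₐ[E] E ⊗[F] ExteriorAlgebra F V,
      ∀ w, Ψ (ExteriorAlgebra.ι E w) = (ExteriorAlgebra.ι F : V →ₗ[F] _).baseChange E (ψ w) := by
  have hsw : ∀ x y : E ⊗[F] V, (ExteriorAlgebra.ι F : V →ₗ[F] _).baseChange E x *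
      (ExteriorAlgebra.ι F : V →ₗ[F] _).baseChange E y +
      (ExteriorAlgebra.ι F : V →ₗ[F] _).baseChange E y *
      (ExteriorAlgebra.ι F : V →ₗ[F] _).baseChange E x = 0 := by
    intro x y
    induction x using TensorProduct.induction_on with
    | zero => simp
    | add x x' h h' =>
      simp only [map_add, add_mul, mul_add]
      rw [add_add_add_comm, h, h', add_zero]
    | tmul a v =>
      induction y using TensorProduct.induction_on with
      | zero => simp
      | add x x' h h' =>
        simp only [map_add, add_mul, mul_add]
        rw [add_add_add_comm, h, h', add_zero]
      | tmul a' v' =>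
        simp only [LinearMap.baseChange_tmul, Algebra.TensorProduct.tmul_mul_tmul]
        rw [mul_comm a' a, ← TensorProduct.tmul_add, ExteriorAlgebra.ι_add_mul_swap,
          TensorProduct.tmul_zero]
  have hsq : ∀ x : E ⊗[F] V, (ExteriorAlgebra.ι F : V →ₗ[F] _).baseChange E x *
      (ExteriorAlgebra.ι F : V →ₗ[F] _).baseChange E x = 0 := by
    intro x
    induction x using TensorProduct.induction_on with
    | zero => simp
    | add x x' h h' =>
      have := hsw x x'
      simp only [map_add, add_mul, mul_add]
      rw [h, h', zero_add, add_zero, add_comm]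
      exact this
    | tmul a v => simp [Algebra.TensorProduct.tmul_mul_tmul]
  refine ⟨ExteriorAlgebra.lift E ⟨((ExteriorAlgebra.ι F : V →ₗ[F] _).baseChange E).comp ψ,
    fun w => hsq _⟩, fun w => ?_⟩
  simp

/-- Commuting a one-form past an `n`-form. -/
theorem mul_ι_swap {F : Type*} [Field F] (v : KaehlerDifferential ℤ F) (n : ℕ) (ω : DF F)
    (hω : ω ∈ omegaPow F n) :
    ω * ExteriorAlgebra.ι F v = (-1 : F) ^ n • (ExteriorAlgebra.ι F v * ω) := by
  unfold omegaPow at hω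
  induction hω using Submodule.pow_induction_on_left' with
  | algebraMap a => simp [Algebra.commutes]
  | add x y i hx hy h1 h2 => rw [add_mul, h1, h2, mul_add, smul_add]
  | mem_mul w hw k x hx h1 =>
    obtain ⟨u, rfl⟩ := hw
    have h : ExteriorAlgebra.ι F u * ExteriorAlgebra.ι F v
        = - (ExteriorAlgebra.ι F v * ExteriorAlgebra.ι F u) :=
      eq_neg_of_add_eq_zero_left (ExteriorAlgebra.ι_add_mul_swap _ _)
    rw [mul_assoc, h1, mul_smul_comm, ← mul_assoc, h, pow_succ]
    simp [mul_assoc]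

theorem dForm_eq {F : Type*} [Field F] (a : F) : dForm F a = a • dLog F a := by
  by_cases h : a = 0
  · simp [h, dForm, dLog]
  · simp [dForm, dLog, smul_smul, h]

theorem dLog_eq {F : Type*} [Field F] (a : F) : dLog F a = a⁻¹ • dForm F a := by
  simp [dForm, dLog]

theorem log_form_iff {F : Type*} [Field F] {r : ℕ} (b : Fin r → F) (n : ℕ) (ω : DF F) :
    (∃ η : Fin r → DF F, (∀ i, η i ∈ omegaPred F n) ∧ ω = ∑ i, dForm F (b i) * η i) ↔
    (∃ η : Fin r → DF F, (∀ i, η i ∈ omegaPred F n) ∧ ω = ∑ i, η i * dLog F (b i)) := by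
  cases n with
  | zero =>
    have h : ∀ η : Fin r → DF F, (∀ i, η i ∈ omegaPred F 0) ↔ η = 0 := by
      intro η
      simp [omegaPred, funext_iff]
    simp [h]
  | succ n =>
    have hs : (-1 : F) ^ n * (-1) ^ n = 1 := by
      rw [← mul_pow]
      simp
    constructor
    · rintro ⟨η, hη, rfl⟩
      refine ⟨fun i => ((-1 : F) ^ n * b i) • η i, fun i => Submodule.smul_mem _ _ (hη i), ?_⟩
      refine Finset.sum_congr rfl fun i _ => ?_
      rw [smul_mul_assoc, dForm_eq]
      rw [dLog, mul_ι_swap _ n _ (hη i), smul_smul, smul_mul_assoc, mul_right_comm, hs, one_mul]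
    · rintro ⟨η, hη, rfl⟩
      refine ⟨fun i => ((-1 : F) ^ n * (b i)⁻¹) • η i, fun i => Submodule.smul_mem _ _ (hη i), ?_⟩
      refine Finset.sum_congr rfl fun i _ => ?_
      rw [dLog_eq, dForm, mul_smul_comm, mul_ι_swap _ n _ (hη i), smul_smul, mul_smul_comm,
        mul_comm]

theorem res_kernel_iff
    (p : ℕ) (hp : p.Prime) (F E : Type*) [Field F] [Field E] [Algebra F E]
    [CharP F p] [CharP E p]
    (SF : DiffStr p F) (SE : DiffStr p E) (R : DiffRes p F E SF SE)
    (r : ℕ) (b : Fin r → F) (m : Fin r → ℕ)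
    (hb : PIndep p b) (hm : ∀ i, 1 ≤ m i)
    (β : Fin r → E) (hβ : ∀ i, β i ^ p ^ m i = algebraMap F E (b i))
    (hgen : Algebra.adjoin F (Set.range β) = ⊤)
    (n : ℕ) (ω : DF F) (hω : ω ∈ omegaPow F n) : R.res ω = 0 ↔
      ∃ η : Fin r → DF F, (∀ i, η i ∈ omegaPred F n) ∧
        ω = ∑ i, dForm F (b i) * η i := by
  constructor
  · intro h0
    let U : Submodule F (KaehlerDifferential ℤ F) :=
      Submodule.span F (Set.range fun i => KaehlerDifferential.D ℤ F (b i))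
    obtain ⟨g, hg⟩ := LinearMap.exists_leftInverse_of_injective U.subtype
      (LinearMap.ker_eq_bot.2 U.injective_subtype)
    let e : KaehlerDifferential ℤ F →ₗ[F] KaehlerDifferential ℤ F :=
      LinearMap.id - U.subtype.comp g
    have he : ∀ v, ∃ a : Fin r → F, v - e v = ∑ i, a i • KaehlerDifferential.D ℤ F (b i) := by
      intro v
      have : v - e v ∈ U := by
        simp [e]
      obtain ⟨a, ha⟩ := (Submodule.mem_span_range_iff_exists_fun F).1 this
      exact ⟨a, ha.symm⟩
    have heb : ∀ i, e (KaehlerDifferential.D ℤ F (b i)) = 0 := by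
      intro i
      have hU : KaehlerDifferential.D ℤ F (b i) ∈ U := Submodule.subset_span ⟨i, rfl⟩
      have := LinearMap.congr_fun hg ⟨_, hU⟩
      simp only [LinearMap.comp_apply, Submodule.subtype_apply, LinearMap.id_apply] at this
      simp [e, this]
    obtain ⟨δ, hδ⟩ := exists_derivation p hp b m hb β hβ hgen hm
      (e.compDer (KaehlerDifferential.D ℤ F)) heb
    obtain ⟨Ψ, hΨ⟩ := exists_comparison δ.liftKaehlerDifferential
    have key : ∀ x : DF F, Ψ (R.res x) = 1 ⊗ₜ ExteriorAlgebra.map e x := by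
      intro x
      induction x using ExteriorAlgebra.induction with
      | algebraMap a =>
        rw [Algebra.algebraMap_eq_smul_one, R.res_smul, R.res_one]
        rw [map_smul, map_one, map_smul, map_one, TensorProduct.tmul_smul, algebraMap_smul,
          Algebra.TensorProduct.one_def]
      | add x y hx hy => rw [map_add, map_add, hx, hy, map_add, TensorProduct.tmul_add]
      | mul x y hx hy =>
        rw [R.res_mul, map_mul, hx, hy, map_mul, Algebra.TensorProduct.tmul_mul_tmul, one_mul]
      | ι v =>
        have hv : v ∈ Submodule.span F (Set.range (KaehlerDifferential.D ℤ F)) := by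
          rw [KaehlerDifferential.span_range_derivation]
          trivial
        induction hv using Submodule.span_induction with
        | mem v hv =>
          obtain ⟨a, rfl⟩ := hv
          have h1 := R.res_dForm a
          unfold dForm at h1
          rw [h1, hΨ, Derivation.liftKaehlerDifferential_comp_D, hδ]
          simp
        | zero => simp
        | add v w _ _ hv hw =>
          rw [map_add, map_add, map_add, hv, hw, map_add, TensorProduct.tmul_add]
        | smul a v _ hv =>
          rw [map_smul, R.res_smul, map_smul, hv, map_smul, TensorProduct.tmul_smul,
            algebraMap_smul]
    have h1 := key ω
    rw [h0, map_zero] at h1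
    have h2 : ExteriorAlgebra.map e ω = 0 := by
      have hinj : Function.Injective (Algebra.TensorProduct.includeRight :
          ExteriorAlgebra F (KaehlerDifferential ℤ F) →ₐ[F] E ⊗[F] _) :=
        Algebra.TensorProduct.includeRight_injective (algebraMap F E).injective
      apply hinj
      rw [map_zero]
      exact h1.symm
    have := sub_map_mem b e he n ω hω
    rwa [h2, sub_zero] at this
  · rintro ⟨η, -, rfl⟩
    rw [map_sum]
    refine Finset.sum_eq_zero fun i _ => ?_
    have : p ∣ p ^ m i := dvd_pow_self _ (by have := hm i; omega)
    have h0 : ((p ^ m i : ℕ) : E) = 0 := (CharP.cast_eq_zero_iff E p _).2 this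
    have h1 : KaehlerDifferential.D ℤ E (algebraMap F E (b i)) = 0 := by
      rw [← hβ, Derivation.leibniz_pow, ← Nat.cast_smul_eq_nsmul E, h0, zero_smul]
    rw [R.res_mul, R.res_dForm, dForm, h1, map_zero, zero_mul]

/-- **Theorem 4.1 (41).** Let `E = F(b₁^{1/p^{m₁}},…,b_r^{1/p^{m_r}})` be purely
inseparable with `p`-independent `b₁,…,b_r ∈ F` and `mᵢ ≥ 1`. Then
`Ω^n(E/F) = Σᵢ dbᵢ ∧ Ω_F^{n-1}`, and in particular
`ν_n(E/F) = { ω₁∧(db₁/b₁) + … + ω_r∧(db_r/b_r) ∈ ν_n(F) : ωᵢ ∈ Ω_F^{n-1} }`. -/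
theorem omegaKernel_purely_inseparable
    (p : ℕ) (hp : p.Prime) (F E : Type*) [Field F] [Field E] [Algebra F E]
    [CharP F p] [CharP E p]
    (SF : DiffStr p F) (SE : DiffStr p E) (R : DiffRes p F E SF SE)
    (r : ℕ) (b : Fin r → F) (m : Fin r → ℕ)
    (hb : PIndep p b) (hm : ∀ i, 1 ≤ m i)
    (β : Fin r → E) (hβ : ∀ i, β i ^ p ^ m i = algebraMap F E (b i))
    (hgen : Algebra.adjoin F (Set.range β) = ⊤)
    (n : ℕ) :
    (∀ ω ∈ omegaPow F n, (R.res ω = 0 ↔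
      ∃ η : Fin r → DF F, (∀ i, η i ∈ omegaPred F n) ∧
        ω = ∑ i, dForm F (b i) * η i)) ∧
    (∀ ω ∈ omegaPow F n, ((ω ∈ nuSet SF n ∧ R.res ω = 0) ↔
      (ω ∈ nuSet SF n ∧ ∃ η : Fin r → DF F, (∀ i, η i ∈ omegaPred F n) ∧
        ω = ∑ i, η i * dLog F (b i)))) := by
  have key := res_kernel_iff p hp F E SF SE R r b m hb hm β hβ hgen n
  refine ⟨key, fun ω hω => ?_⟩
  rw [key ω hω, log_form_iff]
end
end
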